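/- arXiv:2605.13567 — 9 statements merged into one kernel-verified Lean document; each statement's English description precedes it below -/
import Mathlib

section
/- The number 4/9 is a non-jump for 3-uniform hypergraphs; that is, for every c > 0 the set Π of Turán densities of nonempty (possibly infinite) families of 3-graphs satisfies Π ∩ (4/9, 4/9 + c) ≠ ∅. -/
/-- A 3-uniform hypergraph (3-graph): a finite collection of 3-element subsets of the
vertex set `Fin n`. -/
structure ThreeGraph where
  n : ℕ
  edges : Finset (Finset (Fin n))
  uniform : ∀ e ∈ edges, e.card = 3

/-- `G` contains a copy of `H` as a subgraph: an injection of the vertices of `H` into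
those of `G` mapping every edge of `H` to an edge of `G`. -/
def ThreeGraph.Contains (G H : ThreeGraph) : Prop :=
  ∃ f : Fin H.n → Fin G.n, Function.Injective f ∧ ∀ e ∈ H.edges, e.image f ∈ G.edges

/-- The Turán number `ex(n, F)`: the maximum number of edges of an `n`-vertex 3-graph
containing no member of `F` as a subgraph. -/
noncomputable def exNum (n : ℕ) (F : Set ThreeGraph) : ℕ :=
  sSup {m : ℕ | ∃ G : ThreeGraph, G.n = n ∧ (∀ H ∈ F, ¬ G.Contains H) ∧ G.edges.card = m}

/-- `L` is the Turán density of the family `F`, i.e. `ex(n,F)/C(n,3) → L`. -/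
def IsTuranDensity (F : Set ThreeGraph) (L : ℝ) : Prop :=
  Filter.Tendsto (fun n : ℕ => (exNum n F : ℝ) / (n.choose 3 : ℝ)) Filter.atTop (nhds L)

/-- The set `Π` of all Turán densities of nonempty (possibly infinite) families of
3-graphs. -/
def TuranDensities : Set ℝ :=
  {L : ℝ | ∃ F : Set ThreeGraph, F.Nonempty ∧ IsTuranDensity F L}

lemma mul_one_sub_add_le {a b e : ℝ} (ha : 0 ≤ a) (hb : 0 ≤ b) (he : 0 ≤ e)
    (h : a ^ 2 + b ^ 2 = 2 * e ^ 2) (he3 : e ≤ 3 / 10) :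
    a * b * (1 - a - b) ≤ e ^ 2 * (1 - 2 * e) := by
  obtain ⟨m, hm⟩ : ∃ m, m = a + b := ⟨_, rfl⟩
  have hab : a * b = (m ^ 2 - 2 * e ^ 2) / 2 := by subst hm; linarith [sq_nonneg (a + b)]
  have hm0 : 0 ≤ m := by subst hm; positivity
  have hm2 : m ≤ 2 * e := by
    refine abs_le_of_sq_le_sq' ?_ (by positivity) |>.2
    subst hm; nlinarith [sq_nonneg (a - b)]
  have : 1 - a - b = 1 - m := by subst hm; ring
  rw [hab, this]
  have key : 0 ≤ (2 * e - m) * ((m + 2 * e) * (1 - m - 2 * e) + 2 * e ^ 2 + 2 * e * m) := by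
    apply mul_nonneg (by linarith)
    have : 0 ≤ (m + 2 * e) * (2 - 3 * m) := by
      apply mul_nonneg <;> nlinarith
    nlinarith [mul_nonneg hm0 he]
  nlinarith [key]

lemma mul_one_sub_add_le_one_div {a b : ℝ} (ha : 0 ≤ a) (hb : 0 ≤ b) (hab : a + b ≤ 1) :
    a * b * (1 - a - b) ≤ 1 / 27 := by
  nlinarith [sq_nonneg (a - b), mul_nonneg (sub_nonneg.2 hab) (sq_nonneg (a - b)),
    mul_nonneg (add_nonneg ha hb) (sq_nonneg (a + b - 2/3)), sq_nonneg (a + b - 2/3)]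

lemma one_sub_two_mul_le_cubic {e : ℝ} (h0 : 0 ≤ e) (h1 : e ≤ 3 / 10) :
    1 - 2 * e ≤ (83 / 20 - 37 / 5 * e) / 4 * (1 - 27 / 32 * ((83 / 20 - 37 / 5 * e) * e ^ 2)) := by
  have h2 := sub_nonneg.2 h1
  nlinarith [sq_nonneg (e * (e - 23/100)), sq_nonneg (e - 23/100), mul_nonneg h0 h2,
    mul_nonneg h0 (sq_nonneg (e - 23/100)), mul_nonneg h2 (sq_nonneg (e - 23/100)),
    mul_nonneg (mul_nonneg h0 h2) (sq_nonneg (e - 23/100))]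

lemma quartic_le_sq_of_linear_eq {e S : ℝ} (h0 : 0 ≤ e) (h1 : e ≤ 3 / 10)
    (hS : S = 83 / 20 - 37 / 5 * e) :
    5 / 2 * (S - 2) * (S ^ 2 - 2) * e ^ 2 ≤ (S / 4 * (1 - 27 / 32 * (S * e ^ 2))) ^ 2 := by
  have h : 5 / 2 * (S - 2) * (S ^ 2 - 2) * e ^ 2 ≤ S ^ 2 / 16 * (1 - 27 / 16 * (S * e ^ 2)) := by
    subst hS
    have h2 := sub_nonneg.2 h1
    have h3 := mul_nonneg h0 h2
    nlinarith [mul_nonneg h0 (sq_nonneg (e * (e - 19/100))),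
      mul_nonneg h2 (sq_nonneg (e * (e - 19/100))), mul_nonneg h0 (sq_nonneg (e - 19/100)),
      mul_nonneg h2 (sq_nonneg (e - 19/100)), h3, mul_nonneg h3 (sq_nonneg (e - 19/100)),
      mul_nonneg h3 (mul_nonneg h0 (sq_nonneg (e - 19/100))),
      mul_nonneg h3 (mul_nonneg h2 (sq_nonneg (e - 19/100)))]
  nlinarith [sq_nonneg (S * (S * e ^ 2))]

lemma le_of_two_bounds {a b h σ : ℝ} (ha : 0 ≤ a) (hb : 0 ≤ b) (hab : a + b ≤ 1)
    (hσ : a ^ 2 + b ^ 2 ≤ σ) (hσ1 : σ ≤ 1)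
    (h1 : h ≤ a * b * (1 - a - b))
    (h2 : h ^ 2 ≤ 5 / 2 * (σ - (a ^ 2 + b ^ 2)) * (σ ^ 2 - (a ^ 2 + b ^ 2) ^ 2 / 2)) :
    h ≤ σ / 4 - 27 / 128 * σ ^ 2 := by
  by_cases hs : 18 / 100 ≤ σ
  · have := mul_one_sub_add_le_one_div ha hb hab
    nlinarith [mul_nonneg (sub_nonneg.2 hs) (sub_nonneg.2 hσ1)]
  push Not at hs
  obtain ⟨e, he0, he⟩ : ∃ e : ℝ, 0 ≤ e ∧ a ^ 2 + b ^ 2 = 2 * e ^ 2 :=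
    ⟨√((a ^ 2 + b ^ 2) / 2), Real.sqrt_nonneg _, by rw [Real.sq_sqrt (by positivity)]; ring⟩
  have he3 : e ≤ 3 / 10 := by nlinarith
  have hσ0 : 0 ≤ σ := le_trans (by positivity) hσ
  replace h1 := h1.trans (mul_one_sub_add_le ha hb he0 he he3)
  rw [he] at hσ h2
  obtain ⟨S, hS⟩ : ∃ S : ℝ, S = 83 / 20 - 37 / 5 * e := ⟨_, rfl⟩
  rcases eq_or_lt_of_le he0 with h0 | hepos
  · subst h0
    nlinarith
  have he2 : 0 < e ^ 2 := by positivity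
  obtain ⟨R, rfl⟩ : ∃ R, σ = R * e ^ 2 := ⟨σ / e ^ 2, by field_simp⟩
  have hR2 : 2 ≤ R := le_of_mul_le_mul_right hσ he2
  by_cases hc : S ≤ R
  · have hq := one_sub_two_mul_le_cubic he0 he3
    rw [← hS] at hq
    have hS0 : 0 < S := by linarith
    have h3 : e ^ 2 * (1 - 2 * e) ≤ e ^ 2 * (S / 4 * (1 - 27 / 32 * (S * e ^ 2))) :=
      mul_le_mul_of_nonneg_left hq he2.le
    have h4 : 0 ≤ (R - S) * e ^ 2 := mul_nonneg (by linarith) he2.le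
    nlinarith [mul_nonneg h4 (by nlinarith : 0 ≤ 1 - 27 / 32 * (R * e ^ 2 + S * e ^ 2))]
  · push Not at hc
    have hq := quartic_le_sq_of_linear_eq he0 he3 hS
    have hpos : 0 ≤ 1 - 27 / 32 * (R * e ^ 2) := by nlinarith
    have hR : 5 / 2 * (R - 2) * (R ^ 2 - 2) * e ^ 2 ≤
        (R / 4 * (1 - 27 / 32 * (R * e ^ 2))) ^ 2 := by
      have hS0 : 0 < S := by linarith
      have e1 : (R - 2) * ((R ^ 2 - 2) * S ^ 2) ≤ (S - 2) * ((S ^ 2 - 2) * R ^ 2) := by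
        apply mul_le_mul (by linarith) _ (mul_nonneg (by nlinarith) (sq_nonneg S)) (by linarith)
        nlinarith
      have e2 : S * (1 - 27 / 32 * (S * e ^ 2)) ≤ S * (1 - 27 / 32 * (R * e ^ 2)) := by
        gcongr
      have hpos' : 0 ≤ 1 - 27 / 32 * (S * e ^ 2) := by
        nlinarith [mul_nonneg he0 (sq_nonneg e)]
      have e3 : (S / 4 * (1 - 27 / 32 * (S * e ^ 2))) ^ 2
          ≤ (S / 4 * (1 - 27 / 32 * (R * e ^ 2))) ^ 2 := by
        gcongr
      have e4 := mul_le_mul_of_nonneg_right (hq.trans e3) (sq_nonneg R)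
      refine le_of_mul_le_mul_right ?_ (by positivity : 0 < S ^ 2)
      nlinarith [mul_le_mul_of_nonneg_right e1 (by positivity : 0 ≤ 5 / 2 * e ^ 2)]
    have : h ^ 2 ≤ (e ^ 2 * (R / 4 * (1 - 27 / 32 * (R * e ^ 2)))) ^ 2 := by
      rw [mul_pow]
      calc _ ≤ _ := h2
        _ = (e ^ 2) ^ 2 * (5 / 2 * (R - 2) * (R ^ 2 - 2) * e ^ 2) := by ring
        _ ≤ _ := by gcongr
    have := (abs_le_of_sq_le_sq' this (by positivity)).2
    linarith

/-- The real inequality behind `sum_prod_le_cube`: `a`, `b` stand for the two largest weights,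
`s` and `σ` for the sums of the weights and of their squares. -/
lemma cube_bound {a b h s σ y : ℝ} (ha : 0 ≤ a) (hb : 0 ≤ b) (hs : 0 < s) (hy : 0 ≤ y)
    (hab : a + b ≤ s) (hσ : a ^ 2 + b ^ 2 ≤ σ) (hσ1 : σ ≤ s ^ 2)
    (h1 : h ≤ a * b * (s - a - b))
    (h2 : h ^ 2 ≤ 5 / 2 * (σ - (a ^ 2 + b ^ 2)) * (σ ^ 2 - (a ^ 2 + b ^ 2) ^ 2 / 2)) :
    y * ((s ^ 2 - σ) / 2) + h ≤ 2 / 27 * (s + y) ^ 3 := by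
  obtain ⟨a, rfl⟩ : ∃ t, a = t * s := ⟨a / s, by field_simp⟩
  obtain ⟨b, rfl⟩ : ∃ t, b = t * s := ⟨b / s, by field_simp⟩
  obtain ⟨y, rfl⟩ : ∃ t, y = t * s := ⟨y / s, by field_simp⟩
  obtain ⟨σ, rfl⟩ : ∃ t, σ = t * s ^ 2 := ⟨σ / s ^ 2, by field_simp⟩
  obtain ⟨h, rfl⟩ : ∃ t, h = t * s ^ 3 := ⟨h / s ^ 3, by field_simp⟩
  have ha' : 0 ≤ a := nonneg_of_mul_nonneg_left ha hs
  have hb' : 0 ≤ b := nonneg_of_mul_nonneg_left hb hs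
  have hy' : 0 ≤ y := nonneg_of_mul_nonneg_left hy hs
  have h3 : 0 < s ^ 3 := by positivity
  have key : h ≤ σ / 4 - 27 / 128 * σ ^ 2 := by
    apply le_of_two_bounds ha' hb'
    · exact le_of_mul_le_mul_right (by linarith) hs
    · exact le_of_mul_le_mul_right (by linarith) (by positivity : 0 < s ^ 2)
    · exact le_of_mul_le_mul_right (by linarith) (by positivity : 0 < s ^ 2)
    · exact le_of_mul_le_mul_right (by linarith) h3
    · exact le_of_mul_le_mul_right (by linarith) (by positivity : 0 < s ^ 6)
  have : y * ((1 - σ) / 2) + h ≤ 2 / 27 * (1 + y) ^ 3 := by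
    nlinarith [sq_nonneg (8 / 27 * (y - 1 / 2) + σ / 4), mul_nonneg hy' (sq_nonneg (y - 1 / 2))]
  nlinarith [mul_le_mul_of_nonneg_right this h3.le]

open Finset in
lemma exists_subset_sub_card_ge {α : Type*} [DecidableEq α] (T : Finset α) (B : Finset (Finset α))
    (hB : ∀ E ∈ B, E ⊆ T) {p : ℝ} (hp0 : 0 ≤ p) (hp1 : p ≤ 1) :
    ∃ H ⊆ T, p * #T - ∑ E ∈ B, p ^ #E ≤ #H - #{E ∈ B | E ⊆ H} := by
  let F : (α → ℝ) → ℝ := fun x => ∑ e ∈ T, x e - ∑ E ∈ B, ∏ e ∈ E, x e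
  have hF : ∀ (x : α → ℝ) (a : α), ∃ c d : ℝ, ∀ t, F (Function.update x a t) = c + d * t := by
    intro x a
    have h1 : ∃ c d : ℝ, ∀ t, ∑ e ∈ T, Function.update x a t e = c + d * t := by
      by_cases ha : a ∈ T
      · exact ⟨∑ e ∈ T \ {a}, x e, 1, fun t => by rw [sum_update_of_mem ha]; ring⟩
      · exact ⟨∑ e ∈ T, x e, 0, fun t => by rw [sum_update_of_notMem ha]; ring⟩
    have h2 : ∀ E : Finset α, ∃ c d : ℝ, ∀ t, ∏ e ∈ E, Function.update x a t e = c + d * t := by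
      intro E
      by_cases ha : a ∈ E
      · exact ⟨0, ∏ e ∈ E \ {a}, x e, fun t => by rw [prod_update_of_mem ha]; ring⟩
      · exact ⟨∏ e ∈ E, x e, 0, fun t => by rw [prod_update_of_notMem ha]; ring⟩
    obtain ⟨c, d, h1⟩ := h1
    choose c' d' h2 using h2
    refine ⟨c - ∑ E ∈ B, c' E, d - ∑ E ∈ B, d' E, fun t => ?_⟩
    simp only [F, h1, h2, sum_add_distrib, ← sum_mul]
    ring
  have key : ∀ U : Finset α, ∃ x : α → ℝ, (∀ e ∈ U, x e = 0 ∨ x e = 1) ∧ (∀ e ∉ U, x e = p) ∧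
      F (fun _ => p) ≤ F x := by
    intro U
    induction U using Finset.induction_on with
    | empty => exact ⟨fun _ => p, by simp, by simp, le_rfl⟩
    | insert a U ha ih =>
      obtain ⟨x, hx1, hx2, hx3⟩ := ih
      obtain ⟨c, d, h⟩ := hF x a
      have hx : F x = c + d * p := by rw [← h p, ← hx2 a ha, Function.update_eq_self]
      obtain ⟨t, ht, htd⟩ : ∃ t : ℝ, (t = 0 ∨ t = 1) ∧ d * p ≤ d * t := by
        rcases le_total 0 d with hd | hd
        · exact ⟨1, by simp, by nlinarith⟩
        · exact ⟨0, by simp, by nlinarith⟩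
      refine ⟨Function.update x a t, fun e he => ?_, fun e he => ?_, ?_⟩
      · rcases eq_or_ne e a with rfl | hea
        · simpa using ht
        · simpa [hea] using hx1 e (by simpa [hea] using he)
      · simp only [mem_insert, not_or] at he
        simpa [he.1] using hx2 e he.2
      · rw [h]; linarith
  obtain ⟨x, hx1, -, hx3⟩ := key T
  refine ⟨T.filter (x · = 1), filter_subset _ _, ?_⟩
  have e1 : F (fun _ => p) = p * #T - ∑ E ∈ B, p ^ #E := by
    simp [F, mul_comm]
  have e2 : ∑ e ∈ T, x e = #(T.filter (x · = 1)) := by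
    rw [card_filter]; push_cast
    refine sum_congr rfl fun e he => ?_
    rcases hx1 e he with h | h <;> simp [h]
  have e3 : ∑ E ∈ B, ∏ e ∈ E, x e = #{E ∈ B | E ⊆ T.filter (x · = 1)} := by
    rw [card_filter]; push_cast
    refine sum_congr rfl fun E hE => ?_
    split_ifs with h
    · exact prod_eq_one fun e he => (mem_filter.1 (h he)).2
    · obtain ⟨e, he, he'⟩ := not_subset.1 h
      refine prod_eq_zero he ?_
      rcases hx1 e (hB E hE he) with h | h
      · exact h
      · exact absurd (mem_filter.2 ⟨hB E hE he, h⟩) he'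
  rw [← e1, ← e2, ← e3]
  exact hx3

open Finset in
/-- The deletion method. -/
lemma exists_subset_avoiding {α : Type*} [DecidableEq α] (T : Finset α) (B : Finset (Finset α))
    (hB : ∀ E ∈ B, E ⊆ T) (hne : ∀ E ∈ B, E.Nonempty) {p : ℝ} (hp0 : 0 ≤ p) (hp1 : p ≤ 1) :
    ∃ H ⊆ T, (∀ E ∈ B, ¬ E ⊆ H) ∧ p * #T - ∑ E ∈ B, p ^ #E ≤ #H := by
  obtain ⟨H, hHT, hH⟩ := exists_subset_sub_card_ge T B hB hp0 hp1
  obtain hα | ⟨⟨a⟩⟩ := isEmpty_or_nonempty α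
  · have hB0 : B = ∅ := eq_empty_of_forall_notMem fun E hE => hα.false (hne E hE).choose
    refine ⟨T, Subset.rfl, by simp [hB0], ?_⟩
    simp only [hB0, sum_empty, sub_zero]
    exact mul_le_of_le_one_left (by positivity) hp1
  have : Nonempty α := ⟨a⟩
  choose! g hg using hne
  refine ⟨H \ ({E ∈ B | E ⊆ H}).image g, sdiff_subset.trans hHT, fun E hE hEH => ?_, ?_⟩
  · have := hEH (hg E hE)
    rw [mem_sdiff] at this
    exact this.2 (mem_image_of_mem g (mem_filter.2 ⟨hE, hEH.trans sdiff_subset⟩))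
  · have h1 := le_card_sdiff (({E ∈ B | E ⊆ H}).image g) H
    have h2 : #(({E ∈ B | E ⊆ H}).image g) ≤ #{E ∈ B | E ⊆ H} := card_image_le
    have h3 : #H ≤ #(H \ ({E ∈ B | E ⊆ H}).image g) + #{E ∈ B | E ⊆ H} := by omega
    have h4 : (#H : ℝ) ≤ #(H \ ({E ∈ B | E ⊆ H}).image g) + #{E ∈ B | E ⊆ H} := by
      exact_mod_cast h3
    linarith

lemma cast_choose_three (n : ℕ) : (n.choose 3 : ℝ) = n * (n - 1) * (n - 2) / 6 := by
  rw [Nat.cast_choose_eq_descPochhammer_div]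
  simp [descPochhammer_succ_right, Nat.factorial]

open Finset in
lemma sum_biUnion_le_sum_sum {ι α : Type*} [DecidableEq α] (s : Finset ι) (t : ι → Finset α)
    {f : α → ℝ} (hf : ∀ a, 0 ≤ f a) : ∑ a ∈ s.biUnion t, f a ≤ ∑ i ∈ s, ∑ a ∈ t i, f a := by
  classical
  induction s using Finset.induction_on with
  | empty => simp
  | insert i s hi ih =>
    rw [biUnion_insert, sum_insert hi]
    have h := sum_union_inter (s₁ := t i) (s₂ := s.biUnion t) (f := f)
    have h' : 0 ≤ ∑ a ∈ t i ∩ s.biUnion t, f a := sum_nonneg fun a _ => hf a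
    linarith

open Finset in
lemma card_filter_superset_pair_le {n : ℕ} {q : Finset (Fin n)} (hq : #q = 2) :
    #{e ∈ powersetCard 3 (univ : Finset (Fin n)) | q ⊆ e} ≤ n := by
  have : #(powersetCard 1 (univ : Finset (Fin n))) = n := by simp
  refine le_of_le_of_eq ?_ this
  refine card_le_card_of_injOn (· \ q) (fun e he => ?_) fun e he e' he' h => ?_
  · simp only [coe_filter, mem_powersetCard_univ, Set.mem_ofPred_eq] at he
    simp [card_sdiff_of_subset he.2, he.1, hq]
  · simp only [coe_filter, mem_powersetCard_univ, Set.mem_ofPred_eq] at he he'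
    rw [← sdiff_union_of_subset he.2, ← sdiff_union_of_subset he'.2]
    exact congrArg (· ∪ q) h

open Finset in
lemma sum_pow_bad_pairs_le {n : ℕ} (hn : 0 < n) :
    ∑ E ∈ (powersetCard 2 (univ : Finset (Fin n))).biUnion fun q =>
      powersetCard 6 {e ∈ powersetCard 3 univ | q ⊆ e}, (2 / n : ℝ) ^ #E ≤ 2 / 45 * n ^ 2 := by
  have hn' : (0 : ℝ) < n := by exact_mod_cast hn
  refine (sum_biUnion_le_sum_sum _ _ fun E => by positivity).trans ?_
  have h1 : ∀ q ∈ powersetCard 2 (univ : Finset (Fin n)),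
      ∑ E ∈ powersetCard 6 {e ∈ powersetCard 3 (univ : Finset (Fin n)) | q ⊆ e},
        (2 / n : ℝ) ^ #E ≤ (n : ℝ) ^ 6 / 720 * (2 / n) ^ 6 := by
    intro q hq
    rw [sum_congr rfl fun E hE => by rw [(mem_powersetCard.1 hE).2]]
    rw [sum_const, card_powersetCard, nsmul_eq_mul]
    gcongr
    calc (((#{e ∈ powersetCard 3 (univ : Finset (Fin n)) | q ⊆ e}).choose 6 : ℕ) : ℝ)
        ≤ (n.choose 6 : ℕ) := by
          exact_mod_cast Nat.choose_le_choose _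
            (card_filter_superset_pair_le (mem_powersetCard.1 hq).2)
      _ ≤ _ := by simpa [Nat.factorial] using Nat.choose_le_pow_div (α := ℝ) 6 n
  refine (sum_le_sum h1).trans ?_
  rw [sum_const, card_powersetCard, nsmul_eq_mul, card_univ, Fintype.card_fin]
  have h2 : (n.choose 2 : ℝ) ≤ n ^ 2 / 2 := by
    simpa [Nat.factorial] using Nat.choose_le_pow_div (α := ℝ) 2 n
  calc (n.choose 2 : ℝ) * ((n : ℝ) ^ 6 / 720 * (2 / n : ℝ) ^ 6)
      ≤ (n : ℝ) ^ 2 / 2 * ((n : ℝ) ^ 6 / 720 * (2 / n : ℝ) ^ 6) := by gcongr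
    _ = 2 / 45 * (n : ℝ) ^ 2 := by field_simp; norm_num

open Finset in
lemma sum_pow_dense_sets_le {n : ℕ} (hn : 0 < n) (K : ℕ) :
    ∑ E ∈ (Icc 3 K).biUnion fun j => (powersetCard j (univ : Finset (Fin n))).biUnion fun X =>
      powersetCard (j - 1) (powersetCard 3 X), (2 / n : ℝ) ^ #E ≤
      n * ∑ j ∈ Icc 3 K, ((j.choose 3).choose (j - 1) * 2 ^ (j - 1) : ℕ) := by
  have hn' : (0 : ℝ) < n := by exact_mod_cast hn
  refine (sum_biUnion_le_sum_sum _ _ fun E => by positivity).trans ?_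
  push_cast
  rw [mul_sum]
  refine sum_le_sum fun j hj => ?_
  refine (sum_biUnion_le_sum_sum _ _ fun E => by positivity).trans ?_
  have h1 : ∀ X ∈ powersetCard j (univ : Finset (Fin n)),
      ∑ E ∈ powersetCard (j - 1) (powersetCard 3 X), (2 / n : ℝ) ^ #E =
        (j.choose 3).choose (j - 1) * (2 / n) ^ (j - 1) := by
    intro X hX
    rw [sum_congr rfl fun E hE => by rw [(mem_powersetCard.1 hE).2]]
    rw [sum_const, card_powersetCard, card_powersetCard, nsmul_eq_mul, (mem_powersetCard.1 hX).2]
  rw [sum_congr rfl h1, sum_const, card_powersetCard, nsmul_eq_mul, card_univ, Fintype.card_fin]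
  have h2 : (n.choose j : ℝ) ≤ n ^ j := by exact_mod_cast Nat.choose_le_pow n j
  obtain ⟨i, rfl⟩ : ∃ i, j = i + 1 := ⟨j - 1, by rw [mem_Icc] at hj; omega⟩
  calc (n.choose (i + 1) : ℝ) * (((i + 1).choose 3).choose (i + 1 - 1) * (2 / n) ^ (i + 1 - 1))
      ≤ n ^ (i + 1) * (((i + 1).choose 3).choose (i + 1 - 1) * (2 / n) ^ (i + 1 - 1)) := by gcongr
    _ = _ := by
      simp only [add_tsub_cancel_right, div_pow]
      field_simp
      ring

open Finset in
/-- Sparse 3-graphs with quadratically many edges. -/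
lemma exists_locally_sparse (K : ℕ) : ∃ (n : ℕ) (H : Finset (Finset (Fin n))),
    0 < n ∧ (∀ e ∈ H, #e = 3) ∧ n ^ 2 < 4 * #H ∧
    (∀ q : Finset (Fin n), #q = 2 → #{e ∈ H | q ⊆ e} ≤ 5) ∧
    ∀ E ⊆ H, E.Nonempty → #(E.biUnion id) ≤ K → #E + 2 ≤ #(E.biUnion id) := by
  set c : ℕ := ∑ j ∈ Icc 3 K, ((j.choose 3).choose (j - 1) * 2 ^ (j - 1) : ℕ) with hc
  obtain ⟨n, hn⟩ : ∃ n, n = 30 * (c + 2) := ⟨_, rfl⟩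
  have hn0 : 0 < n := by omega
  have hn' : (n : ℝ) = 30 * (c + 2) := by rw [hn]; push_cast; ring
  have hn0' : (0 : ℝ) < n := by exact_mod_cast hn0
  set B1 := (powersetCard 2 (univ : Finset (Fin n))).biUnion fun q =>
      powersetCard 6 {e ∈ powersetCard 3 univ | q ⊆ e} with hB1
  set B2 := (Icc 3 K).biUnion fun j => (powersetCard j (univ : Finset (Fin n))).biUnion fun X =>
      powersetCard (j - 1) (powersetCard 3 X) with hB2
  obtain ⟨H, hHT, hH1, hH2⟩ := exists_subset_avoiding (powersetCard 3 (univ : Finset (Fin n)))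
    (B1 ∪ B2) (p := 2 / n) (by
      intro E hE
      rcases mem_union.1 hE with h | h
      · simp only [hB1, mem_biUnion, mem_powersetCard] at h
        obtain ⟨q, -, h, -⟩ := h
        exact h.trans (filter_subset _ _)
      · simp only [hB2, mem_biUnion, mem_powersetCard] at h
        obtain ⟨j, -, X, -, h, -⟩ := h
        exact h.trans (powersetCard_mono (subset_univ _))) (by
      intro E hE
      rw [← card_pos]
      rcases mem_union.1 hE with h | h
      · simp only [hB1, mem_biUnion, mem_powersetCard] at h
        obtain ⟨q, -, -, h⟩ := h
        omega
      · simp only [hB2, mem_biUnion, mem_powersetCard, mem_Icc] at h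
        obtain ⟨j, hj, X, -, -, h⟩ := h
        omega) (by positivity) (by
      rw [div_le_one hn0', hn']
      have : (0 : ℝ) ≤ c := by positivity
      linarith)
  have hcard : ∀ e ∈ H, #e = 3 := fun e he => (mem_powersetCard.1 (hHT he)).2
  refine ⟨n, H, hn0, hcard, ?_, fun q hq => ?_, fun E hEH hE hEK => ?_⟩
  · have h1 : ∑ E ∈ B1 ∪ B2, (2 / n : ℝ) ^ #E ≤ 2 / 45 * n ^ 2 + n * c := by
      have h := sum_union_inter (s₁ := B1) (s₂ := B2) (f := fun E => (2 / n : ℝ) ^ #E)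
      have h' : 0 ≤ ∑ E ∈ B1 ∩ B2, (2 / n : ℝ) ^ #E := sum_nonneg fun a _ => by positivity
      have h1 := sum_pow_bad_pairs_le hn0
      have h2 := sum_pow_dense_sets_le hn0 K
      rw [← hB1] at h1
      rw [← hB2, ← hc] at h2
      linarith
    rw [card_powersetCard, card_univ, Fintype.card_fin, cast_choose_three] at hH2
    have h4 : 2 / n * ((n : ℝ) * (n - 1) * (n - 2) / 6) = (n - 1) * (n - 2) / 3 := by
      field_simp; ring
    rw [h4] at hH2
    have h5 : (n : ℝ) ^ 2 < 4 * #H := by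
      have : (0 : ℝ) ≤ c := by positivity
      nlinarith
    exact_mod_cast h5
  · by_contra! h
    obtain ⟨E, hE, hE6⟩ := exists_subset_card_eq (n := 6) (show 6 ≤ #{e ∈ H | q ⊆ e} by omega)
    refine hH1 E (mem_union_left _ ?_) (hE.trans (filter_subset _ _))
    simp only [hB1, mem_biUnion, mem_powersetCard]
    exact ⟨q, ⟨subset_univ _, hq⟩, hE.trans (filter_subset_filter _ hHT), hE6⟩
  · by_contra! h
    have h3 : 3 ≤ #(E.biUnion id) := by
      obtain ⟨e, he⟩ := hE
      rw [← hcard e (hEH he)]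
      exact card_le_card (subset_biUnion_of_mem id he)
    obtain ⟨E', hE', hE'c⟩ := exists_subset_card_eq (n := #(E.biUnion id) - 1)
      (show #(E.biUnion id) - 1 ≤ #E by omega)
    refine hH1 E' (mem_union_right _ ?_) (hE'.trans hEH)
    simp only [hB2, mem_biUnion, mem_powersetCard, mem_Icc]
    refine ⟨_, ⟨h3, hEK⟩, E.biUnion id, ⟨subset_univ _, rfl⟩, fun e he => ?_, hE'c⟩
    exact mem_powersetCard.2 ⟨subset_biUnion_of_mem id (hE' he), hcard e (hEH (hE' he))⟩

open Finset in
lemma sum_powersetCard_two_prod {V : Type*} [DecidableEq V] (S : Finset V) (c : V → ℝ) :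
    ∑ q ∈ powersetCard 2 S, ∏ w ∈ q, c w = ((∑ w ∈ S, c w) ^ 2 - ∑ w ∈ S, c w ^ 2) / 2 := by
  induction S using Finset.induction_on with
  | empty =>
    have : powersetCard 2 (∅ : Finset V) = ∅ := powersetCard_eq_empty.2 (by simp)
    simp [this]
  | insert a S ha ih =>
    have hinj : Set.InjOn (insert a) (powersetCard 1 S : Set (Finset V)) := by
      intro q hq q' hq' h
      have hq := (mem_powersetCard.1 (mem_coe.1 hq)).1
      have hq' := (mem_powersetCard.1 (mem_coe.1 hq')).1
      rw [← erase_insert fun h => ha (hq h), h, erase_insert fun h => ha (hq' h)]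
    have hdisj : Disjoint (powersetCard 2 S) ((powersetCard 1 S).image (insert a)) := by
      rw [disjoint_left]
      intro q hq hq'
      obtain ⟨q', -, rfl⟩ := mem_image.1 hq'
      exact ha ((mem_powersetCard.1 hq).1 (mem_insert_self a q'))
    rw [powersetCard_succ_insert ha, sum_union hdisj, sum_image hinj, ih, sum_insert ha,
      sum_insert ha, powersetCard_one, sum_map]
    have : ∀ w ∈ S, ∏ x ∈ insert a {w}, c x = c a * c w := by
      intro w hw
      rw [prod_pair]
      rintro rfl
      exact ha hw
    simp only [Function.Embedding.coeFn_mk]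
    rw [sum_congr rfl this, ← mul_sum]
    ring

open Finset in
lemma exists_system_of_representatives {V : Type*} [DecidableEq V] (H : Finset (Finset V))
    (hH : ∀ E ⊆ H, E.Nonempty → #E + 2 ≤ #(E.biUnion id)) (Q : Finset V) (hQ : #Q ≤ 2)
    (hne : H.Nonempty) :
    ∃ v : Finset V → V, Set.InjOn v H ∧ ∀ e ∈ H, v e ∈ e ∧ v e ∉ Q := by
  have hall := (all_card_le_biUnion_card_iff_exists_injective
    (fun e : {e // e ∈ H} => (e : Finset V) \ Q)).1 (by
      intro s
      rcases s.eq_empty_or_nonempty with rfl | hs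
      · simp
      have h1 := hH (s.image Subtype.val) (by
        intro e he
        obtain ⟨e', -, rfl⟩ := mem_image.1 he
        exact e'.2) (hs.image _)
      rw [card_image_of_injective _ Subtype.val_injective] at h1
      have h2 : s.biUnion (fun e => (e : Finset V) \ Q) =
          (s.image Subtype.val).biUnion id \ Q := by
        ext w
        simp only [mem_biUnion, mem_sdiff, mem_image, id]
        grind
      rw [h2]
      have h3 := le_card_sdiff Q ((s.image Subtype.val).biUnion id)
      omega)
  obtain ⟨f, hf, hf'⟩ := hall
  obtain ⟨e₀, he₀⟩ := hne
  refine ⟨fun e => if h : e ∈ H then f ⟨e, h⟩ else f ⟨e₀, he₀⟩, fun e he e' he' h => ?_,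
    fun e he => ?_⟩
  · rw [mem_coe] at he he'
    simp only [he, he', dif_pos] at h
    exact congrArg Subtype.val (hf h)
  · simp only [he, dif_pos]
    exact mem_sdiff.1 (hf' ⟨e, he⟩)

open Finset in
/-- The Lagrangian-type inequality for locally sparse 3-graphs. -/
lemma sum_prod_le_cube {V : Type*} [Fintype V] [DecidableEq V] (K : ℕ) (H : Finset (Finset V))
    (h3 : ∀ e ∈ H, #e = 3) (hdeg : ∀ q : Finset V, #q = 2 → #{e ∈ H | q ⊆ e} ≤ 5)
    (hsp : ∀ E ⊆ H, E.Nonempty → #(E.biUnion id) ≤ K → #E + 2 ≤ #(E.biUnion id))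
    (c : V → ℝ) (hc : ∀ w, 0 ≤ c w) (hX : #{w | c w ≠ 0} ≤ K) {y : ℝ} (hy : 0 ≤ y) :
    y * ∑ q ∈ powersetCard 2 univ, ∏ w ∈ q, c w + ∑ e ∈ H, ∏ w ∈ e, c w ≤
      2 / 27 * (∑ w, c w + y) ^ 3 := by
  rw [sum_powersetCard_two_prod]
  set s := ∑ w, c w with hs
  set σ := ∑ w, c w ^ 2 with hσ
  have hs0 : 0 ≤ s := sum_nonneg fun w _ => hc w
  have hσ0 : 0 ≤ σ := sum_nonneg fun w _ => by positivity
  set H' := {e ∈ H | ∀ w ∈ e, c w ≠ 0} with hH'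
  have hsum : ∑ e ∈ H, ∏ w ∈ e, c w = ∑ e ∈ H', ∏ w ∈ e, c w := by
    rw [hH', sum_filter]
    refine sum_congr rfl fun e _ => ?_
    split_ifs with h
    · rfl
    · push Not at h
      obtain ⟨w, hw, hw0⟩ := h
      exact prod_eq_zero hw hw0
  rw [hsum]
  rcases H'.eq_empty_or_nonempty with h0 | hne
  · rw [h0, sum_empty]
    have : 0 ≤ (s - 2 * y) ^ 2 * (s + y / 4) := by positivity
    nlinarith [mul_nonneg hy hσ0]
  have hH'H : H' ⊆ H := filter_subset _ _
  obtain ⟨e₀, he₀⟩ := hne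
  have he₀3 := h3 e₀ (hH'H he₀)
  obtain ⟨w₀, hw₀⟩ : e₀.Nonempty := by rw [← card_pos]; omega
  have hspos : 0 < s := lt_of_lt_of_le
    (lt_of_le_of_ne (hc w₀) ((mem_filter.1 he₀).2 w₀ hw₀).symm)
    (single_le_sum (fun w _ => hc w) (mem_univ w₀))
  obtain ⟨u₁, -, hu₁⟩ := exists_max_image univ c ⟨w₀, mem_univ _⟩
  obtain ⟨u₂, hu₂, hu₂'⟩ := exists_max_image (univ.erase u₁) c (by
    rw [← card_pos]
    have h1 : #(e₀.erase u₁) ≤ #((univ : Finset V).erase u₁) :=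
      card_le_card (erase_subset_erase _ (subset_univ _))
    have h2 := pred_card_le_card_erase (a := u₁) (s := e₀)
    omega)
  have hu : u₁ ≠ u₂ := (ne_of_mem_erase hu₂).symm
  have hQ : #({u₁, u₂} : Finset V) = 2 := card_pair hu
  obtain ⟨v, hv, hv'⟩ := exists_system_of_representatives H' (fun E hE hEne =>
    hsp E (hE.trans hH'H) hEne (le_trans (card_le_card fun w hw => by
      obtain ⟨e, he, hwe⟩ := mem_biUnion.1 hw
      exact mem_filter.2 ⟨mem_univ _, (mem_filter.1 (hE he)).2 w hwe⟩) hX))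
    {u₁, u₂} hQ.le ⟨e₀, he₀⟩
  have hsplit : ∀ f : V → ℝ, ∑ w, f w = f u₁ + f u₂ + ∑ w ∈ univ \ {u₁, u₂}, f w := by
    intro f
    rw [← sum_sdiff (subset_univ ({u₁, u₂} : Finset V)), sum_pair hu]
    ring
  have hrep : ∀ f : V → ℝ, (∀ w, 0 ≤ f w) → ∑ e ∈ H', f (v e) ≤ ∑ w ∈ univ \ {u₁, u₂}, f w := by
    intro f hf
    rw [← sum_image hv]
    refine sum_le_sum_of_subset_of_nonneg (fun w hw => ?_) fun w _ _ => hf w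
    obtain ⟨e, he, rfl⟩ := mem_image.1 hw
    exact mem_sdiff.2 ⟨mem_univ _, (hv' e he).2⟩
  have hprod : ∀ e ∈ H', ∏ w ∈ e, c w = c (v e) * ∏ w ∈ e.erase (v e), c w := fun e he =>
    (mul_prod_erase e c (hv' e he).1).symm
  have hcard : ∀ e ∈ H', #(e.erase (v e)) = 2 := fun e he => by
    rw [card_erase_of_mem (hv' e he).1, h3 e (hH'H he)]
  rw [sum_congr rfl hprod]
  have hs2 := hsplit c
  have hσ2 := hsplit (fun w => c w ^ 2)
  have hrest : 0 ≤ ∑ w ∈ univ \ {u₁, u₂}, c w := sum_nonneg fun w _ => hc w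
  have hrest2 : 0 ≤ ∑ w ∈ univ \ {u₁, u₂}, c w ^ 2 := sum_nonneg fun w _ => by positivity
  refine cube_bound (a := c u₁) (b := c u₂) (hc _) (hc _) hspos hy (by linarith) (by linarith)
    ?_ ?_ ?_
  · have := sum_powersetCard_two_prod univ c
    have h0 : 0 ≤ ∑ q ∈ powersetCard 2 univ, ∏ w ∈ q, c w :=
      sum_nonneg fun q _ => prod_nonneg fun w _ => hc w
    linarith
  · have h1 : ∀ e ∈ H', c (v e) * ∏ w ∈ e.erase (v e), c w ≤ c (v e) * (c u₁ * c u₂) := by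
      intro e he
      refine mul_le_mul_of_nonneg_left ?_ (hc _)
      obtain ⟨p, q, hpq, h⟩ := card_eq_two.1 (hcard e he)
      rw [h, prod_pair hpq]
      have hle : ∀ w, w ≠ u₁ → c w ≤ c u₂ := fun w hw => hu₂' w (mem_erase.2 ⟨hw, mem_univ _⟩)
      rcases eq_or_ne q u₁ with rfl | hq
      · rw [mul_comm]
        exact mul_le_mul_of_nonneg_left (hle p hpq) (hc _)
      · exact mul_le_mul (hu₁ p (mem_univ _)) (hle q hq) (hc _) (hc _)
    refine (sum_le_sum h1).trans ?_
    rw [← sum_mul, mul_comm]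
    refine mul_le_mul_of_nonneg_left ((hrep c hc).trans (by linarith)) (mul_nonneg (hc _) (hc _))
  · have h1 := sum_mul_sq_le_sq_mul_sq H' (fun e => c (v e)) fun e => ∏ w ∈ e.erase (v e), c w
    have h2 : ∑ e ∈ H', c (v e) ^ 2 ≤ σ - (c u₁ ^ 2 + c u₂ ^ 2) := by
      have := hrep (fun w => c w ^ 2) fun w => by positivity
      linarith
    have h4 : ∑ e ∈ H', (∏ w ∈ e.erase (v e), c w) ^ 2 ≤
        ∑ q ∈ powersetCard 2 univ, 5 * ∏ w ∈ q, c w ^ 2 := by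
      rw [← sum_fiberwise_of_maps_to (s := H') (t := powersetCard 2 univ)
        (g := fun e => e.erase (v e))
        fun e he => mem_powersetCard.2 ⟨subset_univ _, hcard e he⟩]
      refine sum_le_sum fun q hq => ?_
      have h5 : ∀ e ∈ {e ∈ H' | e.erase (v e) = q},
          (∏ w ∈ e.erase (v e), c w) ^ 2 = ∏ w ∈ q, c w ^ 2 := by
        intro e he
        rw [(mem_filter.1 he).2, prod_pow]
      rw [sum_congr rfl h5, sum_const, nsmul_eq_mul]
      refine mul_le_mul_of_nonneg_right ?_ (prod_nonneg fun w _ => by positivity)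
      have h6 : #{e ∈ H' | e.erase (v e) = q} ≤ 5 := by
        refine (card_le_card fun e he => ?_).trans (hdeg q (mem_powersetCard.1 hq).2)
        rw [mem_filter] at he ⊢
        exact ⟨hH'H he.1, he.2 ▸ erase_subset _ _⟩
      exact_mod_cast h6
    rw [← mul_sum, sum_powersetCard_two_prod] at h4
    have h5 : (c u₁ ^ 2 + c u₂ ^ 2) ^ 2 / 2 ≤ ∑ w, (c w ^ 2) ^ 2 := by
      have h6 := hsplit (fun w => (c w ^ 2) ^ 2)
      have h7 : 0 ≤ ∑ w ∈ univ \ {u₁, u₂}, (c w ^ 2) ^ 2 := sum_nonneg fun w _ => by positivity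
      nlinarith [sq_nonneg (c u₁ ^ 2 - c u₂ ^ 2)]
    calc _ ≤ (∑ e ∈ H', c (v e) ^ 2) * ∑ e ∈ H', (∏ w ∈ e.erase (v e), c w) ^ 2 := h1
      _ ≤ (σ - (c u₁ ^ 2 + c u₂ ^ 2)) *
          (5 / 2 * (σ ^ 2 - (c u₁ ^ 2 + c u₂ ^ 2) ^ 2 / 2)) := by
        refine mul_le_mul h2 (h4.trans (by linarith)) (sum_nonneg fun e _ => by positivity) ?_
        linarith
      _ = _ := by ring

open Finset in
lemma card_transversals {α W : Type*} [DecidableEq α] [DecidableEq W] (π : α → W) (S : Finset α)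
    (E : Finset W) :
    #{e ∈ powersetCard #E S | e.image π = E} = ∏ w ∈ E, #{x ∈ S | π x = w} := by
  rw [← card_pi]
  symm
  have hπ : ∀ f ∈ E.pi fun w => {x ∈ S | π x = w}, ∀ w hw, f w hw ∈ S ∧ π (f w hw) = w :=
    fun f hf w hw => mem_filter.1 (mem_pi.1 hf w hw)
  have hcard : ∀ f ∈ E.pi fun w => {x ∈ S | π x = w},
      #(E.attach.image fun w => f w.1 w.2) = #E := by
    intro f hf
    rw [card_image_of_injective, card_attach]
    intro w w' h
    have h' := congrArg π h
    simp only [(hπ f hf _ _).2] at h'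
    exact Subtype.ext h'
  refine card_bij (fun f _ => E.attach.image fun w => f w.1 w.2) (fun f hf => ?_)
    (fun f hf g hg h => ?_) fun e he => ?_
  · rw [mem_filter, mem_powersetCard]
    refine ⟨⟨fun x hx => ?_, hcard f hf⟩, ?_⟩
    · obtain ⟨w, -, rfl⟩ := mem_image.1 hx
      exact (hπ f hf _ _).1
    · rw [image_image]
      ext w
      simp only [mem_image, mem_attach, true_and, Function.comp_apply, (hπ f hf _ _).2]
      exact ⟨fun ⟨a, ha⟩ => ha ▸ a.2, fun hw => ⟨⟨w, hw⟩, rfl⟩⟩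
  · funext w hw
    have h1 : f w hw ∈ E.attach.image fun w => g w.1 w.2 := by
      rw [← h]
      exact mem_image.2 ⟨⟨w, hw⟩, mem_attach _ _, rfl⟩
    obtain ⟨w', -, h2⟩ := mem_image.1 h1
    have h3 := congrArg π h2
    simp only [(hπ f hf _ _).2, (hπ g hg _ _).2] at h3
    subst h3
    exact h2.symm
  · obtain ⟨he, rfl⟩ := mem_filter.1 he
    obtain ⟨heS, hec⟩ := mem_powersetCard.1 he
    have hex : ∀ w ∈ e.image π, ∃ x ∈ e, π x = w := fun w hw => mem_image.1 hw
    choose g hg hg' using hex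
    have hgm : g ∈ (e.image π).pi fun w => {x ∈ S | π x = w} :=
      mem_pi.2 fun w hw => mem_filter.2 ⟨heS (hg w hw), hg' w hw⟩
    refine ⟨g, hgm, eq_of_subset_of_card_le (fun x hx => ?_) ?_⟩
    · obtain ⟨w, -, rfl⟩ := mem_image.1 hx
      exact hg _ _
    · rw [hcard g hgm, hec]

open Finset in
lemma card_blowup_edges {α W : Type*} [DecidableEq α] [DecidableEq W] (π : α → W) (S : Finset α)
    {k : ℕ} (P : Finset (Finset W)) (hP : ∀ E ∈ P, #E = k) :
    #{e ∈ powersetCard k S | e.image π ∈ P} = ∑ E ∈ P, ∏ w ∈ E, #{x ∈ S | π x = w} := by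
  have hmaps : ∀ e ∈ {e ∈ powersetCard k S | e.image π ∈ P}, e.image π ∈ P :=
    fun e he => (mem_filter.1 he).2
  rw [card_eq_sum_card_fiberwise hmaps]
  refine sum_congr rfl fun E hE => ?_
  rw [← card_transversals, hP E hE, filter_filter]
  congr 1
  refine filter_congr fun e _ => ⟨fun h => h.2, fun h => ⟨h ▸ hE, h⟩⟩

open Finset in
/-- The pattern on `Option V` whose triples are the pairs of `V` joined to `none`, together with
the triples of `H`. -/
def conePattern {V : Type*} [Fintype V] [DecidableEq V] (H : Finset (Finset V)) :
    Finset (Finset (Option V)) :=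
  (powersetCard 2 univ).image (fun q => insertNone q) ∪ H.image (·.map .some)

open Finset in
lemma card_of_mem_conePattern {V : Type*} [Fintype V] [DecidableEq V] {H : Finset (Finset V)}
    (hH : ∀ e ∈ H, #e = 3) : ∀ E ∈ conePattern H, #E = 3 := by
  intro E hE
  rcases mem_union.1 hE with h | h
  · obtain ⟨q, hq, rfl⟩ := mem_image.1 h
    rw [card_insertNone, (mem_powersetCard.1 hq).2]
  · obtain ⟨e, he, rfl⟩ := mem_image.1 h
    rw [card_map, hH e he]

open Finset in
lemma sum_conePattern_prod {V : Type*} [Fintype V] [DecidableEq V] (H : Finset (Finset V))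
    (c : Option V → ℝ) :
    ∑ E ∈ conePattern H, ∏ w ∈ E, c w =
      c none * ∑ q ∈ powersetCard 2 univ, ∏ w ∈ q, c (some w) +
        ∑ e ∈ H, ∏ w ∈ e, c (some w) := by
  have hdisj : Disjoint ((powersetCard 2 (univ : Finset V)).image (fun q => insertNone q))
      (H.image (·.map .some)) := by
    rw [disjoint_left]
    intro E hE hE'
    obtain ⟨q, -, rfl⟩ := mem_image.1 hE
    obtain ⟨e, -, he⟩ := mem_image.1 hE'
    have := he ▸ none_mem_insertNone (s := q)
    simp at this
  rw [conePattern, sum_union hdisj, sum_image (fun a _ b _ h => insertNone.injective h),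
    sum_image (fun a _ b _ h => map_injective _ h), mul_sum]
  congr 1
  · refine sum_congr rfl fun q _ => ?_
    rw [prod_insertNone]
  · refine sum_congr rfl fun e _ => ?_
    rw [prod_map]
    rfl

open Finset in
/-- The blow-up of a pattern `P` along `π`. -/
def blowup {W : Type*} [DecidableEq W] {N : ℕ} (π : Fin N → W) (P : Finset (Finset W)) :
    ThreeGraph where
  n := N
  edges := {e ∈ powersetCard 3 univ | e.image π ∈ P}
  uniform _ he := (mem_powersetCard.1 (mem_filter.1 he).1).2

open Finset in
lemma card_edges_le_of_blowup_contains {V : Type*} [Fintype V] [DecidableEq V]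
    {K : ℕ} {H : Finset (Finset V)}
    (h3 : ∀ e ∈ H, #e = 3) (hdeg : ∀ q : Finset V, #q = 2 → #{e ∈ H | q ⊆ e} ≤ 5)
    (hsp : ∀ E ⊆ H, E.Nonempty → #(E.biUnion id) ≤ K → #E + 2 ≤ #(E.biUnion id))
    {N : ℕ} (π : Fin N → Option V) {G : ThreeGraph} (hG : G.n = K)
    (hc : (blowup π (conePattern H)).Contains G) : 27 * #G.edges ≤ 2 * K ^ 3 := by
  obtain ⟨f, hf, hfe⟩ : ∃ f : Fin G.n → Fin N, Function.Injective f ∧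
    ∀ e ∈ G.edges, e.image f ∈ (blowup π (conePattern H)).edges := hc
  set S := univ.image f with hS
  have hSc : #S = K := by rw [hS, card_image_of_injective _ hf, card_univ, Fintype.card_fin, hG]
  have h1 : #G.edges ≤ #{e ∈ powersetCard 3 S | e.image π ∈ conePattern H} := by
    rw [← card_image_of_injective G.edges (image_injective hf)]
    refine card_le_card fun e' he' => ?_
    obtain ⟨e, he, rfl⟩ := mem_image.1 he'
    have h := mem_filter.1 (hfe e he)
    exact mem_filter.2 ⟨mem_powersetCard.2 ⟨image_subset_image (subset_univ _),
      (mem_powersetCard.1 h.1).2⟩, h.2⟩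
  rw [card_blowup_edges π S _ (card_of_mem_conePattern h3)] at h1
  have h2 : (#G.edges : ℝ) ≤ ∑ E ∈ conePattern H, ∏ w ∈ E, (#{x ∈ S | π x = w} : ℝ) := by
    exact_mod_cast h1
  rw [sum_conePattern_prod] at h2
  have h4 : ∑ w, (#{x ∈ S | π x = some w} : ℝ) + #{x ∈ S | π x = none} = K := by
    have h := card_eq_sum_card_fiberwise (s := S) (f := π) (t := univ) fun x _ => mem_univ _
    rw [← hSc, h, Fintype.sum_option]
    push_cast
    ring
  have h5 := sum_prod_le_cube K H h3 hdeg hsp (fun w => (#{x ∈ S | π x = some w} : ℝ))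
    (fun w => by positivity) (by
      rw [← card_map .some, ← hSc]
      refine le_trans (card_le_card fun w' hw' => ?_) (card_image_le (f := π))
      obtain ⟨w, hw, rfl⟩ := mem_map.1 hw'
      obtain ⟨x, hx⟩ := card_ne_zero.1 (Nat.cast_ne_zero.1 (mem_filter.1 hw).2)
      rw [mem_filter] at hx
      exact mem_image.2 ⟨x, hx⟩) (y := #{x ∈ S | π x = none}) (by positivity)
  rw [h4] at h5
  have h6 : (27 : ℝ) * #G.edges ≤ 2 * (K : ℝ) ^ 3 := by linarith
  exact_mod_cast h6

open Finset in
lemma exists_map_card_fiber {W : Type*} [Fintype W] [DecidableEq W] (d : W → ℕ) {N : ℕ}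
    (hN : ∑ w, d w = N) : ∃ π : Fin N → W, ∀ w, #{x | π x = w} = d w := by
  have e : Fin N ≃ Σ w, Fin (d w) := (Fintype.equivFinOfCardEq (by simpa using hN)).symm
  refine ⟨fun x => (e x).1, fun w => ?_⟩
  rw [← Fintype.card_fin (d w), ← card_univ]
  symm
  refine card_bij (fun i _ => e.symm ⟨w, i⟩) (fun i _ => by simp) (fun i _ j _ h => ?_)
    fun x hx => ?_
  · simpa using h
  · obtain ⟨-, rfl⟩ := mem_filter.1 hx
    exact ⟨(e x).2, mem_univ _, by simp⟩

open Finset in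
lemma exists_blowup_card_edges {n : ℕ} {H : Finset (Finset (Fin n))} (h3 : ∀ e ∈ H, #e = 3)
    (hH : n ^ 2 < 4 * #H) (t : ℕ) :
    ∃ π : Fin (3 * n * t) → Option (Fin n),
      t ^ 3 * (2 * n ^ 3 + 2) ≤ #(blowup π (conePattern H)).edges := by
  obtain ⟨π, hπ⟩ := exists_map_card_fiber (N := 3 * n * t)
    (fun w : Option (Fin n) => w.elim (n * t) fun _ => 2 * t) (by
      rw [Fintype.sum_option]
      simp
      ring)
  refine ⟨π, ?_⟩
  have h1 := card_blowup_edges π univ _ (card_of_mem_conePattern h3)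
  have h2 : (#(blowup π (conePattern H)).edges : ℝ) =
      ∑ E ∈ conePattern H, ∏ w ∈ E, (#{x | π x = w} : ℝ) := by
    exact_mod_cast h1
  simp only [sum_conePattern_prod, hπ, Option.elim] at h2
  have h4 : ∑ e ∈ H, ∏ _w ∈ e, ((2 * t : ℕ) : ℝ) = ∑ e ∈ H, ((2 * t : ℕ) : ℝ) ^ 3 :=
    sum_congr rfl fun e he => by rw [prod_const, h3 e he]
  rw [sum_powersetCard_two_prod, h4] at h2
  simp only [sum_const, card_univ, Fintype.card_fin, nsmul_eq_mul] at h2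
  push_cast at h2
  have h5 : (n : ℝ) ^ 2 + 1 ≤ 4 * #H := by exact_mod_cast hH
  have h6 : (t : ℝ) ^ 3 * (2 * n ^ 3 + 2) ≤ #(blowup π (conePattern H)).edges := by
    rw [h2]
    nlinarith [mul_le_mul_of_nonneg_left h5 (by positivity : (0 : ℝ) ≤ 2 * t ^ 3)]
  exact_mod_cast h6

open Finset in
lemma bddAbove_card_edges (n : ℕ) (F : Set ThreeGraph) :
    BddAbove {m : ℕ | ∃ G : ThreeGraph, G.n = n ∧ (∀ H ∈ F, ¬ G.Contains H) ∧
      G.edges.card = m} := by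
  refine ⟨n.choose 3, ?_⟩
  rintro m ⟨⟨n, edges, hu⟩, rfl, -, rfl⟩
  have : edges ⊆ powersetCard 3 univ := fun e he => mem_powersetCard.2 ⟨subset_univ _, hu e he⟩
  simpa using card_le_card this

lemma card_edges_le_exNum {F : Set ThreeGraph} {G : ThreeGraph} (hG : ∀ H ∈ F, ¬ G.Contains H) :
    G.edges.card ≤ exNum G.n F :=
  le_csSup (bddAbove_card_edges G.n F) ⟨G, rfl, hG, rfl⟩

lemma exNum_le {n m : ℕ} {F : Set ThreeGraph}
    (h : ∀ G : ThreeGraph, G.n = n → (∀ H ∈ F, ¬ G.Contains H) → G.edges.card ≤ m) :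
    exNum n F ≤ m := by
  refine csSup_le' ?_
  rintro _ ⟨G, hn, hG, rfl⟩
  exact h G hn hG

open Finset in
lemma card_filter_notMem_le_exNum {n : ℕ} {F : Set ThreeGraph} {G : ThreeGraph}
    (hG : ∀ H ∈ F, ¬ G.Contains H) (hn : G.n = n + 1) (v : Fin G.n) :
    #{e ∈ G.edges | v ∉ e} ≤ exNum n F := by
  obtain ⟨_, edges, hu⟩ := G
  dsimp only at hn v hu
  subst hn
  let G' : ThreeGraph :=
    { n := n
      edges := {e | e.map v.succAboveEmb ∈ edges}
      uniform := fun e he => by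
        rw [← card_map v.succAboveEmb, hu _ (mem_filter.1 he).2] }
  have h1 : #{e ∈ edges | v ∉ e} ≤ #G'.edges := by
    rw [← card_map (mapEmbedding v.succAboveEmb).toEmbedding]
    refine card_le_card fun e he => ?_
    rw [mem_filter] at he
    have he' : ((univ : Finset (Fin n)).filter fun i => v.succAboveEmb i ∈ e).map
        v.succAboveEmb = e := by
      ext x
      simp only [mem_map, mem_filter, mem_univ, true_and]
      refine ⟨?_, fun hx => ?_⟩
      · rintro ⟨i, hi, rfl⟩
        exact hi
      · obtain ⟨i, rfl⟩ := Fin.exists_succAbove_eq (x := x) (y := v) fun h => he.2 (h ▸ hx)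
        exact ⟨i, hx, rfl⟩
    refine mem_map.2 ⟨_, mem_filter.2 ⟨mem_univ _, ?_⟩, he'⟩
    rw [he']
    exact he.1
  refine h1.trans (card_edges_le_exNum (G := G') fun H hH hc => hG H hH ?_)
  obtain ⟨f, hf, hfe⟩ : ∃ f : Fin H.n → Fin n, Function.Injective f ∧
    ∀ e ∈ H.edges, e.image f ∈ G'.edges := hc
  refine ⟨v.succAbove ∘ f, v.succAbove_right_injective.comp hf, fun e he => ?_⟩
  have h := (mem_filter.1 (hfe e he)).2
  rw [map_eq_image, image_image] at h
  exact h

open Finset in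
lemma exNum_succ_mul_le (n : ℕ) (F : Set ThreeGraph) :
    exNum (n + 1) F * (n - 2) ≤ exNum n F * (n + 1) := by
  rcases Set.eq_empty_or_nonempty {m : ℕ | ∃ G : ThreeGraph, G.n = n + 1 ∧
    (∀ H ∈ F, ¬ G.Contains H) ∧ G.edges.card = m} with h | h
  · rw [exNum, h]
    simp
  obtain ⟨G, hn, hG, hc⟩ := Nat.sSup_mem h (bddAbove_card_edges (n + 1) F)
  rw [exNum, ← hc]
  have h1 : ∑ v : Fin G.n, #{e ∈ G.edges | v ∉ e} = #G.edges * (n - 2) := by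
    simp only [card_filter]
    rw [sum_comm, ← smul_eq_mul, ← sum_const]
    refine sum_congr rfl fun e he => ?_
    rw [← card_filter, filter_not, card_sdiff_of_subset (filter_subset _ _)]
    simp only [filter_mem_eq_inter, univ_inter, card_univ, Fintype.card_fin, G.uniform e he]
    omega
  rw [← h1]
  refine (sum_le_card_nsmul _ _ _ fun v _ => card_filter_notMem_le_exNum hG hn v).trans ?_
  simp [hn, mul_comm]

lemma exists_isTuranDensity (F : Set ThreeGraph) :
    ∃ L, IsTuranDensity F L ∧ ∀ n, 3 ≤ n → L ≤ (exNum n F : ℝ) / (n.choose 3 : ℝ) := by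
  let a : ℕ → ℝ := fun k => (exNum (k + 3) F : ℝ) / ((k + 3).choose 3 : ℝ)
  have ha : Antitone a := by
    refine antitone_nat_of_succ_le fun k => ?_
    have h1 : exNum (k + 3 + 1) F * (k + 1) ≤ exNum (k + 3) F * (k + 3 + 1) :=
      exNum_succ_mul_le (k + 3) F
    have h2 : (k + 3).choose 3 * (k + 3 + 1) = (k + 3 + 1).choose 3 * (k + 1) :=
      Nat.choose_mul_succ_eq (k + 3) 3
    have hp : ∀ m : ℕ, (0 : ℝ) < ((m + 3).choose 3 : ℝ) := fun m => by
      exact_mod_cast Nat.choose_pos (by omega)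
    have hp' : (0 : ℝ) < ((k + 3 + 1).choose 3 : ℝ) := by
      exact_mod_cast Nat.choose_pos (by omega)
    change (exNum (k + 1 + 3) F : ℝ) / ((k + 1 + 3).choose 3 : ℝ) ≤ _
    rw [show k + 1 + 3 = k + 3 + 1 by ring, div_le_div_iff₀ hp' (hp k)]
    have h3 : exNum (k + 3 + 1) F * (k + 3).choose 3 * (k + 3 + 1) ≤
        exNum (k + 3) F * (k + 3 + 1).choose 3 * (k + 3 + 1) := by
      calc _ = exNum (k + 3 + 1) F * (k + 1) * (k + 3 + 1).choose 3 := by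
            rw [mul_assoc, h2]; ring
        _ ≤ exNum (k + 3) F * (k + 3 + 1) * (k + 3 + 1).choose 3 := Nat.mul_le_mul_right _ h1
        _ = _ := by ring
    exact_mod_cast Nat.le_of_mul_le_mul_right h3 (by omega)
  have hb : BddBelow (Set.range a) := ⟨0, by rintro _ ⟨k, rfl⟩; positivity⟩
  have hlim := tendsto_atTop_ciInf ha hb
  refine ⟨⨅ k, a k, ?_, fun n hn => ?_⟩
  · exact (Filter.tendsto_add_atTop_iff_nat
      (f := fun n : ℕ => (exNum n F : ℝ) / (n.choose 3 : ℝ)) 3).1 hlim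
  · obtain ⟨k, rfl⟩ := Nat.exists_eq_add_of_le' hn
    exact ciInf_le hb k

lemma lt_of_isTuranDensity_of_blowups {F : Set ThreeGraph} {L : ℝ} (hL : IsTuranDensity F L)
    {n : ℕ} (hn : 0 < n)
    (h : ∀ t : ℕ, t ^ 3 * (2 * n ^ 3 + 2) ≤ exNum (3 * n * t) F) : 4 / 9 < L := by
  have hn' : (0 : ℝ) < n := by exact_mod_cast hn
  have hsub : Filter.Tendsto (fun t : ℕ => 3 * n * t) Filter.atTop Filter.atTop :=
    Filter.tendsto_id.const_mul_atTop' (by omega)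
  have hle : 4 / 9 + 4 / (9 * (n : ℝ) ^ 3) ≤ L := by
    refine ge_of_tendsto (hL.comp hsub) ?_
    filter_upwards [Filter.eventually_ge_atTop 1] with t ht
    have ht' : (0 : ℝ) < t := by exact_mod_cast ht
    have h3 : 3 ≤ 3 * n * t := by nlinarith [Nat.mul_pos hn ht]
    have h1 : (t : ℝ) ^ 3 * (2 * n ^ 3 + 2) ≤ exNum (3 * n * t) F := by exact_mod_cast h t
    have h2 : ((3 * n * t).choose 3 : ℝ) ≤ (3 * n * t : ℝ) ^ 3 / 6 := by
      simpa [Nat.factorial] using Nat.choose_le_pow_div (α := ℝ) 3 (3 * n * t)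
    have h4 : (0 : ℝ) < ((3 * n * t).choose 3 : ℝ) := by exact_mod_cast Nat.choose_pos h3
    simp only [Function.comp_apply]
    rw [le_div_iff₀ h4]
    calc (4 / 9 + 4 / (9 * (n : ℝ) ^ 3)) * ((3 * n * t).choose 3 : ℝ)
        ≤ (4 / 9 + 4 / (9 * (n : ℝ) ^ 3)) * ((3 * n * t : ℝ) ^ 3 / 6) := by gcongr
      _ = (t : ℝ) ^ 3 * (2 * n ^ 3 + 2) := by field_simp; ring
      _ ≤ _ := h1
  have : 0 < 4 / (9 * (n : ℝ) ^ 3) := by positivity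
  linarith

/-- `4/9` is a non-jump for 3-graphs: for every `c > 0`, the set `Π` of Turán densities
meets the open interval `(4/9, 4/9 + c)`. -/
theorem four_ninths_is_non_jump :
    ∀ c : ℝ, 0 < c → ∃ L ∈ TuranDensities, 4 / 9 < L ∧ L < 4 / 9 + c := by
  intro c hc
  obtain ⟨m, hm⟩ := exists_nat_gt (36 / (27 * c))
  obtain ⟨K, hK⟩ : ∃ K, K = m + 10 := ⟨_, rfl⟩
  have hK' : (K : ℝ) = m + 10 := by rw [hK]; push_cast; ring
  have hm0 : (0 : ℝ) ≤ m := m.cast_nonneg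
  have hK0 : (0 : ℝ) < K := by linarith
  let F : Set ThreeGraph := {G | G.n = K ∧ 2 * K ^ 3 < 27 * G.edges.card}
  obtain ⟨L, hL, hLK⟩ := exists_isTuranDensity F
  refine ⟨L, ⟨F, ?_, hL⟩, ?_, ?_⟩
  · refine ⟨⟨K, Finset.powersetCard 3 Finset.univ, fun e he => (Finset.mem_powersetCard.1 he).2⟩,
      rfl, ?_⟩
    simp only [Finset.card_powersetCard, Finset.card_univ, Fintype.card_fin]
    have h : 2 * (K : ℝ) ^ 3 < 27 * (K.choose 3 : ℝ) := by
      rw [cast_choose_three]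
      have : 0 < (K : ℝ) * (27 * (K - 1) * (K - 2) - 12 * K ^ 2) := by
        refine mul_pos hK0 ?_
        nlinarith
      nlinarith
    exact_mod_cast h
  · obtain ⟨n, H, hn, h3, hcard, hdeg, hsp⟩ := exists_locally_sparse K
    refine lt_of_isTuranDensity_of_blowups hL hn fun t => ?_
    obtain ⟨π, hπ⟩ := exists_blowup_card_edges h3 hcard t
    refine hπ.trans (card_edges_le_exNum (G := blowup π (conePattern H)) fun G hG hcon => ?_)
    have := card_edges_le_of_blowup_contains h3 hdeg hsp π hG.1 hcon
    exact absurd hG.2 (by omega)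
  · refine (hLK K (by omega)).trans_lt ?_
    have h1 : exNum K F ≤ 2 * K ^ 3 / 27 := by
      refine exNum_le fun G hn hG => ?_
      by_contra! h
      refine hG G ⟨hn, by omega⟩ ⟨id, Function.injective_id, fun e he => ?_⟩
      rwa [Finset.image_id]
    have h2 : 27 * (exNum K F : ℝ) ≤ 2 * (K : ℝ) ^ 3 := by
      have : 27 * exNum K F ≤ 2 * K ^ 3 := by omega
      exact_mod_cast this
    have h4 : (0 : ℝ) < (K.choose 3 : ℝ) := by exact_mod_cast Nat.choose_pos (by omega)
    rw [div_lt_iff₀ h4, cast_choose_three]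
    rw [div_lt_iff₀ (by positivity)] at hm
    have h5 : 12 * (K : ℝ) ^ 2 < (12 + 27 * c) * ((K - 1) * (K - 2)) := by
      nlinarith [mul_pos hc hK0]
    nlinarith [mul_lt_mul_of_pos_left h5 hK0]
end

section
/- Let α ∈ [0,1). Suppose that for every positive integer m there exists a finite 3-graph G_m such that λ(G_m) > α, but λ(H) ≤ α for every subgraph H ⊆ G_m with v(H) ≤ m. Then α is a non-jump for 3-graphs. -/
/-- The normalized Lagrangian of the 3-graph with edge set `E` on vertex set `Fin n`:
the supremum of `6·Σ_{e ∈ E} Π_{i ∈ e} x i` over probability vectors `x`. -/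
noncomputable def lagrangian {n : ℕ} (E : Finset (Finset (Fin n))) : ℝ :=
  sSup {p : ℝ | ∃ x : Fin n → ℝ, (∀ i, 0 ≤ x i) ∧ (∑ i, x i) = 1 ∧
    p = 6 * ∑ e ∈ E, ∏ i ∈ e, x i}

open Filter Topology

/-- The normalized Lagrangian polynomial of the edge set `E`. -/
def lagrangianPoly {n : ℕ} (E : Finset (Finset (Fin n))) (x : Fin n → ℝ) : ℝ :=
  6 * ∑ e ∈ E, ∏ i ∈ e, x i

/-- For a probability vector, the products over any collection of subsets sum to at most
`exp 1`. -/
lemma sum_prod_le_exp_one {n : ℕ} (E : Finset (Finset (Fin n))) {x : Fin n → ℝ}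
    (hx : ∀ i, 0 ≤ x i) (hs : ∑ i, x i = 1) :
    ∑ e ∈ E, ∏ i ∈ e, x i ≤ Real.exp 1 := by
  calc ∑ e ∈ E, ∏ i ∈ e, x i
      ≤ ∑ e ∈ (Finset.univ : Finset (Fin n)).powerset, ∏ i ∈ e, x i :=
        Finset.sum_le_sum_of_subset_of_nonneg (fun e _ => by simp)
          fun e _ _ => Finset.prod_nonneg fun i _ => hx i
    _ = ∏ i, (1 + x i) := (Finset.prod_one_add _).symm
    _ ≤ Real.exp (∑ i, x i) := Real.prod_one_add_le_exp_sum _ hx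
    _ = Real.exp 1 := by rw [hs]

lemma lagrangianPoly_le_lagrangian {n : ℕ} (E : Finset (Finset (Fin n))) {x : Fin n → ℝ}
    (hx : ∀ i, 0 ≤ x i) (hs : ∑ i, x i = 1) : lagrangianPoly E x ≤ lagrangian E := by
  refine le_csSup ⟨6 * Real.exp 1, ?_⟩ ⟨x, hx, hs, rfl⟩
  rintro p ⟨y, hy, hys, rfl⟩
  have := sum_prod_le_exp_one E hy hys
  linarith

lemma exists_lt_lagrangianPoly {n : ℕ} {E : Finset (Finset (Fin n))} {a : ℝ} (ha : 0 ≤ a)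
    (h : a < lagrangian E) :
    ∃ x : Fin n → ℝ, (∀ i, 0 ≤ x i) ∧ ∑ i, x i = 1 ∧ a < lagrangianPoly E x := by
  have hne : {p : ℝ | ∃ x : Fin n → ℝ, (∀ i, 0 ≤ x i) ∧ (∑ i, x i) = 1 ∧
      p = 6 * ∑ e ∈ E, ∏ i ∈ e, x i}.Nonempty := by
    by_contra hemp
    rw [Set.not_nonempty_iff_eq_empty] at hemp
    rw [lagrangian, hemp, Real.sSup_empty] at h
    linarith
  obtain ⟨p, ⟨x, hx, hs, rfl⟩, hp⟩ := exists_lt_of_lt_csSup hne h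
  exact ⟨x, hx, hs, hp⟩

/-- Removing a vertex `v` changes the Lagrangian polynomial by at most `18 * x v`. -/
lemma lagrangianPoly_le_add {n : ℕ} (E : Finset (Finset (Fin n))) {x : Fin n → ℝ}
    (hx : ∀ i, 0 ≤ x i) (hs : ∑ i, x i = 1) (v : Fin n) :
    lagrangianPoly E x ≤ lagrangianPoly {e ∈ E | v ∉ e} x + 18 * x v := by
  have hsplit := Finset.sum_filter_add_sum_filter_not E (fun e => v ∈ e) fun e => ∏ i ∈ e, x i
  have hlink : ∑ e ∈ E with v ∈ e, ∏ i ∈ e, x i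
      = x v * ∑ e ∈ (E.filter (v ∈ ·)).image (fun e => e.erase v), ∏ i ∈ e, x i := by
    rw [Finset.sum_image, Finset.mul_sum]
    · exact Finset.sum_congr rfl fun e he =>
        (Finset.mul_prod_erase e x (Finset.mem_filter.1 he).2).symm
    · intro e he e' he' hee
      simp only [Finset.coe_filter, Set.mem_ofPred_eq] at he he'
      rw [← Finset.insert_erase he.2, ← Finset.insert_erase he'.2]
      exact congrArg (insert v) hee
  have hle := mul_le_mul_of_nonneg_left
    ((sum_prod_le_exp_one ((E.filter (v ∈ ·)).image (fun e => e.erase v)) hx hs).trans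
      Real.exp_one_lt_three.le) (hx v)
  unfold lagrangianPoly
  linarith

/-- The number of transversal sets over `e` for the fibres of `f`. -/
lemma card_filter_image_eq {N n : ℕ} (f : Fin N → Fin n) (e : Finset (Fin n)) :
    (Finset.univ.filter fun h : Finset (Fin N) => h.card = e.card ∧ h.image f = e).card
      = ∏ i ∈ e, (Finset.univ.filter fun a => f a = i).card := by
  rw [← Finset.card_pi]
  symm
  have key : ∀ g ∈ e.pi (fun i => Finset.univ.filter fun a => f a = i),
      ∀ i (hi : i ∈ e), f (g i hi) = i := fun g hg i hi => by
    simpa using Finset.mem_pi.1 hg i hi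
  refine Finset.card_bij (fun g _ => e.attach.image fun i => g i.1 i.2) ?_ ?_ ?_
  · intro g hg
    have hk := key g hg
    simp only [Finset.mem_filter, Finset.mem_univ, true_and]
    constructor
    · rw [Finset.card_image_of_injective, Finset.card_attach]
      intro i j hij
      have := congrArg f hij
      simp only [hk] at this
      exact Subtype.ext this
    · ext b
      simp only [Finset.mem_image, Finset.mem_attach, true_and, Subtype.exists]
      constructor
      · rintro ⟨a, ⟨i, hi, rfl⟩, rfl⟩
        rwa [hk]
      · exact fun hb => ⟨g b hb, ⟨b, hb, rfl⟩, hk b hb⟩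
  · intro g hg g' hg' hgg
    funext i hi
    have hmem : g i hi ∈ e.attach.image fun i => g' i.1 i.2 := by
      rw [← hgg]
      exact Finset.mem_image_of_mem (fun i : e => g i.1 i.2) (Finset.mem_attach e ⟨i, hi⟩)
    obtain ⟨⟨j, hj⟩, -, hji⟩ := Finset.mem_image.1 hmem
    have := congrArg f hji
    simp only [key g hg, key g' hg'] at this
    subst this
    exact hji.symm
  · intro h hh
    simp only [Finset.mem_filter, Finset.mem_univ, true_and] at hh
    obtain ⟨hcard, him⟩ := hh
    have hex : ∀ i ∈ e, ∃ a ∈ h, f a = i := fun i hi => by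
      rw [← him] at hi
      exact Finset.mem_image.1 hi
    choose g hgh hgf using hex
    refine ⟨g, Finset.mem_pi.2 fun i hi => by simp [hgf], ?_⟩
    refine Finset.eq_of_subset_of_card_le ?_ ?_
    · intro a ha
      obtain ⟨i, -, rfl⟩ := Finset.mem_image.1 ha
      exact hgh _ _
    · rw [Finset.card_image_of_injective, Finset.card_attach, hcard]
      intro i j hij
      have := congrArg f hij
      simp only [hgf] at this
      exact Subtype.ext this

/-- The vertex map `f` sends every edge of `H` to an edge of `G`. -/
def ThreeGraph.IsHom (H G : ThreeGraph) (f : Fin H.n → Fin G.n) : Prop :=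
  ∀ e ∈ H.edges, e.image f ∈ G.edges

/-- The family of 3-graphs admitting no homomorphism to `G`. -/
def ThreeGraph.nonColorable (G : ThreeGraph) : Set ThreeGraph :=
  {H | ∀ f, ¬ H.IsHom G f}

lemma ThreeGraph.nonColorable_nonempty (G : ThreeGraph) : G.nonColorable.Nonempty := by
  refine ⟨⟨G.n + 3, Finset.univ.powersetCard 3, fun e he => (Finset.mem_powersetCard.1 he).2⟩,
    fun f hf => ?_⟩
  obtain ⟨a, b, hab, hfab⟩ := Fintype.exists_ne_map_eq_of_card_lt f (by simp)
  obtain ⟨e, hsub, -, hcard⟩ := Finset.exists_subsuperset_card_eq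
    (Finset.subset_univ ({a, b} : Finset (Fin (G.n + 3)))) (n := 3)
    (by rw [Finset.card_pair hab]; norm_num) (by simp)
  have himg := G.uniform _ (hf e (Finset.mem_powersetCard.2 ⟨Finset.subset_univ _, hcard⟩))
  have hinj := Finset.card_image_iff.1 (himg.trans hcard.symm)
  exact hab (hinj (hsub (by simp)) (hsub (by simp)) hfab)

/-- The triples that `f` maps onto an edge of `G`. -/
def ThreeGraph.blowupEdges (G : ThreeGraph) {N : ℕ} (f : Fin N → Fin G.n) :
    Finset (Finset (Fin N)) :=
  Finset.univ.filter fun h => h.card = 3 ∧ h.image f ∈ G.edges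

lemma ThreeGraph.mem_blowupEdges {G : ThreeGraph} {N : ℕ} {f : Fin N → Fin G.n}
    {h : Finset (Fin N)} : h ∈ G.blowupEdges f ↔ h.card = 3 ∧ h.image f ∈ G.edges := by
  simp [blowupEdges]

lemma ThreeGraph.card_blowupEdges (G : ThreeGraph) {N : ℕ} (f : Fin N → Fin G.n) :
    (G.blowupEdges f).card
      = ∑ e ∈ G.edges, ∏ i ∈ e, (Finset.univ.filter fun a => f a = i).card := by
  rw [Finset.card_eq_sum_card_fiberwise (f := fun h => h.image f) (t := G.edges)
    fun h hh => (mem_blowupEdges.1 hh).2]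
  refine Finset.sum_congr rfl fun e he => ?_
  rw [← card_filter_image_eq, blowupEdges, Finset.filter_filter, G.uniform e he]
  congr 1
  ext h
  simp only [Finset.mem_filter, Finset.mem_univ, true_and]
  constructor
  · rintro ⟨⟨h1, -⟩, h2⟩
    exact ⟨h1, h2⟩
  · rintro ⟨h1, h2⟩
    exact ⟨⟨h1, h2 ▸ he⟩, h2⟩

lemma card_blowupEdges_le_exNum (G : ThreeGraph) {N : ℕ} (f : Fin N → Fin G.n) :
    (G.blowupEdges f).card ≤ exNum N G.nonColorable := by
  refine le_csSup ⟨Fintype.card (Finset (Fin N)), ?_⟩ ⟨⟨N, G.blowupEdges f,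
    fun _ he => (ThreeGraph.mem_blowupEdges.1 he).1⟩, rfl, ?_, rfl⟩
  · rintro m ⟨H, rfl, -, rfl⟩
    exact Finset.card_le_univ _
  · rintro H hH ⟨φ, -, hφ⟩
    refine hH (f ∘ φ) fun e he => ?_
    rw [← Finset.image_image]
    exact (ThreeGraph.mem_blowupEdges.1 (hφ e he)).2

lemma exNum_le_s1 {G : ThreeGraph} {N B : ℕ}
    (hB : ∀ f : Fin N → Fin G.n, (G.blowupEdges f).card ≤ B) :
    exNum N G.nonColorable ≤ B := by
  refine csSup_le' ?_
  rintro m ⟨H, rfl, hfree, rfl⟩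
  have hH : H ∉ G.nonColorable := fun hmem =>
    hfree H hmem ⟨id, Function.injective_id, fun e he => by simpa using he⟩
  simp only [ThreeGraph.nonColorable, Set.mem_ofPred_eq, not_forall, not_not] at hH
  obtain ⟨f, hf⟩ := hH
  refine (Finset.card_le_card fun e he => ?_).trans (hB f)
  exact ThreeGraph.mem_blowupEdges.2 ⟨H.uniform e he, hf e he⟩

lemma exNum_le_lagrangian (G : ThreeGraph) {N : ℕ} (hN : 0 < N) :
    (exNum N G.nonColorable : ℝ) ≤ lagrangian G.edges / 6 * (N : ℝ) ^ 3 := by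
  have hN' : (0 : ℝ) < N := by exact_mod_cast hN
  have hblow : ∀ f : Fin N → Fin G.n,
      ((G.blowupEdges f).card : ℝ) ≤ lagrangian G.edges / 6 * (N : ℝ) ^ 3 := fun f => by
    have hle := lagrangianPoly_le_lagrangian G.edges
      (x := fun i => ((Finset.univ.filter fun a => f a = i).card : ℝ) / N)
      (fun i => by positivity) (by
        rw [← Finset.sum_div, ← Nat.cast_sum,
          ← Finset.card_eq_sum_card_fiberwise (fun a _ => Finset.mem_coe.2 (Finset.mem_univ (f a)))]
        simp [hN'.ne'])
    have hpoly : lagrangianPoly G.edges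
        (fun i => ((Finset.univ.filter fun a => f a = i).card : ℝ) / N)
        = 6 * (((G.blowupEdges f).card : ℝ) / (N : ℝ) ^ 3) := by
      rw [lagrangianPoly, G.card_blowupEdges, Nat.cast_sum, Finset.sum_div]
      congr 1
      refine Finset.sum_congr rfl fun e he => ?_
      rw [Finset.prod_div_distrib, Finset.prod_const, G.uniform e he, Nat.cast_prod]
    rw [hpoly] at hle
    rw [← div_le_iff₀ (by positivity)]
    linarith
  by_cases hf : Nonempty (Fin N → Fin G.n)
  · obtain ⟨f⟩ := hf
    have hnonneg := (Nat.cast_nonneg _).trans (hblow f)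
    exact (Nat.cast_le.2 (exNum_le_s1 fun f => Nat.le_floor (hblow f))).trans (Nat.floor_le hnonneg)
  · have h0 : exNum N G.nonColorable ≤ 0 := exNum_le_s1 fun f => (hf ⟨f⟩).elim
    have hemp : IsEmpty (Fin G.n) := by
      by_contra hne
      rw [not_isEmpty_iff] at hne
      exact hf inferInstance
    have hlag : lagrangian G.edges = 0 := by
      have : {p : ℝ | ∃ x : Fin G.n → ℝ, (∀ i, 0 ≤ x i) ∧ (∑ i, x i) = 1 ∧
          p = 6 * ∑ e ∈ G.edges, ∏ i ∈ e, x i} = ∅ := by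
        ext p
        simp
      rw [lagrangian, this, Real.sSup_empty]
    rw [hlag, Nat.le_zero.1 h0]
    simp

/-- Prescribed lower bounds on fibre sizes can be realized when they sum to at most `N`. -/
lemma exists_map_le_card_fiber {n N : ℕ} [Nonempty (Fin n)] (k : Fin n → ℕ)
    (hk : ∑ i, k i ≤ N) :
    ∃ f : Fin N → Fin n, ∀ i, k i ≤ (Finset.univ.filter fun a => f a = i).card := by
  obtain ⟨φ⟩ : Nonempty ((Σ i, Fin (k i)) ↪ Fin N) :=
    Function.Embedding.nonempty_of_card_le (by simpa using hk)
  refine ⟨Function.extend φ Sigma.fst fun _ => Classical.arbitrary _, fun i => ?_⟩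
  have := Finset.card_le_card_of_injOn (s := (Finset.univ : Finset (Fin (k i))))
    (t := Finset.univ.filter fun a =>
      Function.extend φ Sigma.fst (fun _ => Classical.arbitrary (Fin n)) a = i)
    (fun j => φ ⟨i, j⟩) (fun j _ => by simp [φ.injective.extend_apply])
    (fun j _ j' _ hj => by simpa using φ.injective hj)
  simpa using this

lemma le_exNum (G : ThreeGraph) {x : Fin G.n → ℝ} (hx : ∀ i, 0 ≤ x i) (hs : ∑ i, x i = 1)
    (N : ℕ) :
    ∑ e ∈ G.edges, ∏ i ∈ e, (⌊x i * N⌋₊ : ℝ) ≤ exNum N G.nonColorable := by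
  have hne : Nonempty (Fin G.n) := by
    by_contra hemp
    rw [not_nonempty_iff] at hemp
    simp at hs
  have hk : ∑ i, ⌊x i * N⌋₊ ≤ N := by
    have : ∑ i, (⌊x i * N⌋₊ : ℝ) ≤ ∑ i, x i * N :=
      Finset.sum_le_sum fun i _ => Nat.floor_le (mul_nonneg (hx i) (Nat.cast_nonneg N))
    rw [← Finset.sum_mul, hs, one_mul] at this
    exact_mod_cast this
  obtain ⟨f, hf⟩ := exists_map_le_card_fiber _ hk
  have hle := card_blowupEdges_le_exNum G f
  rw [G.card_blowupEdges] at hle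
  refine le_trans ?_ (Nat.cast_le.2 hle)
  push_cast
  exact Finset.sum_le_sum fun e _ => Finset.prod_le_prod (fun i _ => Nat.cast_nonneg _)
    fun i _ => Nat.cast_le.2 (hf i)

lemma tendsto_pow_three_div_choose :
    Tendsto (fun N : ℕ => (N : ℝ) ^ 3 / (N.choose 3 : ℝ)) atTop (𝓝 6) := by
  have h := ProbabilityTheory.tendsto_choose_mul_pow_atTop (p := fun N : ℕ => (N : ℝ)⁻¹) (r := 1) 3
    (tendsto_const_nhds.congr' (by
      filter_upwards [eventually_gt_atTop 0] with N hN
      have : (N : ℝ) ≠ 0 := by positivity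
      field_simp))
  have h' := h.inv₀ (by norm_num [Nat.factorial])
  norm_num [Nat.factorial] at h'
  refine h'.congr fun N => ?_
  rw [div_eq_mul_inv]

/-- The Lagrangian of a 3-graph is the Turán density of its family of non-colorable 3-graphs. -/
lemma isTuranDensity_lagrangian (G : ThreeGraph) (hpos : 0 < lagrangian G.edges) :
    IsTuranDensity G.nonColorable (lagrangian G.edges) := by
  refine tendsto_order.2 ⟨fun a ha => ?_, fun b hb => ?_⟩
  · obtain ⟨x, hx, hs, hxa⟩ := exists_lt_lagrangianPoly (le_max_right a 0) (max_lt ha hpos)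
    have hlim : Tendsto (fun N : ℕ => (∑ e ∈ G.edges, ∏ i ∈ e, ((⌊x i * N⌋₊ : ℝ) / N))
        * ((N : ℝ) ^ 3 / (N.choose 3 : ℝ))) atTop (𝓝 ((∑ e ∈ G.edges, ∏ i ∈ e, x i) * 6)) :=
      (tendsto_finsetSum _ fun e _ => tendsto_finsetProd _ fun i _ =>
        (tendsto_nat_floor_mul_div_atTop (hx i)).comp tendsto_natCast_atTop_atTop).mul
        tendsto_pow_three_div_choose
    have hlt : a < (∑ e ∈ G.edges, ∏ i ∈ e, x i) * 6 := by
      rw [mul_comm]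
      exact (le_max_left a 0).trans_lt hxa
    filter_upwards [hlim.eventually_const_lt hlt, eventually_gt_atTop 0] with N hN hN0
    refine hN.trans_le ?_
    have hN' : (N : ℝ) ^ 3 ≠ 0 := by positivity
    have hsum : ∑ e ∈ G.edges, ∏ i ∈ e, ((⌊x i * N⌋₊ : ℝ) / N)
        = (∑ e ∈ G.edges, ∏ i ∈ e, (⌊x i * N⌋₊ : ℝ)) / (N : ℝ) ^ 3 := by
      rw [Finset.sum_div]
      refine Finset.sum_congr rfl fun e he => ?_
      rw [Finset.prod_div_distrib, Finset.prod_const, G.uniform e he]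
    rw [hsum, div_mul_div_cancel₀ hN']
    exact div_le_div_of_nonneg_right (le_exNum G hx hs N) (Nat.cast_nonneg _)
  · have hlim : Tendsto (fun N : ℕ => lagrangian G.edges / 6 * ((N : ℝ) ^ 3 / (N.choose 3 : ℝ)))
        atTop (𝓝 (lagrangian G.edges / 6 * 6)) := tendsto_pow_three_div_choose.const_mul _
    rw [div_mul_cancel₀ _ (by norm_num)] at hlim
    filter_upwards [hlim.eventually_lt_const hb, eventually_gt_atTop 0] with N hN hN0
    refine lt_of_le_of_lt ?_ hN
    rw [← mul_div_assoc]
    exact div_le_div_of_nonneg_right (exNum_le_lagrangian G hN0) (Nat.cast_nonneg _)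

/-- If every subgraph on at most `m` vertices has Lagrangian at most `α`, a vertex-minimal
induced subgraph of Lagrangian more than `α` has Lagrangian at most `α + 18 / m`. -/
lemma exists_lagrangian_le_add {n m : ℕ} (hm : 0 < m) {E : Finset (Finset (Fin n))} {α : ℝ}
    (hα : 0 ≤ α) (hE : α < lagrangian E)
    (hsub : ∀ W : Finset (Fin n), W.card ≤ m → lagrangian {e ∈ E | e ⊆ W} ≤ α) :
    ∃ E' ⊆ E, α < lagrangian E' ∧ lagrangian E' ≤ α + 18 / m := by
  obtain ⟨W, hW, hmin⟩ := exists_minimal_of_wellFoundedLT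
    (fun W : Finset (Fin n) => α < lagrangian {e ∈ E | e ⊆ W}) ⟨Finset.univ, by simpa using hE⟩
  refine ⟨_, Finset.filter_subset _ _, hW, ?_⟩
  have hcard : m < W.card := by
    by_contra hle
    exact absurd (hsub W (not_lt.1 hle)) (not_le.2 hW)
  have hm' : (0 : ℝ) < m := by exact_mod_cast hm
  refine Real.sSup_le ?_ (by positivity)
  rintro p ⟨x, hx, hs, rfl⟩
  change lagrangianPoly _ x ≤ _
  obtain ⟨v, hvW, hv⟩ : ∃ v ∈ W, x v ≤ 1 / m := by
    refine Finset.exists_le_of_sum_le (Finset.card_pos.1 (hm.trans hcard)) ?_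
    rw [Finset.sum_const, nsmul_eq_mul, mul_one_div]
    calc ∑ i ∈ W, x i ≤ ∑ i, x i :=
          Finset.sum_le_sum_of_subset_of_nonneg (Finset.subset_univ _) fun i _ _ => hx i
      _ = 1 := hs
      _ ≤ (W.card : ℝ) / m := by
        rw [one_le_div hm']
        exact_mod_cast hcard.le
  have herase : {e ∈ {e ∈ E | e ⊆ W} | v ∉ e} = {e ∈ E | e ⊆ W.erase v} := by
    ext e
    simp [Finset.subset_erase, and_assoc]
  have hle : lagrangian {e ∈ E | e ⊆ W.erase v} ≤ α := by
    by_contra hlt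
    exact Finset.notMem_erase v W (hmin (not_le.1 hlt) (Finset.erase_subset v W) hvW)
  calc lagrangianPoly {e ∈ E | e ⊆ W} x
      ≤ lagrangianPoly {e ∈ E | e ⊆ W.erase v} x + 18 * x v :=
        herase ▸ lagrangianPoly_le_add _ hx hs v
    _ ≤ α + 18 * (1 / m) := by
        gcongr
        exact (lagrangianPoly_le_lagrangian _ hx hs).trans hle
    _ = α + 18 / m := by ring

/-- The Lagrangian form of the Frankl–Rödl non-jump criterion: if for every `m` there is
a finite 3-graph `G_m` with `λ(G_m) > α` but `λ(H) ≤ α` for every subgraph `H ⊆ G_m`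
(with vertex set `W`) having at most `m` vertices, then `α` is a non-jump. -/
theorem frankl_rodl_criterion (α : ℝ) (hα0 : 0 ≤ α) (hα1 : α < 1)
    (h : ∀ m : ℕ, 0 < m → ∃ G : ThreeGraph, α < lagrangian G.edges ∧
      ∀ (W : Finset (Fin G.n)) (H : Finset (Finset (Fin G.n))),
        H ⊆ G.edges → (∀ e ∈ H, e ⊆ W) → W.card ≤ m → lagrangian H ≤ α) :
    ∀ c : ℝ, 0 < c → ∃ L ∈ TuranDensities, α < L ∧ L < α + c := by
  intro c hc
  obtain ⟨m, hm⟩ := exists_nat_gt (18 / c)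
  have hm' : (0 : ℝ) < m := (by positivity : (0 : ℝ) < 18 / c).trans hm
  have hm0 : 0 < m := by exact_mod_cast hm'
  obtain ⟨G, hG, hsub⟩ := h m hm0
  obtain ⟨E, hE, hlt, hle⟩ := exists_lagrangian_le_add hm0 hα0 hG fun W hW =>
    hsub W _ (Finset.filter_subset _ _) (fun e he => (Finset.mem_filter.1 he).2) hW
  let G' : ThreeGraph := ⟨G.n, E, fun e he => G.uniform e (hE he)⟩
  refine ⟨lagrangian E, ⟨G'.nonColorable, G'.nonColorable_nonempty,
    isTuranDensity_lagrangian G' (hα0.trans_lt hlt)⟩, hlt, hle.trans_lt ?_⟩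
  have : 18 / (m : ℝ) < c := (div_lt_comm₀ hc hm').1 hm
  linarith
end

section
/- Let Q be a sparse 3-graph with maximum codegree Δ₂(Q) ≤ 2. Then the normalized Lagrangian of cone(Q) satisfies λ(cone(Q)) ≤ 4/9. -/
/-- A 3-graph with edge set `E` on vertex set `Fin n` is *sparse* if every vertex subset
`S` with `|S| ≥ 2` contains at most `|S| - 2` edges. -/
def Sparse {n : ℕ} (E : Finset (Finset (Fin n))) : Prop :=
  ∀ S : Finset (Fin n), 2 ≤ S.card → (E.filter (· ⊆ S)).card ≤ S.card - 2

/-- The codegree `d(u,v)`: the number of vertices `w` with `{u,v,w} ∈ E`. -/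
def codeg {n : ℕ} (E : Finset (Finset (Fin n))) (u v : Fin n) : ℕ :=
  (Finset.univ.filter (fun w => ({u, v, w} : Finset (Fin n)) ∈ E)).card

/-- The cone of a 3-graph: add a new apex vertex (here `Fin.last n`), all triples
consisting of the apex together with two distinct old vertices, and keep all old edges. -/
def coneEdges {n : ℕ} (E : Finset (Finset (Fin n))) : Finset (Finset (Fin (n + 1))) :=
  E.image (Finset.image Fin.castSucc) ∪
    (Finset.univ : Finset (Finset (Fin (n + 1)))).filter
      (fun e => e.card = 3 ∧ Fin.last n ∈ e)

open Finset in
theorem two_mul_sum_powersetCard_two {α : Type*} [DecidableEq α] (s : Finset α) (f : α → ℝ) :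
    2 * ∑ p ∈ s.powersetCard 2, ∏ i ∈ p, f i = (∑ i ∈ s, f i) ^ 2 - ∑ i ∈ s, f i ^ 2 := by
  induction s using Finset.induction_on with
  | empty => simp [powersetCard_eq_empty.2 (show #(∅ : Finset α) < 2 by simp)]
  | insert a s ha ih =>
    rw [powersetCard_succ_insert ha, sum_union, sum_insert ha, sum_insert ha, mul_add, ih,
      sum_image]
    · have h : ∑ p ∈ s.powersetCard 1, ∏ i ∈ insert a p, f i = f a * ∑ i ∈ s, f i := by
        rw [powersetCard_one, sum_map, mul_sum]
        refine sum_congr rfl fun i hi => ?_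
        have : a ≠ i := fun h => ha (h ▸ hi)
        simp [prod_pair this]
      rw [h]
      ring
    · intro p hp q hq h
      have hp' : a ∉ p := fun h => ha ((mem_powersetCard.1 hp).1 h)
      have hq' : a ∉ q := fun h => ha ((mem_powersetCard.1 hq).1 h)
      rw [← erase_insert hp', ← erase_insert hq', h]
    · rw [disjoint_left]
      intro p hp hq
      obtain ⟨q, -, rfl⟩ := mem_image.1 hq
      exact ha ((mem_powersetCard.1 hp).1 (mem_insert_self a q))

/-- Sparseness gives a system of distinct representatives of the edges which avoids any two
prescribed vertices. -/
theorem Sparse.exists_injOn_avoiding {n : ℕ} {E : Finset (Finset (Fin n))} (h : Sparse E)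
    {u v : Fin n} (huv : u ≠ v) :
    ∃ φ : Finset (Fin n) → Fin n, Set.InjOn φ E ∧
      ∀ e ∈ E, φ e ∈ e ∧ φ e ≠ u ∧ φ e ≠ v := by
  classical
  have hall := (Finset.all_card_le_biUnion_card_iff_exists_injective
    (fun e : E => (e : Finset (Fin n)) \ {u, v})).1 (by
      intro s
      set T := s.biUnion (fun e : E => (e : Finset (Fin n)) \ {u, v}) with hT
      have hd : Disjoint T {u, v} := by
        rw [hT, Finset.disjoint_biUnion_left]
        exact fun i _ => Finset.sdiff_disjoint
      have hc : (T ∪ {u, v}).card = T.card + 2 := by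
        rw [Finset.card_union_of_disjoint hd, Finset.card_pair huv]
      have h1 := h (T ∪ {u, v}) (by omega)
      have h2 : s.card ≤ (E.filter (· ⊆ T ∪ {u, v})).card := by
        rw [← Finset.card_map (Function.Embedding.subtype (· ∈ E))]
        refine Finset.card_le_card fun e he => ?_
        obtain ⟨e', he', rfl⟩ := Finset.mem_map.1 he
        refine Finset.mem_filter.2 ⟨e'.2, fun x hx => ?_⟩
        by_cases hxuv : x ∈ ({u, v} : Finset (Fin n))
        · exact Finset.mem_union_right _ hxuv
        · exact Finset.mem_union_left _
            (Finset.mem_biUnion.2 ⟨e', he', Finset.mem_sdiff.2 ⟨hx, hxuv⟩⟩)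
      omega)
  obtain ⟨g, hg, hmem⟩ := hall
  refine ⟨fun e => if he : e ∈ E then g ⟨e, he⟩ else u, ?_, ?_⟩
  · intro e he e' he' hee
    have he : e ∈ E := he
    have he' : e' ∈ E := he'
    simp only [he, he', dif_pos] at hee
    simpa using hg hee
  · intro e he
    have := hmem ⟨e, he⟩
    simp only [he, dif_pos]
    simpa using this

/-- The case of `le_quarter_mul_one_sub` in which the two largest weights are both `c` and the sum
of squares is `c ^ 2 * w`. -/
theorem le_quarter_mul_one_sub_of_eq {c w q : ℝ} (hc : 0 < c) (hc12 : c ≤ 1 / 2) (hw2 : 2 ≤ w)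
    (hs : c ^ 2 * w ≤ 1 / 2) (hA : q ≤ c ^ 2 * (1 - 2 * c))
    (hB : q ^ 2 ≤ c ^ 6 * (w - 2) * (w ^ 2 - 2)) :
    q ≤ c ^ 2 * w * (1 - c ^ 2 * w) / 4 := by
  have hc2 : 0 < c ^ 2 := by positivity
  by_cases hw : 4 * (1 - 2 * c) ≤ w * (1 - c ^ 2 * w)
  · have := mul_le_mul_of_nonneg_left hw hc2.le
    linarith
  have hw4 : w ≤ 4 := by
    by_contra! hlt
    have h5 : c ^ 2 * 4 ≤ c ^ 2 * w := mul_le_mul_of_nonneg_left hlt.le hc2.le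
    have h6 := mul_nonneg (sub_nonneg.2 h5) (by linarith : 0 ≤ 1 - c ^ 2 * w - c ^ 2 * 4)
    have h7 := mul_nonneg hc2.le (mul_nonneg hc.le (by linarith : 0 ≤ 1 - 2 * c))
    refine hw (le_of_mul_le_mul_left ?_ hc2)
    linarith
  have hcw : c ≤ (4 - w) / 6 := by
    by_contra! hlt
    set k := (4 - w) / 6 with hk
    have hk0 : 0 ≤ k := by rw [hk]; linarith
    have h1 : 0 ≤ 2 - k * w ^ 2 := by
      rw [hk]; nlinarith [mul_nonneg (sq_nonneg (w - 8 / 3)) (by linarith : 0 ≤ w)]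
    have h2 : 0 ≤ 8 - w ^ 2 * (k + 1 / 2) := by
      rw [hk]; nlinarith [mul_nonneg (sub_nonneg.2 hw2) (sub_nonneg.2 hw4),
        mul_nonneg (mul_nonneg (sub_nonneg.2 hw2) (sub_nonneg.2 hw4)) (by linarith : 0 ≤ w)]
    have h3 := mul_nonneg (sq_nonneg w) (mul_nonneg (sub_nonneg.2 hlt.le) (sub_nonneg.2 hc12))
    have h4 := mul_nonneg hk0 h1
    have h5 := mul_nonneg (sub_nonneg.2 hlt.le) h2
    have h6 : w = 4 - 6 * k := by rw [hk]; ring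
    exact hw (by linarith)
  have hcw2 : c ^ 2 ≤ ((4 - w) / 6) ^ 2 := pow_le_pow_left₀ hc.le hcw 2
  have h79 : 7 / 9 ≤ 1 - c ^ 2 * w := by
    have h1 : (4 - w) ^ 2 * w ≤ 8 := by
      nlinarith [mul_nonneg (sub_nonneg.2 hw2) (sub_nonneg.2 hw4),
        mul_nonneg (mul_nonneg (sub_nonneg.2 hw2) (sub_nonneg.2 hw4)) (by linarith : 0 ≤ w)]
    have h2 := mul_le_mul_of_nonneg_right hcw2 (by linarith : 0 ≤ w)
    linarith
  have hfin : 16 * (c ^ 2 * (w - 2)) ≤ (1 - c ^ 2 * w) ^ 2 := by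
    have h1 : (4 - w) ^ 2 * (w - 2) ≤ 32 / 27 := by
      nlinarith [mul_nonneg (sq_nonneg (w - 8 / 3)) (by linarith : 0 ≤ 14 / 3 - w)]
    have h2 := mul_le_mul_of_nonneg_right hcw2 (by linarith : 0 ≤ w - 2)
    have h3 := pow_le_pow_left₀ (by norm_num) h79 2
    linarith
  refine (abs_le.1 (abs_le_of_sq_le_sq ?_ ?_)).2
  · have h1 := mul_le_mul_of_nonneg_left hfin (by positivity : 0 ≤ c ^ 4 * w ^ 2)
    have h2 : 0 ≤ c ^ 6 * (w - 2) := mul_nonneg (by positivity) (by linarith)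
    linarith
  · have : 0 ≤ 1 - c ^ 2 * w := by linarith
    have : 0 ≤ w := by linarith
    positivity

/-- The real inequality combining the two estimates for the edge polynomial `q`, where `a ≥ b` are
the two largest weights and `σ` is the sum of the squares of all weights. -/
theorem le_quarter_mul_one_sub {a b σ q : ℝ} (hb : 0 ≤ b) (hba : b ≤ a) (hd : a + b ≤ 1)
    (hσ : a ^ 2 + b ^ 2 ≤ σ) (hσ' : σ ≤ a ^ 2 + b ^ 2 + b * (1 - a - b))
    (h1 : q ≤ a * b * (1 - a - b))
    (h2 : q ^ 2 ≤ (σ - a ^ 2 - b ^ 2) * (σ ^ 2 - a ^ 4 - b ^ 4)) :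
    q ≤ σ * (1 - σ) / 4 := by
  have ha : 0 ≤ a := hb.trans hba
  have hd0 : 0 ≤ 1 - a - b := by linarith
  have hσ0 : 0 ≤ σ := by nlinarith
  have hσ1 : 2 * a * (b + (1 - a - b)) ≤ 1 - σ := by
    nlinarith [mul_nonneg hb hd0, mul_nonneg ha hb, mul_nonneg ha hd0, mul_nonneg hd0 hd0]
  have hσ1' : 0 ≤ 1 - σ := le_trans (by positivity) hσ1
  rcases hb.eq_or_lt with rfl | hb
  · have := mul_nonneg hσ0 hσ1'
    simp only [mul_zero, zero_mul] at h1
    linarith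
  have ha : 0 < a := hb.trans_le hba
  rcases le_total (1 / 2) σ with hs | hs
  · have h3 : 4 * (b * (1 - a - b)) ≤ b + (1 - a - b) := by
      nlinarith [sq_nonneg (b - (1 - a - b))]
    nlinarith [mul_le_mul_of_nonneg_left h3 ha.le, mul_le_mul_of_nonneg_right hs hσ1']
  obtain ⟨c, hc, hcab⟩ : ∃ c : ℝ, 0 < c ∧ c ^ 2 = a * b :=
    ⟨√(a * b), Real.sqrt_pos.2 (by positivity), Real.sq_sqrt (by positivity)⟩
  have hc2 : 2 * c ≤ a + b := by
    nlinarith [sq_nonneg (a - b)]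
  have hA : q ≤ c ^ 2 * (1 - 2 * c) := by
    rw [hcab]
    exact h1.trans (mul_le_mul_of_nonneg_left (by linarith) (by positivity))
  have hB : q ^ 2 ≤ (σ - 2 * c ^ 2) * (σ ^ 2 - 2 * c ^ 4) := by
    have e4 : c ^ 4 = a ^ 2 * b ^ 2 := by
      calc c ^ 4 = (c ^ 2) ^ 2 := by ring
        _ = _ := by rw [hcab]; ring
    refine h2.trans (mul_le_mul ?_ ?_ ?_ ?_)
    · nlinarith [sq_nonneg (a - b)]
    · nlinarith [sq_nonneg (a ^ 2 - b ^ 2)]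
    · nlinarith [mul_self_le_mul_self (by positivity) hσ, mul_pos ha hb]
    · nlinarith [sq_nonneg (a - b)]
  obtain ⟨w, rfl⟩ : ∃ w, σ = c ^ 2 * w := ⟨σ / c ^ 2, by field_simp⟩
  have hc2pos : 0 < c ^ 2 := by positivity
  have hw2 : 2 ≤ w := by
    have : c ^ 2 * 2 ≤ c ^ 2 * w := by nlinarith [sq_nonneg (a - b)]
    exact le_of_mul_le_mul_left this hc2pos
  exact le_quarter_mul_one_sub_of_eq hc (by linarith) hw2 hs hA (hB.trans_eq (by ring))

/-- If `z u` and `z v` are the two largest values of `z`, then `z u * z v` is the largest product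
over a pair. -/
theorem prod_le_mul_of_card_eq_two {α : Type*} [DecidableEq α] {z : α → ℝ} (hz : ∀ i, 0 ≤ z i)
    {u v : α} (hu : ∀ i, z i ≤ z u) (hv : ∀ i, i ≠ u → z i ≤ z v) {p : Finset α}
    (hp : p.card = 2) : ∏ i ∈ p, z i ≤ z u * z v := by
  obtain ⟨j, k, hjk, rfl⟩ := Finset.card_eq_two.1 hp
  rw [Finset.prod_pair hjk]
  by_cases hj : j = u
  · subst hj
    exact mul_le_mul_of_nonneg_left (hv k hjk.symm) (hz j)
  · rw [mul_comm]
    exact mul_le_mul (hu k) (hv j hj) (hz j) (hz u)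

/-- If `φ` chooses distinct vertices from the edges, then at most two edges leave the same pair once
their chosen vertex is removed. -/
theorem card_filter_erase_eq_le_two {n : ℕ} {E : Finset (Finset (Fin n))}
    (hcodeg : ∀ u v : Fin n, u ≠ v → codeg E u v ≤ 2) {φ : Finset (Fin n) → Fin n}
    (hφ : Set.InjOn φ E) (hmem : ∀ e ∈ E, φ e ∈ e) {p : Finset (Fin n)} (hp : p.card = 2) :
    (E.filter (fun e => e.erase (φ e) = p)).card ≤ 2 := by
  obtain ⟨j, k, hjk, rfl⟩ := Finset.card_eq_two.1 hp
  refine le_trans ?_ (hcodeg j k hjk)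
  refine Finset.card_le_card_of_injOn φ ?_ (hφ.mono ?_)
  · intro e he
    obtain ⟨he, hep⟩ := Finset.mem_filter.1 he
    have : ({j, k, φ e} : Finset (Fin n)) = e := by
      refine Eq.trans ?_ (Finset.insert_erase (hmem e he))
      rw [hep]
      ext x
      simp only [Finset.mem_insert, Finset.mem_singleton]
      tauto
    simpa [this] using he
  · intro e he
    exact (Finset.mem_filter.1 he).1

/-- The edge polynomial of a sparse 3-graph of codegree at most 2 at a probability vector. -/
theorem sum_prod_le_quarter {n : ℕ} {E : Finset (Finset (Fin n))}
    (huniform : ∀ e ∈ E, e.card = 3) (hsparse : Sparse E)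
    (hcodeg : ∀ u v : Fin n, u ≠ v → codeg E u v ≤ 2) {z : Fin n → ℝ} (hz : ∀ i, 0 ≤ z i)
    (hz1 : ∑ i, z i = 1) :
    ∑ e ∈ E, ∏ i ∈ e, z i ≤ (∑ i, z i ^ 2) * (1 - ∑ i, z i ^ 2) / 4 := by
  classical
  rcases E.eq_empty_or_nonempty with rfl | ⟨e₀, he₀⟩
  · have h1 : ∑ i, z i ^ 2 ≤ 1 := by
      rw [← hz1]
      refine Finset.sum_le_sum fun i _ => ?_
      have : z i ≤ 1 := hz1 ▸ Finset.single_le_sum (fun i _ => hz i) (Finset.mem_univ i)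
      nlinarith [hz i]
    have h0 : 0 ≤ ∑ i, z i ^ 2 := Finset.sum_nonneg fun i _ => sq_nonneg _
    rw [Finset.sum_empty]
    have := mul_nonneg h0 (sub_nonneg.2 h1)
    linarith
  have hn : 3 ≤ n := by
    have := Finset.card_le_univ e₀
    rwa [huniform e₀ he₀, Fintype.card_fin] at this
  obtain ⟨u, -, hu⟩ := Finset.exists_max_image Finset.univ z ⟨⟨0, by omega⟩, Finset.mem_univ _⟩
  obtain ⟨v, hvu, hv⟩ := Finset.exists_max_image (Finset.univ.erase u) z (by
    rw [← Finset.card_pos, Finset.card_erase_of_mem (Finset.mem_univ u), Finset.card_univ,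
      Fintype.card_fin]
    omega)
  have hvu : v ≠ u := Finset.ne_of_mem_erase hvu
  replace hu : ∀ i, z i ≤ z u := fun i => hu i (Finset.mem_univ i)
  replace hv : ∀ i, i ≠ u → z i ≤ z v := fun i hi =>
    hv i (Finset.mem_erase.2 ⟨hi, Finset.mem_univ i⟩)
  obtain ⟨φ, hφ, hφE⟩ := hsparse.exists_injOn_avoiding hvu.symm
  set R : Finset (Fin n) := (Finset.univ.erase u).erase v with hR
  have hsplit : ∀ f : Fin n → ℝ, ∑ i, f i = f u + f v + ∑ i ∈ R, f i := fun f => by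
    rw [← Finset.add_sum_erase _ f (Finset.mem_univ u),
      ← Finset.add_sum_erase _ f (Finset.mem_erase.2 ⟨hvu, Finset.mem_univ v⟩), add_assoc]
  have hφR : ∀ f : Fin n → ℝ, (∀ i, 0 ≤ f i) → ∑ e ∈ E, f (φ e) ≤ ∑ i ∈ R, f i := fun f hf => by
    rw [← Finset.sum_image hφ]
    refine Finset.sum_le_sum_of_subset_of_nonneg ?_ fun i _ _ => hf i
    intro i hi
    obtain ⟨e, he, rfl⟩ := Finset.mem_image.1 hi
    have := hφE e he
    simp [hR, this.2.1, this.2.2]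
  have hprod : ∀ e ∈ E, ∏ i ∈ e, z i = z (φ e) * ∏ i ∈ e.erase (φ e), z i := fun e he =>
    (Finset.mul_prod_erase e z (hφE e he).1).symm
  have hcard : ∀ e ∈ E, (e.erase (φ e)).card = 2 := fun e he => by
    rw [Finset.card_erase_of_mem (hφE e he).1, huniform e he]
  have hsum := hsplit z
  have hsq := hsplit fun i => z i ^ 2
  rw [hz1] at hsum
  have hR0 : 0 ≤ ∑ i ∈ R, z i := Finset.sum_nonneg fun i _ => hz i
  have hRle : ∑ i ∈ R, z i ^ 2 ≤ z v * ∑ i ∈ R, z i := by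
    rw [Finset.mul_sum]
    refine Finset.sum_le_sum fun i hi => ?_
    have hiu : i ≠ u := Finset.ne_of_mem_erase (Finset.mem_of_mem_erase hi)
    rw [sq]
    exact mul_le_mul_of_nonneg_right (hv i hiu) (hz i)
  have hRsq : 0 ≤ ∑ i ∈ R, z i ^ 2 := Finset.sum_nonneg fun i _ => sq_nonneg _
  have hd : 1 - z u - z v = ∑ i ∈ R, z i := by linarith
  apply le_quarter_mul_one_sub (hz v) (hu v)
  · linarith
  · linarith
  · rw [hd]; linarith
  · rw [hd, Finset.sum_congr rfl hprod]
    calc ∑ e ∈ E, z (φ e) * ∏ i ∈ e.erase (φ e), z i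
        ≤ ∑ e ∈ E, z (φ e) * (z u * z v) := Finset.sum_le_sum fun e he =>
          mul_le_mul_of_nonneg_left (prod_le_mul_of_card_eq_two hz hu hv (hcard e he)) (hz _)
      _ = z u * z v * ∑ e ∈ E, z (φ e) := by rw [← Finset.sum_mul, mul_comm]
      _ ≤ _ := mul_le_mul_of_nonneg_left (hφR z hz) (mul_nonneg (hz u) (hz v))
  · have hpairs : ∑ e ∈ E, (∏ i ∈ e.erase (φ e), z i) ^ 2 ≤
        (∑ i, z i ^ 2) ^ 2 - ∑ i, (z i ^ 2) ^ 2 := by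
      rw [← two_mul_sum_powersetCard_two, Finset.mul_sum,
        ← Finset.sum_fiberwise_of_maps_to (t := Finset.univ.powersetCard 2)
          (g := fun e => e.erase (φ e))
          (fun e he => Finset.mem_powersetCard.2 ⟨Finset.subset_univ _, hcard e he⟩)]
      refine Finset.sum_le_sum fun p hp => ?_
      rw [Finset.sum_congr rfl (g := fun _ => ∏ i ∈ p, z i ^ 2) fun e he => by
        rw [(Finset.mem_filter.1 he).2, Finset.prod_pow], Finset.sum_const, nsmul_eq_mul]
      refine mul_le_mul_of_nonneg_right ?_ (Finset.prod_nonneg fun i _ => sq_nonneg _)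
      exact_mod_cast card_filter_erase_eq_le_two hcodeg hφ (fun e he => (hφE e he).1)
        (Finset.mem_powersetCard.1 hp).2
    have h4 := hsplit fun i => (z i ^ 2) ^ 2
    have h4R : 0 ≤ ∑ i ∈ R, (z i ^ 2) ^ 2 := Finset.sum_nonneg fun i _ => sq_nonneg _
    rw [Finset.sum_congr rfl hprod]
    refine (Finset.sum_mul_sq_le_sq_mul_sq E _ _).trans ?_
    refine mul_le_mul ?_ ?_ (Finset.sum_nonneg fun _ _ => sq_nonneg _) ?_
    · have := hφR (fun i => z i ^ 2) fun i => sq_nonneg _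
      linarith
    · linarith
    · linarith

/-- The edge polynomial of the cone, split according to whether an edge contains the apex. -/
theorem two_mul_sum_coneEdges {n : ℕ} (E : Finset (Finset (Fin n))) (x : Fin (n + 1) → ℝ) :
    2 * ∑ e ∈ coneEdges E, ∏ i ∈ e, x i =
      2 * ∑ e ∈ E, ∏ i ∈ e, x i.castSucc + x (Fin.last n) *
        ((∑ i : Fin n, x i.castSucc) ^ 2 - ∑ i : Fin n, x i.castSucc ^ 2) := by
  classical
  have hinj : Function.Injective (Fin.castSucc : Fin n → Fin (n + 1)) :=
    Fin.castSucc_injective n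
  have hlast : ∀ p : Finset (Fin n), Fin.last n ∉ p.image Fin.castSucc := fun p h => by
    obtain ⟨i, -, hi⟩ := Finset.mem_image.1 h
    exact (Fin.castSucc_lt_last i).ne hi
  have hprod : ∀ p : Finset (Fin n), ∏ i ∈ p.image Fin.castSucc, x i = ∏ i ∈ p, x i.castSucc :=
    fun p => Finset.prod_image hinj.injOn
  have hapex : (Finset.univ : Finset (Finset (Fin (n + 1)))).filter
      (fun e => e.card = 3 ∧ Fin.last n ∈ e) =
      (Finset.univ.powersetCard 2).image
        (fun p : Finset (Fin n) => insert (Fin.last n) (p.image Fin.castSucc)) := by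
    ext e
    simp only [Finset.mem_filter, Finset.mem_univ, true_and, Finset.mem_image,
      Finset.mem_powersetCard, Finset.subset_univ]
    constructor
    · rintro ⟨hc, hl⟩
      have him : (Finset.univ.filter fun i : Fin n => i.castSucc ∈ e).image Fin.castSucc =
          e.erase (Fin.last n) := by
        ext i
        refine Fin.lastCases ?_ (fun j => ?_) i
        · simp [Fin.castSucc_ne_last]
        · simp [Fin.castSucc_ne_last]
      refine ⟨Finset.univ.filter fun i : Fin n => i.castSucc ∈ e, ?_, ?_⟩
      · rw [← Finset.card_image_of_injective _ hinj, him, Finset.card_erase_of_mem hl, hc]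
      · rw [him, Finset.insert_erase hl]
    · rintro ⟨p, hp, rfl⟩
      rw [Finset.card_insert_of_notMem (hlast p), Finset.card_image_of_injective _ hinj, hp]
      exact ⟨rfl, Finset.mem_insert_self _ _⟩
  have hdisj : Disjoint (E.image (Finset.image Fin.castSucc))
      ((Finset.univ : Finset (Finset (Fin (n + 1)))).filter
        (fun e => e.card = 3 ∧ Fin.last n ∈ e)) := by
    rw [Finset.disjoint_left]
    intro e he he'
    obtain ⟨p, -, rfl⟩ := Finset.mem_image.1 he
    exact hlast p (Finset.mem_filter.1 he').2.2
  rw [coneEdges, Finset.sum_union hdisj, hapex, mul_add,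
    Finset.sum_image (Finset.image_injective hinj).injOn, Finset.sum_image,
    ← two_mul_sum_powersetCard_two]
  · simp only [hprod, Finset.prod_insert (hlast _), ← Finset.mul_sum]
    ring
  · intro p _ q _ h
    refine Finset.image_injective hinj ?_
    rw [← Finset.erase_insert (hlast p), ← Finset.erase_insert (hlast q)]
    exact congrArg (fun e => e.erase (Fin.last n)) h

/-- The one-variable maximisation over the weight `1 - s` of the apex. -/
theorem cone_polynomial_le {s σ : ℝ} (hs0 : 0 ≤ s) (hσ1 : σ ≤ 1) :
    3 * (1 - s) * s ^ 2 * (1 - σ) + 6 * s ^ 3 * (σ * (1 - σ) / 4) ≤ 4 / 9 := by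
  set B := 3 - 3 / 2 * σ with hB
  have hBpos : 0 < B := by linarith
  have h1 : (B * s) ^ 2 * (3 - B * s) ≤ 4 := by
    nlinarith [mul_nonneg (sq_nonneg (B * s - 2)) (by positivity : 0 ≤ B * s + 1)]
  have h2 : 9 * (1 - σ) ≤ B ^ 2 := by
    rw [hB]; nlinarith [sq_nonneg σ]
  have h3 := mul_le_mul_of_nonneg_left h1 (sub_nonneg.2 hσ1)
  have h4 : B ^ 2 * (s ^ 2 * (3 - B * s) * (1 - σ)) ≤ B ^ 2 * (4 / 9) := by linarith
  have h5 := le_of_mul_le_mul_left h4 (by positivity)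
  rw [hB] at h5
  linarith

/-- If `Q` is a sparse 3-graph with maximum codegree at most 2, then
`λ(cone(Q)) ≤ 4/9`. -/
theorem cone_lagrangian_le (n : ℕ) (E : Finset (Finset (Fin n)))
    (huniform : ∀ e ∈ E, e.card = 3)
    (hsparse : Sparse E)
    (hcodeg : ∀ u v : Fin n, u ≠ v → codeg E u v ≤ 2) :
    lagrangian (coneEdges E) ≤ 4 / 9 := by
  refine Real.sSup_le ?_ (by norm_num)
  rintro _ ⟨x, hx, hx1, rfl⟩
  set t := x (Fin.last n)
  set s := ∑ i : Fin n, x i.castSucc with hs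
  have hst : t = 1 - s := by
    rw [Fin.sum_univ_castSucc] at hx1
    linarith
  have hs0 : 0 ≤ s := Finset.sum_nonneg fun i _ => hx _
  have hcone := two_mul_sum_coneEdges E x
  rcases hs0.eq_or_lt with hs0' | hs0'
  · have hzero : ∀ i : Fin n, x i.castSucc = 0 := fun i =>
      (Finset.sum_eq_zero_iff_of_nonneg fun i _ => hx _).1 hs0'.symm i (Finset.mem_univ i)
    have hE : ∑ e ∈ E, ∏ i ∈ e, x i.castSucc = 0 := Finset.sum_eq_zero fun e he => by
      obtain ⟨i, hi⟩ : e.Nonempty := Finset.card_pos.1 (by rw [huniform e he]; norm_num)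
      exact Finset.prod_eq_zero hi (hzero i)
    rw [hE] at hcone
    simp only [hzero, Finset.sum_const_zero] at hcone
    norm_num at hcone
    rw [hcone]
    norm_num
  set z : Fin n → ℝ := fun i => x i.castSucc / s with hz
  have hxz : ∀ i : Fin n, x i.castSucc = s * z i := fun i => by
    simp only [hz]; field_simp
  have hz0 : ∀ i, 0 ≤ z i := fun i => div_nonneg (hx _) hs0
  have hz1 : ∑ i, z i = 1 := by
    rw [hz, ← Finset.sum_div, ← hs, div_self hs0'.ne']
  have hq := sum_prod_le_quarter huniform hsparse hcodeg hz0 hz1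
  have hσ1 : ∑ i, z i ^ 2 ≤ 1 := by
    simpa [hz1] using Finset.sum_sq_le_sq_sum_of_nonneg (s := Finset.univ) fun i _ => hz0 i
  have hE : ∑ e ∈ E, ∏ i ∈ e, x i.castSucc = s ^ 3 * ∑ e ∈ E, ∏ i ∈ e, z i := by
    rw [Finset.mul_sum]
    refine Finset.sum_congr rfl fun e he => ?_
    simp only [hxz, Finset.prod_mul_distrib, Finset.prod_const, huniform e he]
  have hS : ∑ i : Fin n, x i.castSucc ^ 2 = s ^ 2 * ∑ i, z i ^ 2 := by
    simp only [hxz, mul_pow, Finset.mul_sum]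
  rw [hE, hS, ← hs, show x (Fin.last n) = 1 - s from hst] at hcone
  have h1 := cone_polynomial_le hs0 hσ1
  have h2 := mul_le_mul_of_nonneg_left hq (by positivity : 0 ≤ s ^ 3)
  linarith
end

section
/- Let ρ and q be real numbers with 0 ≤ ρ ≤ 1, 0 ≤ q, and q ≤ τ(ρ). Then for every b ∈ [0,1], 3(1−b)b²(1−ρ) + 6b³q ≤ 4/9. -/
/-- The threshold function `τ` from the paper: `τ(ρ) = (1-ρ)(1-√(1-ρ))/2` for
`0 ≤ ρ ≤ 5/9` and `τ(ρ) = 2/27` for `5/9 ≤ ρ ≤ 1` (the two formulas agree at `ρ = 5/9`). -/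
noncomputable def tau (ρ : ℝ) : ℝ :=
  if ρ ≤ 5/9 then (1 - ρ) * (1 - Real.sqrt (1 - ρ)) / 2 else 2/27

/-- If `q ≤ τ(ρ)` then `3(1-b)b²(1-ρ) + 6b³q ≤ 4/9` for every `b ∈ [0,1]`. -/
theorem apex_weight_bound (ρ q : ℝ) (hρ0 : 0 ≤ ρ) (hρ1 : ρ ≤ 1)
    (hq0 : 0 ≤ q) (hq : q ≤ tau ρ) :
    ∀ b : ℝ, 0 ≤ b → b ≤ 1 →
      3 * (1 - b) * b ^ 2 * (1 - ρ) + 6 * b ^ 3 * q ≤ 4 / 9 := by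
  intro b hb0 hb1
  have hb3 : 0 ≤ 6 * b ^ 3 := by positivity
  have hqb := mul_le_mul_of_nonneg_left hq hb3
  unfold tau at hqb
  split_ifs at hqb with h
  · set s := Real.sqrt (1 - ρ)
    have hs : s ^ 2 = 1 - ρ := Real.sq_sqrt (by linarith)
    have ht : 0 ≤ b * s := mul_nonneg hb0 (Real.sqrt_nonneg _)
    have key : 0 ≤ (b * s - 2 / 3) ^ 2 * (b * s + 1 / 3) := by positivity
    rw [← hs] at hqb ⊢
    linarith
  · have hx : 0 ≤ (1 - b) * b ^ 2 * (ρ - 5 / 9) :=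
      mul_nonneg (mul_nonneg (by linarith) (by positivity)) (by linarith)
    have key : 0 ≤ (1 - b) ^ 2 * (1 + 2 * b) := by positivity
    linarith
end

section
/- Let Q be a sparse 3-graph with maximum codegree Δ₂(Q) ≤ 2. Then for every probability vector z on V(Q), q_Q(z) ≤ τ(ρ(z)). -/
/-- Abel summation for sparse 3-graphs: if `m e` is a lower bound for `z` on each edge `e`, then
the sum of `m` over the edges inside `S` is at most the sum of `z` over `S` without its two
largest values. -/
theorem Sparse.sum_le_sum_sub_sub {n : ℕ} {E : Finset (Finset (Fin n))} (hE : Sparse E)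
    {u v : Fin n} (huv : u ≠ v) (S : Finset (Fin n)) (z : Fin n → ℝ) (m : Finset (Fin n) → ℝ)
    (hu : u ∈ S) (hv : v ∈ S) (hz : ∀ i ∈ S, 0 ≤ z i) (hm : ∀ e ∈ E, ∀ i ∈ e, m e ≤ z i)
    (htop : ∀ w ∈ S, w ≠ u → w ≠ v → z w ≤ z u ∧ z w ≤ z v) :
    ∑ e ∈ E.filter (· ⊆ S), m e ≤ ∑ i ∈ S, z i - z u - z v := by
  induction S using Finset.strongInduction generalizing z m with
  | H S ih =>
    have huvS : ({u, v} : Finset (Fin n)) ⊆ S := by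
      simp [Finset.insert_subset_iff, hu, hv]
    have hcard : 2 ≤ S.card := by
      simpa [Finset.card_pair huv] using Finset.card_le_card huvS
    have hsp := hE S hcard
    rcases (S \ {u, v}).eq_empty_or_nonempty with hemp | hne
    · have hS : S = {u, v} := (Finset.sdiff_eq_empty_iff_subset.1 hemp).antisymm huvS
      rw [hS, Finset.card_pair huv] at hsp
      have h0 : E.filter (· ⊆ S) = ∅ := by
        rw [hS]; exact Finset.card_eq_zero.1 (by omega)
      rw [h0, hS, Finset.sum_pair huv]
      simp
    · obtain ⟨w, hw, hwmin⟩ := Finset.exists_min_image (S \ {u, v}) z hne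
      simp only [Finset.mem_sdiff, Finset.mem_insert, Finset.mem_singleton, not_or] at hw hwmin
      obtain ⟨hwS, hwu, hwv⟩ := hw
      have hwle : ∀ i ∈ S, z w ≤ z i := by
        intro i hi
        by_cases h1 : i = u
        · exact h1 ▸ (htop w hwS hwu hwv).1
        by_cases h2 : i = v
        · exact h2 ▸ (htop w hwS hwu hwv).2
        exact hwmin i ⟨hi, h1, h2⟩
      have key := ih (S.erase w) (Finset.erase_ssubset hwS) (fun i => z i - z w)
        (fun e => m e - z w) (Finset.mem_erase.2 ⟨Ne.symm hwu, hu⟩)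
        (Finset.mem_erase.2 ⟨Ne.symm hwv, hv⟩)
        (fun i hi => sub_nonneg.2 (hwle i (Finset.mem_of_mem_erase hi)))
        (fun e he i hi => sub_le_sub_right (hm e he i hi) _)
        (fun x hx h1 h2 => by
          have := htop x (Finset.mem_of_mem_erase hx) h1 h2
          exact ⟨sub_le_sub_right this.1 _, sub_le_sub_right this.2 _⟩)
      have h1 : ∑ e ∈ E.filter (· ⊆ S), (m e - z w) ≤
          ∑ e ∈ E.filter (· ⊆ S.erase w), (m e - z w) := by
        have hsub : E.filter (· ⊆ S.erase w) ⊆ E.filter (· ⊆ S) :=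
          Finset.monotone_filter_right _ fun e _ he => he.trans (Finset.erase_subset _ _)
        rw [← Finset.sum_sdiff hsub]
        have : ∑ e ∈ E.filter (· ⊆ S) \ E.filter (· ⊆ S.erase w), (m e - z w) ≤ 0 := by
          refine Finset.sum_nonpos fun e he => ?_
          simp only [Finset.mem_sdiff, Finset.mem_filter, not_and] at he
          obtain ⟨⟨heE, heS⟩, hnot⟩ := he
          have hwe : w ∈ e := by
            by_contra hwe
            exact hnot heE (Finset.subset_erase.2 ⟨heS, hwe⟩)
          linarith [hm e heE w hwe]
        linarith
      have h2 : ∑ i ∈ S.erase w, (z i - z w) = ∑ i ∈ S, z i - S.card * z w := by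
        rw [← Finset.add_sum_erase S z hwS, Finset.sum_sub_distrib, Finset.sum_const,
          Finset.card_erase_of_mem hwS, nsmul_eq_mul, Nat.cast_sub (by omega)]
        push_cast
        ring
      rw [h2] at key
      rw [Finset.sum_sub_distrib, Finset.sum_const, nsmul_eq_mul] at h1
      have h3 : ((E.filter (· ⊆ S)).card : ℝ) ≤ S.card - 2 := by
        have : (((E.filter (· ⊆ S)).card : ℕ) : ℝ) ≤ ((S.card - 2 : ℕ) : ℝ) := by
          exact_mod_cast hsp
        rwa [Nat.cast_sub hcard] at this
      have h4 := mul_le_mul_of_nonneg_right h3 (hz w hwS)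
      linarith

/-- The edges through a pair `a, b` that avoid the rest of `F ⊇ {a, b}` have few third vertices,
so the part of their weight above `c` times their least vertex weight is small. -/
theorem exists_sum_excess_le {n : ℕ} {E : Finset (Finset (Fin n))}
    (hE : ∀ e ∈ E, e.card = 3) {a b : Fin n} (hab : a ≠ b) (hcodeg : codeg E a b ≤ 2)
    {z : Fin n → ℝ} (hz : ∀ i, 0 ≤ z i) {m : Finset (Fin n) → ℝ}
    (hm : ∀ e ∈ E, ∃ k ∈ e, m e = z k) {c : ℝ} (hc : 0 ≤ c) {F : Finset (Fin n)}
    (ha : a ∈ F) (hb : b ∈ F) (hF : ∀ k ∉ F, z k ≤ z a ∧ z k ≤ z b) :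
    ∃ t, 0 ≤ t ∧ t ^ 2 ≤ 2 * (∑ i, z i ^ 2 - ∑ i ∈ F, z i ^ 2) ∧
      ∑ e ∈ E.filter (fun e => a ∈ e ∧ b ∈ e ∧ ∀ x ∈ F, x ∈ e → x = a ∨ x = b),
        max 0 (∏ i ∈ e, z i - c * m e) ≤ max 0 (z a * z b - c) * t := by
  set K := Finset.univ.filter (fun w => ({a, b, w} : Finset (Fin n)) ∈ E ∧ w ∉ F) with hK
  have hKcard : K.card ≤ 2 := by
    refine le_trans (Finset.card_le_card ?_) hcodeg
    intro w hw
    simp only [hK, Finset.mem_filter] at hw ⊢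
    exact ⟨hw.1, hw.2.1⟩
  have hKF : Disjoint K F := by
    rw [Finset.disjoint_left]
    intro w hw
    exact (Finset.mem_filter.1 hw).2.2
  refine ⟨∑ k ∈ K, z k, Finset.sum_nonneg fun k _ => hz k, ?_, ?_⟩
  · have h1 : (∑ k ∈ K, z k) ^ 2 ≤ K.card * ∑ k ∈ K, z k ^ 2 := sq_sum_le_card_mul_sum_sq
    have h2 : ∑ i ∈ K, z i ^ 2 + ∑ i ∈ F, z i ^ 2 ≤ ∑ i, z i ^ 2 := by
      rw [← Finset.sum_union hKF]
      exact Finset.sum_le_univ_sum_of_nonneg fun i => sq_nonneg _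
    have h3 : (K.card : ℝ) ≤ 2 := by exact_mod_cast hKcard
    have h4 : 0 ≤ ∑ k ∈ K, z k ^ 2 := Finset.sum_nonneg fun i _ => sq_nonneg _
    nlinarith
  · have hsub : E.filter (fun e => a ∈ e ∧ b ∈ e ∧ ∀ x ∈ F, x ∈ e → x = a ∨ x = b) ⊆
        K.image (fun k => {a, b, k}) := by
      intro e he
      obtain ⟨heE, hae, hbe, hx⟩ := Finset.mem_filter.1 he
      have hbe' : b ∈ e.erase a := Finset.mem_erase.2 ⟨hab.symm, hbe⟩
      have hcard1 : ((e.erase a).erase b).card = 1 := by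
        rw [Finset.card_erase_of_mem hbe', Finset.card_erase_of_mem hae, hE e heE]
      obtain ⟨k, hk⟩ := Finset.card_eq_one.1 hcard1
      have hek : ({a, b, k} : Finset (Fin n)) = e := by
        rw [← Finset.insert_erase hae, ← Finset.insert_erase hbe', hk]
      have hkmem : k ∈ (e.erase a).erase b := by simp [hk]
      simp only [Finset.mem_erase] at hkmem
      refine Finset.mem_image.2 ⟨k, ?_, hek⟩
      refine Finset.mem_filter.2 ⟨Finset.mem_univ _, hek ▸ heE, fun hkF => ?_⟩
      rcases hx k hkF hkmem.2.2 with h | h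
      · exact hkmem.2.1 h
      · exact hkmem.1 h
    calc _ ≤ ∑ e ∈ K.image (fun k => ({a, b, k} : Finset (Fin n))),
          max 0 (∏ i ∈ e, z i - c * m e) :=
          Finset.sum_le_sum_of_subset_of_nonneg hsub fun _ _ _ => le_max_left _ _
      _ ≤ ∑ k ∈ K, max 0 (∏ i ∈ ({a, b, k} : Finset (Fin n)), z i - c * m {a, b, k}) :=
          Finset.sum_image_le_of_nonneg fun _ _ => le_max_left _ _
      _ ≤ ∑ k ∈ K, max 0 (z a * z b - c) * z k := by
          refine Finset.sum_le_sum fun k hk => ?_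
          obtain ⟨-, hkE, hkF⟩ := Finset.mem_filter.1 hk
          have hka : a ≠ k := fun h => hkF (h ▸ ha)
          have hkb : b ≠ k := fun h => hkF (h ▸ hb)
          have hmk : z k ≤ m {a, b, k} := by
            obtain ⟨j, hj, hmj⟩ := hm _ hkE
            rw [hmj]
            simp only [Finset.mem_insert, Finset.mem_singleton] at hj
            rcases hj with rfl | rfl | rfl
            · exact (hF k hkF).1
            · exact (hF k hkF).2
            · exact le_rfl
          have hprod : ∏ i ∈ ({a, b, k} : Finset (Fin n)), z i = z a * (z b * z k) := by
            rw [Finset.prod_insert (by simp [hab, hka]), Finset.prod_pair hkb]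
          rw [hprod]
          refine max_le (mul_nonneg (le_max_left _ _) (hz k)) ?_
          have h1 := mul_le_mul_of_nonneg_left hmk hc
          have h2 := mul_le_mul_of_nonneg_right (le_max_right 0 (z a * z b - c)) (hz k)
          nlinarith
      _ = _ := by rw [Finset.mul_sum]

theorem mul_one_sub_div_four_le_tau {ρ : ℝ} (h0 : 0 ≤ ρ) (h1 : ρ ≤ 5 / 9) :
    ρ * (1 - ρ) / 4 ≤ tau ρ := by
  rw [tau, if_pos h1]
  have hs := Real.sq_sqrt (show 0 ≤ 1 - ρ by linarith)
  have hs0 := Real.sqrt_nonneg (1 - ρ)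
  set s := Real.sqrt (1 - ρ)
  have hρ : ρ = 1 - s ^ 2 := by linarith
  have hs1 : s ≤ 1 := by nlinarith
  rw [hρ]
  nlinarith [mul_nonneg (mul_nonneg hs0 hs0) (mul_nonneg (sub_nonneg.2 hs1) (sub_nonneg.2 hs1))]

theorem one_div_le_tau {ρ : ℝ} (h0 : 1 / 5 ≤ ρ) : 1 / 27 ≤ tau ρ := by
  by_cases h1 : ρ ≤ 5 / 9
  · have := mul_one_sub_div_four_le_tau (by linarith) h1
    nlinarith
  · rw [tau, if_neg h1]
    norm_num

/-- The excess of the heaviest pair in normalized coordinates. -/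
theorem top_pair_excess_le {x y t : ℝ} (hxy0 : 0 ≤ x + y) (hxy : 1 / 4 ≤ x * y)
    (ht : 0 ≤ t) (h : t ^ 2 ≤ 2 * (1 - (x ^ 2 + y ^ 2))) :
    (4 * (x * y) - 1) * t ≤ x + y - 17 / 20 := by
  obtain ⟨s, hs⟩ : ∃ s, s = x + y := ⟨_, rfl⟩
  have h4 : 4 * (x * y) ≤ s ^ 2 := by rw [hs]; nlinarith [sq_nonneg (x - y)]
  have ht2 : t ^ 2 ≤ 2 - s ^ 2 := by rw [hs]; nlinarith [sq_nonneg (x - y)]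
  have hs1 : 1 ≤ s := by nlinarith
  have htl : t ≤ (249 / 100 - s ^ 2) * (5 / 7) := by
    nlinarith [sq_nonneg (t - 7 / 10)]
  have hs2 : s ≤ 1.42 := by nlinarith [sq_nonneg t]
  have hpoly : (s ^ 2 - 1) * ((249 / 100 - s ^ 2) * (5 / 7)) ≤ s - 17 / 20 := by
    nlinarith [mul_nonneg (zero_le_one.trans hs1) (sq_nonneg (s - 1.206)),
      sq_nonneg (s - 1.206), sq_nonneg (s ^ 2 - 1.206 * s)]
  rw [← hs]
  calc _ ≤ (s ^ 2 - 1) * t := by gcongr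
    _ ≤ (s ^ 2 - 1) * ((249 / 100 - s ^ 2) * (5 / 7)) := by
      apply mul_le_mul_of_nonneg_left htl; nlinarith
    _ ≤ _ := hpoly

/-- The excess of the other heavy pairs in normalized coordinates. -/
theorem pair_excess_le {p t w : ℝ} (ht : 0 ≤ t) (hp : 8 * p ^ 2 ≤ w ^ 2) (hw : 0 ≤ w)
    (h : t ^ 2 ≤ 2 * (1 - w)) : max 0 (4 * p - 1) * t ≤ 1 / 8 := by
  rcases max_choice 0 (4 * p - 1) with h0 | h0
  · rw [h0]; norm_num
  · rw [h0]
    have h1 : 4 * p ≤ 1.415 * w := by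
      by_contra! hlt
      nlinarith [mul_nonneg hw hw]
    have h2 : 4 * p - 1 ≤ 0.415 - 0.7075 * t ^ 2 := by nlinarith
    calc _ ≤ (0.415 - 0.7075 * t ^ 2) * t := by gcongr
      _ ≤ _ := by nlinarith [mul_nonneg ht (sq_nonneg (t - 0.4423)), sq_nonneg (t - 0.4423)]

/-- The real-variable estimate behind `q_le_tau` when `ρ` is small. -/
theorem sum_excess_le {ρ a b c d t₁ t₂ t₃ t₄ : ℝ} (hρ0 : 0 < ρ) (hρ : ρ ≤ 1 / 5) (hρa : ρ ≤ a)
    (hab : b ≤ a) (hbc : c ≤ b) (hcd : d ≤ c) (hd : 0 ≤ d)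
    (h₁ : 0 ≤ t₁) (h₂ : 0 ≤ t₂) (h₃ : 0 ≤ t₃) (h₄ : 0 ≤ t₄)
    (k₁ : t₁ ^ 2 ≤ 2 * (ρ - (a ^ 2 + b ^ 2)))
    (k₂ : t₂ ^ 2 ≤ 2 * (ρ - (a ^ 2 + b ^ 2 + c ^ 2)))
    (k₃ : t₃ ^ 2 ≤ 2 * (ρ - (a ^ 2 + b ^ 2 + c ^ 2)))
    (k₄ : t₄ ^ 2 ≤ 2 * (ρ - (a ^ 2 + b ^ 2 + c ^ 2 + d ^ 2))) :
    ρ / 4 * (1 - a - b) + (max 0 (a * b - ρ / 4) * t₁ + max 0 (a * c - ρ / 4) * t₂ +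
      max 0 (b * c - ρ / 4) * t₃ + max 0 (a * d - ρ / 4) * t₄) ≤ ρ * (1 - ρ) / 4 := by
  have hc : 0 ≤ c := hd.trans hcd
  have hb : 0 ≤ b := hc.trans hbc
  have ha : 0 ≤ a := hb.trans hab
  rcases le_or_gt (a * b) (ρ / 4) with hle | hgt
  · have e2 : a * c ≤ a * b := by gcongr
    have e3 : b * c ≤ a * b := by nlinarith
    have e4 : a * d ≤ a * b := by gcongr; linarith
    rw [max_eq_left (by linarith), max_eq_left (by linarith), max_eq_left (by linarith),
      max_eq_left (by linarith)]
    nlinarith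
  · obtain ⟨r, hr0, hr⟩ : ∃ r, 0 < r ∧ r ^ 2 = ρ :=
      ⟨√ρ, Real.sqrt_pos.2 hρ0, Real.sq_sqrt hρ0.le⟩
    have scale : ∀ x : ℝ, ∃ y, x = r * y := fun x => ⟨x / r, by field_simp⟩
    obtain ⟨x, rfl⟩ := scale a
    obtain ⟨y, rfl⟩ := scale b
    obtain ⟨z, rfl⟩ := scale c
    obtain ⟨w, rfl⟩ := scale d
    obtain ⟨u₁, rfl⟩ := scale t₁
    obtain ⟨u₂, rfl⟩ := scale t₂
    obtain ⟨u₃, rfl⟩ := scale t₃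
    obtain ⟨u₄, rfl⟩ := scale t₄
    subst hr
    have hx := nonneg_of_mul_nonneg_right ha hr0
    have hy := nonneg_of_mul_nonneg_right hb hr0
    have hz := nonneg_of_mul_nonneg_right hc hr0
    have hw := nonneg_of_mul_nonneg_right hd hr0
    have hu₁ := nonneg_of_mul_nonneg_right h₁ hr0
    have hu₂ := nonneg_of_mul_nonneg_right h₂ hr0
    have hu₃ := nonneg_of_mul_nonneg_right h₃ hr0
    have hu₄ := nonneg_of_mul_nonneg_right h₄ hr0
    have hxy := le_of_mul_le_mul_left hab hr0
    have hyz := le_of_mul_le_mul_left hbc hr0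
    have hzw := le_of_mul_le_mul_left hcd hr0
    have l₁ : u₁ ^ 2 ≤ 2 * (1 - (x ^ 2 + y ^ 2)) :=
      le_of_mul_le_mul_left (by linarith) hρ0
    have l₂ : u₂ ^ 2 ≤ 2 * (1 - (x ^ 2 + y ^ 2 + z ^ 2)) :=
      le_of_mul_le_mul_left (by linarith) hρ0
    have l₃ : u₃ ^ 2 ≤ 2 * (1 - (x ^ 2 + y ^ 2 + z ^ 2)) :=
      le_of_mul_le_mul_left (by linarith) hρ0
    have l₄ : u₄ ^ 2 ≤ 2 * (1 - (x ^ 2 + y ^ 2 + z ^ 2 + w ^ 2)) :=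
      le_of_mul_le_mul_left (by linarith) hρ0
    have hxy4 : 1 / 4 < x * y := lt_of_mul_lt_mul_left (by linarith) hρ0.le
    have s₁ := top_pair_excess_le (by linarith) hxy4.le hu₁ l₁
    have hyz2 : z ^ 2 ≤ y ^ 2 := by gcongr
    have hxy2 : y ^ 2 ≤ x ^ 2 := by gcongr
    have hzw2 : w ^ 2 ≤ z ^ 2 := by gcongr
    have amgm : ∀ p q : ℝ, 8 * (p * q) ^ 2 ≤ (p ^ 2 + 2 * q ^ 2) ^ 2 := fun p q => by
      linarith [sq_nonneg (p ^ 2 - 2 * q ^ 2)]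
    have s₂ := pair_excess_le (p := x * z) (w := x ^ 2 + 2 * z ^ 2) hu₂
      (amgm x z) (by positivity) (by linarith)
    have s₃ := pair_excess_le (p := y * z) (w := z ^ 2 + 2 * y ^ 2) hu₃
      (mul_comm z y ▸ amgm z y) (by positivity) (by linarith)
    have s₄ := pair_excess_le (p := x * w) (w := x ^ 2 + 2 * w ^ 2) hu₄
      (amgm x w) (by positivity)
      (by linarith [sq_nonneg w])
    have hmax : ∀ p q : ℝ, max 0 (r * p * (r * q) - r ^ 2 / 4) =
        r ^ 2 / 4 * max 0 (4 * (p * q) - 1) := by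
      intro p q
      rw [mul_max_of_nonneg _ _ (by positivity)]
      congr 1 <;> ring
    rw [hmax, hmax, hmax, hmax, max_eq_right (show 0 ≤ 4 * (x * y) - 1 by linarith)]
    have hr1 : r ≤ 9 / 20 := by nlinarith
    set T₂ := max 0 (4 * (x * z) - 1) * u₂
    set T₃ := max 0 (4 * (y * z) - 1) * u₃
    set T₄ := max 0 (4 * (x * w) - 1) * u₄
    have hsum : (4 * (x * y) - 1) * u₁ + T₂ + T₃ + T₄ - (x + y) + r ≤ 0 := by linarith
    have := mul_nonpos_of_nonneg_of_nonpos (show 0 ≤ r ^ 2 / 4 * r by positivity) hsum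
    simp only [T₂, T₃, T₄] at this
    linarith

/-- Only four pairs among the four heaviest vertices can have weight exceeding `ρ / 4`. -/
theorem mul_le_of_not_heavy {n : ℕ} {z : Fin n → ℝ} (hz : ∀ i, 0 ≤ z i)
    {v₁ v₂ v₃ v₄ : Fin n} (h₁₂ : v₁ ≠ v₂) (h₁₃ : v₁ ≠ v₃) (h₁₄ : v₁ ≠ v₄) (h₂₃ : v₂ ≠ v₃)
    (h₂₄ : v₂ ≠ v₄) (h₃₄ : v₃ ≠ v₄) (z₁₂ : z v₂ ≤ z v₁) (z₂₃ : z v₃ ≤ z v₂)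
    (z₃₄ : z v₄ ≤ z v₃) (hrest : ∀ i, i ∉ ({v₁, v₂, v₃, v₄} : Finset (Fin n)) → z i ≤ z v₄)
    {i j : Fin n} (hij : i ≠ j) {e : Finset (Fin n)} (hi : i ∈ e) (hj : j ∈ e)
    (n₁₂ : ¬ (v₁ ∈ e ∧ v₂ ∈ e)) (n₁₃ : ¬ (v₁ ∈ e ∧ v₃ ∈ e)) (n₂₃ : ¬ (v₂ ∈ e ∧ v₃ ∈ e))
    (n₁₄ : ¬ (v₁ ∈ e ∧ v₄ ∈ e)) : z i * z j ≤ (∑ i, z i ^ 2) / 4 := by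
  have hmax : ∀ k, z k ≤ z v₁ := by
    intro k
    by_cases hk : k ∈ ({v₁, v₂, v₃, v₄} : Finset (Fin n))
    · simp only [Finset.mem_insert, Finset.mem_singleton] at hk
      rcases hk with rfl | rfl | rfl | rfl <;> linarith
    · linarith [hrest k hk]
  have hsum4 : ∑ k ∈ ({v₁, v₂, v₃, v₄} : Finset (Fin n)), z k ^ 2 =
      z v₁ ^ 2 + z v₂ ^ 2 + z v₃ ^ 2 + z v₄ ^ 2 := by
    rw [Finset.sum_insert (by simp [h₁₂, h₁₃, h₁₄]), Finset.sum_insert (by simp [h₂₃, h₂₄]),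
      Finset.sum_pair h₃₄]
    ring
  have hle4 : ∑ k ∈ ({v₁, v₂, v₃, v₄} : Finset (Fin n)), z k ^ 2 ≤ ∑ k, z k ^ 2 :=
    Finset.sum_le_univ_sum_of_nonneg fun i => sq_nonneg _
  have out : ∀ p k, k ∉ ({v₁, v₂, v₃, v₄} : Finset (Fin n)) →
      z p * z k ≤ (∑ i, z i ^ 2) / 4 := by
    intro p k hk
    have h5 : ∑ l ∈ insert k ({v₁, v₂, v₃, v₄} : Finset (Fin n)), z l ^ 2 ≤ ∑ l, z l ^ 2 :=
      Finset.sum_le_univ_sum_of_nonneg fun i => sq_nonneg _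
    rw [Finset.sum_insert hk, hsum4] at h5
    have hk0 := hz k
    have hk4 := hrest k hk
    have q4 : z k ^ 2 ≤ z v₄ ^ 2 := by gcongr
    have q3 : z k ^ 2 ≤ z v₃ ^ 2 := by gcongr; linarith
    have q2 : z k ^ 2 ≤ z v₂ ^ 2 := by gcongr; linarith
    have hp := mul_le_mul_of_nonneg_right (hmax p) hk0
    nlinarith [sq_nonneg (z v₁ - 2 * z k)]
  by_cases hiV : i ∈ ({v₁, v₂, v₃, v₄} : Finset (Fin n))
  swap
  · rw [mul_comm]; exact out j i hiV
  by_cases hjV : j ∈ ({v₁, v₂, v₃, v₄} : Finset (Fin n))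
  swap
  · exact out i j hjV
  have q12 : z v₂ ^ 2 ≤ z v₁ ^ 2 := pow_le_pow_left₀ (hz _) z₁₂ 2
  have q34 : z v₄ ^ 2 ≤ z v₃ ^ 2 := pow_le_pow_left₀ (hz _) z₃₄ 2
  have p24 : z v₂ * z v₄ ≤ (∑ i, z i ^ 2) / 4 := by
    nlinarith [sq_nonneg (z v₂ - z v₄)]
  have p34 : z v₃ * z v₄ ≤ (∑ i, z i ^ 2) / 4 :=
    (mul_le_mul_of_nonneg_right z₂₃ (hz _)).trans p24
  simp only [Finset.mem_insert, Finset.mem_singleton] at hiV hjV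
  rcases hiV with rfl | rfl | rfl | rfl <;> rcases hjV with rfl | rfl | rfl | rfl <;>
    first
    | exact absurd rfl hij
    | exact p24
    | exact p34
    | (rw [mul_comm]; exact p24)
    | (rw [mul_comm]; exact p34)
    | tauto

/-- A function picking the least weight of each edge. -/
theorem exists_edge_min {n : ℕ} {E : Finset (Finset (Fin n))} (hE : ∀ e ∈ E, e.card = 3)
    (z : Fin n → ℝ) : ∃ m : Finset (Fin n) → ℝ, (∀ e ∈ E, ∀ i ∈ e, m e ≤ z i) ∧
      ∀ e ∈ E, ∃ i j k, i ≠ j ∧ i ∈ e ∧ j ∈ e ∧ k ∈ e ∧ m e = z k ∧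
        ∏ l ∈ e, z l = z i * z j * m e := by
  have h : ∀ e : Finset (Fin n), ∃ μ : ℝ, e ∈ E → (∀ i ∈ e, μ ≤ z i) ∧
      ∃ i j k, i ≠ j ∧ i ∈ e ∧ j ∈ e ∧ k ∈ e ∧ μ = z k ∧ ∏ l ∈ e, z l = z i * z j * μ := by
    intro e
    by_cases he : e ∈ E
    · have hne : e.Nonempty := Finset.card_pos.1 (by rw [hE e he]; norm_num)
      obtain ⟨k, hk, hmin⟩ := Finset.exists_min_image e z hne
      refine ⟨z k, fun _ => ⟨hmin, ?_⟩⟩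
      have hcard : (e.erase k).card = 2 := by rw [Finset.card_erase_of_mem hk, hE e he]
      obtain ⟨i, j, hij, hek⟩ := Finset.card_eq_two.1 hcard
      have hi : i ∈ e.erase k := by simp [hek]
      have hj : j ∈ e.erase k := by simp [hek]
      refine ⟨i, j, k, hij, Finset.mem_of_mem_erase hi, Finset.mem_of_mem_erase hj, hk, rfl, ?_⟩
      rw [← Finset.prod_erase_mul e z hk, hek, Finset.prod_pair hij]
    · exact ⟨0, fun h => absurd h he⟩
  choose m hm using h
  exact ⟨m, fun e he => (hm e he).1, fun e he => (hm e he).2⟩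

/-- If some vertex avoids `S`, then there is a heaviest one among those. -/
theorem exists_heaviest_notMem {n : ℕ} (z : Fin n → ℝ) (S : Finset (Fin n)) (hS : S.card < n) :
    ∃ v, v ∉ S ∧ ∀ i, i ∉ S → z i ≤ z v := by
  have hne : (Sᶜ).Nonempty := by
    rw [← Finset.card_pos, Finset.card_compl, Fintype.card_fin]
    omega
  obtain ⟨v, hv, hmax⟩ := Finset.exists_max_image Sᶜ z hne
  exact ⟨v, Finset.mem_compl.1 hv, fun i hi => hmax i (Finset.mem_compl.2 hi)⟩

/-- If `Q` is a sparse 3-graph with maximum codegree at most 2, then every probability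
vector `z` on `V(Q)` satisfies `q_Q(z) ≤ τ(ρ(z))`, where `q_Q(z) = Σ_{ijk∈Q} z_i z_j z_k`
and `ρ(z) = Σ_i z_i²`. -/
theorem q_le_tau (n : ℕ) (E : Finset (Finset (Fin n)))
    (huniform : ∀ e ∈ E, e.card = 3)
    (hsparse : Sparse E)
    (hcodeg : ∀ u v : Fin n, u ≠ v → codeg E u v ≤ 2)
    (z : Fin n → ℝ) (hz0 : ∀ i, 0 ≤ z i) (hz1 : ∑ i, z i = 1) :
    (∑ e ∈ E, ∏ i ∈ e, z i) ≤ tau (∑ i, z i ^ 2) := by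
  have hcs : 1 ≤ n * ∑ i, z i ^ 2 := by
    have := sq_sum_le_card_mul_sum_sq (s := Finset.univ) (f := z)
    simpa [hz1] using this
  have hρnn : 0 ≤ ∑ i, z i ^ 2 := Finset.sum_nonneg fun i _ => sq_nonneg _
  have hρ0 : 0 < ∑ i, z i ^ 2 := by
    refine lt_of_le_of_ne hρnn fun h => ?_
    rw [← h] at hcs
    norm_num at hcs
  rcases lt_or_ge n 2 with hn | hn
  · have hEe : E = ∅ := by
      refine Finset.eq_empty_of_forall_notMem fun e he => ?_
      have h1 := huniform e he
      have h2 := card_finset_fin_le e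
      omega
    have hn1 : (n : ℝ) ≤ 1 := by exact_mod_cast Nat.lt_succ_iff.1 hn
    have := one_div_le_tau (ρ := ∑ i, z i ^ 2) (by nlinarith)
    rw [hEe, Finset.sum_empty]
    linarith
  obtain ⟨m, hmle, hm⟩ := exists_edge_min huniform z
  obtain ⟨v₁, -, hv₁⟩ := exists_heaviest_notMem z ∅ (by rw [Finset.card_empty]; omega)
  obtain ⟨v₂, hv₂m, hv₂⟩ := exists_heaviest_notMem z {v₁} (by rw [Finset.card_singleton]; omega)
  simp only [Finset.notMem_empty, not_false_eq_true, forall_const] at hv₁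
  simp only [Finset.mem_singleton] at hv₂m hv₂
  have h₁₂ : v₁ ≠ v₂ := Ne.symm hv₂m
  have habel : ∑ e ∈ E, m e ≤ 1 - z v₁ - z v₂ := by
    have := hsparse.sum_le_sum_sub_sub h₁₂ Finset.univ z m (Finset.mem_univ _)
      (Finset.mem_univ _) (fun i _ => hz0 i) hmle (fun w _ hw _ => ⟨hv₁ w, hv₂ w hw⟩)
    simpa [hz1] using this
  have hm0 : ∀ e ∈ E, 0 ≤ m e := by
    intro e he
    obtain ⟨-, -, k, -, -, -, -, hk, -⟩ := hm e he
    rw [hk]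
    exact hz0 k
  rcases le_or_gt (1 / 5) (∑ i, z i ^ 2) with hρ | hρ
  · refine le_trans ?_ (one_div_le_tau hρ)
    have hle : ∀ e ∈ E, ∏ i ∈ e, z i ≤ z v₁ * z v₂ * m e := by
      intro e he
      obtain ⟨i, j, -, hij, -, -, -, -, hp⟩ := hm e he
      rw [hp]
      refine mul_le_mul_of_nonneg_right ?_ (hm0 e he)
      by_cases hi : i = v₁
      · rw [hi]
        exact mul_le_mul_of_nonneg_left (hv₂ j fun h => hij (hi.trans h.symm)) (hz0 _)
      · rw [mul_comm (z v₁)]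
        exact mul_le_mul (hv₂ i hi) (hv₁ j) (hz0 _) (hz0 _)
    have h1 := Finset.sum_le_sum hle
    rw [← Finset.mul_sum] at h1
    have h2 := mul_le_mul_of_nonneg_left habel (mul_nonneg (hz0 v₁) (hz0 v₂))
    have amgm : ∀ x y : ℝ, 0 ≤ x → 0 ≤ y → x * y * (1 - x - y) ≤ 1 / 27 := by
      intro x y hx hy
      obtain ⟨s, hs⟩ : ∃ s, s = x + y := ⟨_, rfl⟩
      have hs0 : 0 ≤ s := by linarith
      have hxy0 := mul_nonneg hx hy
      have hxy : x * y ≤ s ^ 2 / 4 := by rw [hs]; nlinarith [sq_nonneg (x - y)]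
      rw [show 1 - x - y = 1 - s by rw [hs]; ring]
      rcases le_or_gt s 1 with h | h
      · have := mul_le_mul_of_nonneg_right hxy (sub_nonneg.2 h)
        nlinarith [mul_nonneg hs0 (sq_nonneg (s - 2 / 3)), sq_nonneg (s - 2 / 3)]
      · nlinarith
    exact h1.trans (h2.trans (amgm _ _ (hz0 _) (hz0 _)))
  · have hn5 : 4 < n := by
      by_contra! hn4
      have : (n : ℝ) ≤ 4 := by exact_mod_cast hn4
      nlinarith
    obtain ⟨v₃, hv₃m, hv₃⟩ := exists_heaviest_notMem z {v₁, v₂}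
      (lt_of_le_of_lt Finset.card_le_two (by omega))
    obtain ⟨v₄, hv₄m, hv₄⟩ := exists_heaviest_notMem z {v₁, v₂, v₃}
      (lt_of_le_of_lt Finset.card_le_three (by omega))
    have hρa : ∑ i, z i ^ 2 ≤ z v₁ := by
      calc ∑ i, z i ^ 2 ≤ ∑ i, z v₁ * z i := by
            refine Finset.sum_le_sum fun i _ => ?_
            rw [sq]
            exact mul_le_mul_of_nonneg_right (hv₁ i) (hz0 i)
        _ = z v₁ := by rw [← Finset.mul_sum, hz1, mul_one]
    have hm' : ∀ e ∈ E, ∃ k ∈ e, m e = z k := by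
      intro e he
      obtain ⟨-, -, k, -, -, -, hk, hmk, -⟩ := hm e he
      exact ⟨k, hk, hmk⟩
    have hv₄' : ∀ i, i ∉ ({v₁, v₂, v₃, v₄} : Finset (Fin n)) → z i ≤ z v₄ := by
      intro i hi
      refine hv₄ i fun h => hi ?_
      simp only [Finset.mem_insert, Finset.mem_singleton] at h ⊢
      tauto
    simp only [Finset.mem_insert, Finset.mem_singleton, not_or] at hv₃m hv₃ hv₄m hv₄
    have h₁₃ : v₁ ≠ v₃ := Ne.symm hv₃m.1
    have h₂₃ : v₂ ≠ v₃ := Ne.symm hv₃m.2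
    have h₁₄ : v₁ ≠ v₄ := Ne.symm hv₄m.1
    have h₂₄ : v₂ ≠ v₄ := Ne.symm hv₄m.2.1
    have h₃₄ : v₃ ≠ v₄ := Ne.symm hv₄m.2.2
    have z₁₂ := hv₁ v₂
    have z₂₃ := hv₂ v₃ h₁₃.symm
    have z₃₄ := hv₃ v₄ ⟨h₁₄.symm, h₂₄.symm⟩
    set ρ := ∑ i, z i ^ 2 with hρdef
    have hc0 : 0 ≤ ρ / 4 := by positivity
    obtain ⟨t₁, h₁, k₁, l₁⟩ := exists_sum_excess_le huniform h₁₂ (hcodeg _ _ h₁₂) hz0 hm' hc0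
      (F := {v₁, v₂}) (by simp) (by simp)
      (fun k hk => by
        simp only [Finset.mem_insert, Finset.mem_singleton, not_or] at hk
        exact ⟨hv₁ k, hv₂ k hk.1⟩)
    obtain ⟨t₂, h₂, k₂, l₂⟩ := exists_sum_excess_le huniform h₁₃ (hcodeg _ _ h₁₃) hz0 hm' hc0
      (F := {v₁, v₂, v₃}) (by simp) (by simp)
      (fun k hk => by
        simp only [Finset.mem_insert, Finset.mem_singleton, not_or] at hk
        exact ⟨hv₁ k, hv₃ k ⟨hk.1, hk.2.1⟩⟩)
    obtain ⟨t₃, h₃, k₃, l₃⟩ := exists_sum_excess_le huniform h₂₃ (hcodeg _ _ h₂₃) hz0 hm' hc0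
      (F := {v₁, v₂, v₃}) (by simp) (by simp)
      (fun k hk => by
        simp only [Finset.mem_insert, Finset.mem_singleton, not_or] at hk
        exact ⟨hv₂ k hk.1, hv₃ k ⟨hk.1, hk.2.1⟩⟩)
    obtain ⟨t₄, h₄, k₄, l₄⟩ := exists_sum_excess_le huniform h₁₄ (hcodeg _ _ h₁₄) hz0 hm' hc0
      (F := {v₁, v₂, v₃, v₄}) (by simp) (by simp)
      (fun k hk => ⟨hv₁ k, hv₄' k hk⟩)
    rw [← hρdef, Finset.sum_pair h₁₂] at k₁
    rw [← hρdef, Finset.sum_insert (by simp [h₁₂, h₁₃]), Finset.sum_pair h₂₃] at k₂ k₃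
    rw [← hρdef, Finset.sum_insert (by simp [h₁₂, h₁₃, h₁₄]),
      Finset.sum_insert (by simp [h₂₃, h₂₄]), Finset.sum_pair h₃₄] at k₄
    have key := sum_excess_le hρ0 hρ.le hρa z₁₂ z₂₃ z₃₄ (hz0 _) h₁ h₂ h₃ h₄ k₁
      (by linarith) (by linarith) (by linarith)
    refine le_trans ?_ (mul_one_sub_div_four_le_tau hρ0.le (by linarith))
    refine le_trans ?_ key
    simp only [Finset.sum_filter] at l₁ l₂ l₃ l₄
    have hpoint : ∀ e ∈ E, ∏ i ∈ e, z i ≤ ρ / 4 * m e +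
        ((if v₁ ∈ e ∧ v₂ ∈ e ∧ ∀ x ∈ ({v₁, v₂} : Finset (Fin n)), x ∈ e → x = v₁ ∨ x = v₂
          then max 0 (∏ i ∈ e, z i - ρ / 4 * m e) else 0) +
        (if v₁ ∈ e ∧ v₃ ∈ e ∧ ∀ x ∈ ({v₁, v₂, v₃} : Finset (Fin n)), x ∈ e → x = v₁ ∨ x = v₃
          then max 0 (∏ i ∈ e, z i - ρ / 4 * m e) else 0) +
        (if v₂ ∈ e ∧ v₃ ∈ e ∧ ∀ x ∈ ({v₁, v₂, v₃} : Finset (Fin n)), x ∈ e → x = v₂ ∨ x = v₃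
          then max 0 (∏ i ∈ e, z i - ρ / 4 * m e) else 0) +
        (if v₁ ∈ e ∧ v₄ ∈ e ∧ ∀ x ∈ ({v₁, v₂, v₃, v₄} : Finset (Fin n)), x ∈ e →
            x = v₁ ∨ x = v₄
          then max 0 (∏ i ∈ e, z i - ρ / 4 * m e) else 0)) := by
      intro e he
      have hX0 := le_max_left 0 (∏ i ∈ e, z i - ρ / 4 * m e)
      have hX1 := le_max_right 0 (∏ i ∈ e, z i - ρ / 4 * m e)
      set X := max 0 (∏ i ∈ e, z i - ρ / 4 * m e)
      have hite : ∀ (P : Prop) [Decidable P], 0 ≤ if P then X else 0 := by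
        intro P _
        split_ifs
        exacts [hX0, le_rfl]
      simp only [Finset.forall_mem_insert, Finset.mem_singleton, forall_eq]
      by_cases n₁₂ : v₁ ∈ e ∧ v₂ ∈ e
      · refine le_trans ?_ (add_le_add_right (le_add_of_le_of_nonneg (le_add_of_le_of_nonneg
          (le_add_of_le_of_nonneg (b := X) ?_ (hite _)) (hite _)) (hite _)) _)
        · linarith
        · rw [if_pos (by tauto)]
      by_cases n₁₃ : v₁ ∈ e ∧ v₃ ∈ e
      · refine le_trans ?_ (add_le_add_right (le_add_of_le_of_nonneg (le_add_of_le_of_nonneg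
          (le_add_of_nonneg_of_le (b := X) (hite _) ?_) (hite _)) (hite _)) _)
        · linarith
        · rw [if_pos (by tauto)]
      by_cases n₂₃ : v₂ ∈ e ∧ v₃ ∈ e
      · refine le_trans ?_ (add_le_add_right (le_add_of_le_of_nonneg
          (le_add_of_nonneg_of_le (b := X) (add_nonneg (hite _) (hite _)) ?_) (hite _)) _)
        · linarith
        · rw [if_pos (by tauto)]
      by_cases n₁₄ : v₁ ∈ e ∧ v₄ ∈ e
      · refine le_trans ?_ (add_le_add_right
          (le_add_of_nonneg_of_le (b := X)
            (add_nonneg (add_nonneg (hite _) (hite _)) (hite _)) ?_) _)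
        · linarith
        · rw [if_pos (by tauto)]
      · refine le_trans ?_ (le_add_of_nonneg_right
          (add_nonneg (add_nonneg (add_nonneg (hite _) (hite _)) (hite _)) (hite _)))
        obtain ⟨i, j, -, hij, hi, hj, -, -, hp⟩ := hm e he
        rw [hp]
        exact mul_le_mul_of_nonneg_right (mul_le_of_not_heavy hz0 h₁₂ h₁₃ h₁₄ h₂₃ h₂₄ h₃₄
          z₁₂ z₂₃ z₃₄ hv₄' hij hi hj n₁₂ n₁₃ n₂₃ n₁₄) (hm0 e he)
    refine (Finset.sum_le_sum hpoint).trans ?_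
    simp only [Finset.sum_add_distrib, ← Finset.mul_sum]
    have := mul_le_mul_of_nonneg_left habel hc0
    gcongr
end

section
/- Let Q be a sparse 3-graph. Then for every probability vector z on V(Q), q_Q(z) ≤ 1/27. -/
/-- The vector obtained from `z` by moving the weight of `j` to `i`. -/
def moveWeight {n : ℕ} (z : Fin n → ℝ) (i j : Fin n) : Fin n → ℝ :=
  fun k => if k = j then 0 else if k = i then z i + z j else z k

lemma moveWeight_nonneg {n : ℕ} {z : Fin n → ℝ} (hz0 : ∀ i, 0 ≤ z i) (i j k : Fin n) :
    0 ≤ moveWeight z i j k := by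
  unfold moveWeight
  split_ifs
  exacts [le_rfl, add_nonneg (hz0 i) (hz0 j), hz0 k]

lemma sum_moveWeight {n : ℕ} (z : Fin n → ℝ) {i j : Fin n} (hij : i ≠ j) :
    ∑ k, moveWeight z i j k = ∑ k, z k := by
  have h : ∀ k, moveWeight z i j k =
      z k + ((if k = i then z j else 0) - (if k = j then z j else 0)) := by
    intro k
    unfold moveWeight
    split_ifs <;> simp_all
  simp [h, Finset.sum_add_distrib]

lemma support_moveWeight_ssubset {n : ℕ} {z : Fin n → ℝ} {i j : Fin n}
    (hi : z i ≠ 0) (hj : z j ≠ 0) :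
    Finset.univ.filter (moveWeight z i j · ≠ 0) ⊂ Finset.univ.filter (z · ≠ 0) := by
  refine Finset.ssubset_iff_subset_ne.2 ⟨fun k hk => ?_, fun h => ?_⟩
  · rw [Finset.mem_filter] at hk ⊢
    refine ⟨Finset.mem_univ k, fun hk0 => hk.2 ?_⟩
    have hki : k ≠ i := by rintro rfl; exact hi hk0
    simp [moveWeight, hki, hk0]
  · have : j ∈ Finset.univ.filter (moveWeight z i j · ≠ 0) := by rw [h]; simpa using hj
    simp [moveWeight] at this

lemma prod_moveWeight_of_notMem {n : ℕ} (z : Fin n → ℝ) {i j : Fin n} {e : Finset (Fin n)}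
    (hi : i ∉ e) (hj : j ∉ e) : ∏ k ∈ e, moveWeight z i j k = ∏ k ∈ e, z k := by
  refine Finset.prod_congr rfl fun k hk => ?_
  have h1 : k ≠ i := by rintro rfl; exact hi hk
  have h2 : k ≠ j := by rintro rfl; exact hj hk
  simp [moveWeight, h1, h2]

lemma prod_moveWeight_of_mem_right {n : ℕ} (z : Fin n → ℝ) (i : Fin n) {j : Fin n}
    {e : Finset (Fin n)} (hj : j ∈ e) : ∏ k ∈ e, moveWeight z i j k = 0 :=
  Finset.prod_eq_zero hj (by simp [moveWeight])

lemma mul_prod_moveWeight_of_mem_left {n : ℕ} (z : Fin n → ℝ) {i j : Fin n}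
    {e : Finset (Fin n)} (hi : i ∈ e) (hj : j ∉ e) :
    z i * ∏ k ∈ e, moveWeight z i j k = (z i + z j) * ∏ k ∈ e, z k := by
  have hij : i ≠ j := by rintro rfl; exact hj hi
  rw [← Finset.mul_prod_erase e _ hi, ← Finset.mul_prod_erase e z hi,
    prod_moveWeight_of_notMem z (Finset.notMem_erase i e)
      fun h => hj (Finset.mem_of_mem_erase h)]
  simp only [moveWeight, hij, if_false, if_true]
  ring

/-- If no edge inside the support of `z` contains both `i` and `j`, then `q` at `z` is the
weighted mean of its values at the two vectors that merge the weights of `i` and `j`. -/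
lemma add_mul_sum_prod_eq {n : ℕ} {E : Finset (Finset (Fin n))} {z : Fin n → ℝ} {i j : Fin n}
    (hij : ∀ e ∈ E, (∀ k ∈ e, z k ≠ 0) → i ∈ e → j ∉ e) :
    (z i + z j) * ∑ e ∈ E, ∏ k ∈ e, z k =
      z i * ∑ e ∈ E, ∏ k ∈ e, moveWeight z i j k +
        z j * ∑ e ∈ E, ∏ k ∈ e, moveWeight z j i k := by
  simp only [Finset.mul_sum, ← Finset.sum_add_distrib]
  refine Finset.sum_congr rfl fun e he => ?_
  by_cases hi : i ∈ e <;> by_cases hj : j ∈ e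
  · rw [prod_moveWeight_of_mem_right z i hj, prod_moveWeight_of_mem_right z j hi]
    obtain ⟨k, hk, hk0⟩ : ∃ k ∈ e, z k = 0 := by
      by_contra! h
      exact hij e he h hi hj
    simp [Finset.prod_eq_zero hk hk0]
  · rw [mul_prod_moveWeight_of_mem_left z hi hj, prod_moveWeight_of_mem_right z j hi]
    ring
  · rw [mul_prod_moveWeight_of_mem_left z hj hi, prod_moveWeight_of_mem_right z i hj]
    ring
  · rw [prod_moveWeight_of_notMem z hi hj, prod_moveWeight_of_notMem z hj hi]
    ring

/-- In a sparse 3-graph, every set of at least four vertices contains two vertices that lie in no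
common edge inside the set. -/
lemma Sparse.exists_uncovered_pair {n : ℕ} {E : Finset (Finset (Fin n))}
    (huniform : ∀ e ∈ E, e.card = 3) (hsparse : Sparse E) {S : Finset (Fin n)}
    (hS : 4 ≤ S.card) :
    ∃ i ∈ S, ∃ j ∈ S, i ≠ j ∧ ∀ e ∈ E, e ⊆ S → i ∈ e → j ∉ e := by
  by_contra! h
  set F := E.filter (· ⊆ S) with hF
  have hcov : S.powersetCard 2 ⊆ F.biUnion (Finset.powersetCard 2) := by
    intro p hp
    obtain ⟨hpS, hp2⟩ := Finset.mem_powersetCard.1 hp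
    obtain ⟨a, b, hab, rfl⟩ := Finset.card_eq_two.1 hp2
    obtain ⟨e, he, heS, hae, hbe⟩ := h a (hpS (by simp)) b (hpS (by simp)) hab
    simp only [Finset.mem_biUnion, Finset.mem_powersetCard, hF, Finset.mem_filter]
    exact ⟨e, ⟨he, heS⟩, by simp [Finset.insert_subset_iff, hae, hbe], hp2⟩
  have hle : S.card.choose 2 ≤ F.card * 3 := by
    rw [← Finset.card_powersetCard]
    refine (Finset.card_le_card hcov).trans (Finset.card_biUnion_le_card_mul _ _ _ fun e he => ?_)
    rw [Finset.card_powersetCard, huniform e (Finset.mem_filter.1 he).1]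
    decide
  have hFS : F.card ≤ S.card - 2 := hsparse S (by lia)
  have hS4 : S.card = 4 := by
    obtain ⟨m, hm⟩ := Nat.exists_eq_add_of_le hS
    rw [Nat.choose_two_right, hm] at hle
    have heven : (4 + m) * (4 + m - 1) / 2 * 2 = (4 + m) * (4 + m - 1) :=
      Nat.div_mul_cancel (Nat.even_mul_pred_self _).two_dvd
    rw [show 4 + m - 1 = 3 + m by lia] at hle heven
    have : m = 0 := by
      have : F.card ≤ m + 2 := by lia
      nlinarith
    lia
  rw [hS4] at hle hFS
  have hF2 : F.card = 2 := by
    have : Nat.choose 4 2 = 6 := rfl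
    lia
  obtain ⟨e, f, -, hef⟩ := Finset.card_eq_two.1 hF2
  have hmiss : ∀ g ∈ F, ∃ a ∈ S, a ∉ g := fun g hg =>
    Finset.exists_mem_notMem_of_card_lt_card (by
      rw [huniform g (Finset.mem_filter.1 hg).1]; lia)
  have hpair : ∀ a ∈ S, ∀ b ∈ S, a ≠ b → a ∉ e → b ∉ f → False := by
    intro a ha b hb hab hae hbf
    obtain ⟨g, hg, hgS, hag, hbg⟩ := h a ha b hb hab
    have hgF : g ∈ F := Finset.mem_filter.2 ⟨hg, hgS⟩
    rw [hef, Finset.mem_insert, Finset.mem_singleton] at hgF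
    rcases hgF with rfl | rfl
    exacts [hae hag, hbf hbg]
  obtain ⟨a, ha, hae⟩ := hmiss e (by simp [hef])
  obtain ⟨b, hb, hbf⟩ := hmiss f (by simp [hef])
  rcases ne_or_eq a b with hab | rfl
  · exact hpair a ha b hb hab hae hbf
  · obtain ⟨c, hc, hca⟩ := Finset.exists_mem_ne (by lia : 1 < S.card) a
    obtain ⟨g, hg, hgS, hag, -⟩ := h a ha c hc hca.symm
    have hgF : g ∈ F := Finset.mem_filter.2 ⟨hg, hgS⟩
    rw [hef, Finset.mem_insert, Finset.mem_singleton] at hgF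
    rcases hgF with rfl | rfl
    exacts [hae hag, hbf hag]

lemma mul_mul_le_of_add_add_le_one {a b c : ℝ} (ha : 0 ≤ a) (hb : 0 ≤ b) (hc : 0 ≤ c)
    (h : a + b + c ≤ 1) : a * b * c ≤ 1 / 27 := by
  have hcube : (a + b + c) ^ 3 ≤ 1 := pow_le_one₀ (by positivity) h
  nlinarith [mul_nonneg ha (sq_nonneg (b - c)), mul_nonneg hb (sq_nonneg (a - c)),
    mul_nonneg hc (sq_nonneg (a - b)), mul_nonneg ha (sq_nonneg (a - b)),
    mul_nonneg ha (sq_nonneg (a - c)), mul_nonneg hb (sq_nonneg (a - b)),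
    mul_nonneg hb (sq_nonneg (b - c)), mul_nonneg hc (sq_nonneg (a - c)),
    mul_nonneg hc (sq_nonneg (b - c))]

lemma prod_le_of_card_eq_three {n : ℕ} {z : Fin n → ℝ} (hz0 : ∀ i, 0 ≤ z i)
    (hz1 : ∑ i, z i = 1) {e : Finset (Fin n)} (he : e.card = 3) :
    ∏ i ∈ e, z i ≤ 1 / 27 := by
  obtain ⟨a, b, c, hab, hac, hbc, rfl⟩ := Finset.card_eq_three.1 he
  have hsum : ∑ i ∈ {a, b, c}, z i ≤ 1 :=
    hz1 ▸ Finset.sum_le_univ_sum_of_nonneg hz0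
  simp only [Finset.sum_insert, Finset.prod_insert, Finset.mem_insert, Finset.mem_singleton,
    Finset.sum_singleton, Finset.prod_singleton, hab, hac, hbc, or_self, not_false_eq_true]
    at hsum ⊢
  rw [← mul_assoc]
  exact mul_mul_le_of_add_add_le_one (hz0 a) (hz0 b) (hz0 c) (by linarith)

/-- If the support of `z` has at most three elements, then `q` at `z` is at most `1 / 27`. -/
lemma sum_prod_le_of_card_support_le {n : ℕ} {E : Finset (Finset (Fin n))}
    (huniform : ∀ e ∈ E, e.card = 3) {z : Fin n → ℝ} (hz0 : ∀ i, 0 ≤ z i)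
    (hz1 : ∑ i, z i = 1) (hS : (Finset.univ.filter (z · ≠ 0)).card ≤ 3) :
    ∑ e ∈ E, ∏ i ∈ e, z i ≤ 1 / 27 := by
  set S := Finset.univ.filter (z · ≠ 0) with hSdef
  have hzero : ∀ e ∈ E, e ≠ S → ∏ i ∈ e, z i = 0 := by
    intro e he heS
    by_contra hne
    refine heS (Finset.eq_of_subset_of_card_le (fun k hk => ?_) (by rw [huniform e he]; exact hS))
    simpa [hSdef] using Finset.prod_ne_zero_iff.1 hne k hk
  by_cases hSE : S ∈ E
  · rw [Finset.sum_eq_single_of_mem S hSE hzero]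
    exact prod_le_of_card_eq_three hz0 hz1 (huniform S hSE)
  · rw [Finset.sum_eq_zero fun e he => hzero e he (by rintro rfl; exact hSE he)]
    norm_num

/-- If `Q` is a sparse 3-graph, then every probability vector `z` on `V(Q)` satisfies
`q_Q(z) ≤ 1/27`, where `q_Q(z) = Σ_{ijk∈Q} z_i z_j z_k`. -/
theorem q_le_one_over_27 (n : ℕ) (E : Finset (Finset (Fin n)))
    (huniform : ∀ e ∈ E, e.card = 3)
    (hsparse : Sparse E)
    (z : Fin n → ℝ) (hz0 : ∀ i, 0 ≤ z i) (hz1 : ∑ i, z i = 1) :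
    (∑ e ∈ E, ∏ i ∈ e, z i) ≤ 1 / 27 := by
  induction hs : (Finset.univ.filter (z · ≠ 0)).card using Nat.strong_induction_on
    generalizing z with
  | _ s ih =>
    subst hs
    rcases le_or_gt (Finset.univ.filter (z · ≠ 0)).card 3 with hS | hS
    · exact sum_prod_le_of_card_support_le huniform hz0 hz1 hS
    obtain ⟨i, hi, j, hj, hij, hno⟩ := hsparse.exists_uncovered_pair huniform hS
    simp only [Finset.mem_filter, Finset.mem_univ, true_and] at hi hj
    have hu := ih _ (Finset.card_lt_card (support_moveWeight_ssubset hi hj)) _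
      (moveWeight_nonneg hz0 i j) (by rw [sum_moveWeight z hij, hz1]) rfl
    have hv := ih _ (Finset.card_lt_card (support_moveWeight_ssubset hj hi)) _
      (moveWeight_nonneg hz0 j i) (by rw [sum_moveWeight z hij.symm, hz1]) rfl
    have hmean := add_mul_sum_prod_eq (E := E) (z := z) (i := i) (j := j)
      fun e he hk => hno e he fun k hke => by simpa using hk k hke
    have hpos : 0 < z i + z j := add_pos_of_pos_of_nonneg ((hz0 i).lt_of_ne' hi) (hz0 j)
    refine le_of_mul_le_mul_left ?_ hpos
    rw [hmean, add_mul]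
    exact add_le_add (mul_le_mul_of_nonneg_left hu (hz0 i)) (mul_le_mul_of_nonneg_left hv (hz0 j))
end

section
/- Let s be a real number with (1+√3)/3 < s < 1, and set A = (1−s)(2−s)/2, B = (3s−2)/4, ρ = 1−s². Then for every integer N ≥ 2, N·A + 2B > ρ·√(3N − 6). -/
/-- For `(1+√3)/3 < s < 1`, with `A = (1-s)(2-s)/2`, `B = (3s-2)/4`, `ρ = 1-s²`,
every integer `N ≥ 2` satisfies `N·A + 2B > ρ·√(3N-6)`. -/
theorem no_low_rho_counterexample (s : ℝ) (hs1 : (1 + Real.sqrt 3) / 3 < s) (hs2 : s < 1)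
    (N : ℤ) (hN : 2 ≤ N) :
    (1 - s ^ 2) * Real.sqrt (3 * (N : ℝ) - 6)
      < (N : ℝ) * ((1 - s) * (2 - s) / 2) + 2 * ((3 * s - 2) / 4) := by
  have h3 : (1.73 : ℝ) < √3 := Real.lt_sqrt_of_sq_lt (by norm_num)
  have hs : 0.91 < s := by linarith
  have hN' : (2 : ℝ) ≤ N := by exact_mod_cast hN
  set x := √(3 * (N : ℝ) - 6)
  have hx : x ^ 2 = 3 * (N : ℝ) - 6 := Real.sq_sqrt (by linarith)
  obtain ⟨t, rfl⟩ : ∃ t, s = 1 - t := ⟨1 - s, by ring⟩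
  have ht : 0 < t := by linarith
  have ht' : t < 0.09 := by linarith
  have hn : (N : ℝ) = (x ^ 2 + 6) / 3 := by linarith
  rw [hn]
  -- The discriminant of the difference, as a quadratic in `x`, is negative.
  have hdisc : 0 < 1 - 12 * t + 13 * t ^ 2 - t ^ 3 := by
    nlinarith [sq_nonneg (t - 0.09), mul_pos (pow_pos ht 2) (sub_pos.2 ht')]
  have hsq : 0 ≤ t * ((1 + t) * x - 3 * (2 - t)) ^ 2 := by positivity
  refine sub_pos.1 (pos_of_mul_pos_right (a := 1 + t) ?_ (by linarith))
  linear_combination hsq / 6 + hdisc / 2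
end

section
/- Let Q be a sparse 3-graph on N ≥ 2 vertices with maximum codegree Δ₂(Q) ≤ 2, and let z be a probability vector on V(Q). Then Σ_{i∈V(Q)} d_i(z) ≤ ρ(z)·√(3N − 6), where d_i(z) = Σ_{{j,k}: {i,j,k}∈Q} z_j z_k and ρ(z) = Σ_{i∈V(Q)} z_i². -/
/-- The ordered triples whose underlying set is `{a, b, c}` are the six orderings. -/
theorem filter_triple_eq {α : Type*} [Fintype α] [DecidableEq α] {a b c : α}
    (hab : a ≠ b) (hac : a ≠ c) (hbc : b ≠ c) :
    (Finset.univ.filter fun t : α × α × α =>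
        ({t.1, t.2.1, t.2.2} : Finset α) = {a, b, c}) =
      {(a, b, c), (a, c, b), (b, a, c), (b, c, a), (c, a, b), (c, b, a)} := by
  ext ⟨x, y, w⟩
  simp only [Finset.mem_filter, Finset.mem_univ, true_and, Finset.mem_insert,
    Finset.mem_singleton, Prod.mk.injEq]
  constructor
  · intro h
    have h' : ∀ v, (v = x ∨ v = y ∨ v = w) ↔ (v = a ∨ v = b ∨ v = c) := fun v => by
      simpa using Finset.ext_iff.mp h v
    have hx := h' x
    have hy := h' y
    have hw := h' w
    have ha := h' a
    have hb := h' b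
    have hc := h' c
    clear h h'
    grind
  · rintro (⟨rfl, rfl, rfl⟩ | ⟨rfl, rfl, rfl⟩ | ⟨rfl, rfl, rfl⟩ | ⟨rfl, rfl, rfl⟩ |
      ⟨rfl, rfl, rfl⟩ | ⟨rfl, rfl, rfl⟩) <;>
      (ext v; simp only [Finset.mem_insert, Finset.mem_singleton]; try tauto)

/-- Summing over the ordered triples with underlying set `{a, b, c}`. -/
theorem sum_filter_triple {α : Type*} [Fintype α] [DecidableEq α] {a b c : α}
    (hab : a ≠ b) (hac : a ≠ c) (hbc : b ≠ c) (f : α × α × α → ℝ) :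
    ∑ t with ({t.1, t.2.1, t.2.2} : Finset α) = {a, b, c}, f t =
      f (a, b, c) + f (a, c, b) + f (b, a, c) + f (b, c, a) + f (c, a, b) + f (c, b, a) := by
  rw [filter_triple_eq hab hac hbc]
  repeat rw [Finset.sum_insert (by simp [hab, hac, hbc, hab.symm, hac.symm, hbc.symm])]
  rw [Finset.sum_singleton]
  ring

/-- Weighting ordered pairs by codegree amounts to summing over ordered triples of edges. -/
theorem sum_codeg_mul {n : ℕ} (E : Finset (Finset (Fin n))) (g : Fin n → Fin n → ℝ) :
    ∑ p : Fin n × Fin n, (codeg E p.1 p.2 : ℝ) * g p.1 p.2 =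
      ∑ e ∈ E, ∑ t : Fin n × Fin n × Fin n with
        ({t.1, t.2.1, t.2.2} : Finset (Fin n)) = e, g t.1 t.2.1 := by
  simp_rw [Finset.sum_filter]
  rw [Finset.sum_comm]
  simp_rw [Finset.sum_ite_eq, Fintype.sum_prod_type]
  refine Finset.sum_congr rfl fun u _ => Finset.sum_congr rfl fun v _ => ?_
  rw [← Finset.sum_filter, Finset.sum_const, nsmul_eq_mul, codeg]

/-- Every edge of a 3-graph has six orderings. -/
theorem sum_codeg {n : ℕ} {E : Finset (Finset (Fin n))} (huniform : ∀ e ∈ E, e.card = 3) :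
    ∑ p : Fin n × Fin n, (codeg E p.1 p.2 : ℝ) = 6 * E.card := by
  have h := sum_codeg_mul E fun _ _ => 1
  simp only [mul_one] at h
  rw [h, Finset.sum_congr rfl (g := fun _ => (6 : ℝ)), Finset.sum_const, nsmul_eq_mul, mul_comm]
  intro e he
  obtain ⟨a, b, c, hab, hac, hbc, rfl⟩ := Finset.card_eq_three.mp (huniform e he)
  rw [sum_filter_triple hab hac hbc fun _ => 1]
  norm_num

/-- The sum of the link values is half the quadratic form of the codegree matrix. -/
theorem sum_codeg_mul_mul {n : ℕ} {E : Finset (Finset (Fin n))}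
    (huniform : ∀ e ∈ E, e.card = 3) (z : Fin n → ℝ) :
    ∑ p : Fin n × Fin n, (codeg E p.1 p.2 : ℝ) * (z p.1 * z p.2) =
      2 * ∑ i, ∑ e ∈ E.filter (fun e => i ∈ e), ∏ j ∈ e.erase i, z j := by
  rw [sum_codeg_mul E fun u v => z u * z v]
  simp_rw [Finset.sum_filter _ (fun i : Finset (Fin n) => ∏ j ∈ _, z j)]
  rw [Finset.sum_comm (s := Finset.univ) (t := E), Finset.mul_sum]
  refine Finset.sum_congr rfl fun e he => ?_
  obtain ⟨a, b, c, hab, hac, hbc, rfl⟩ := Finset.card_eq_three.mp (huniform e he)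
  rw [sum_filter_triple hab hac hbc fun t => z t.1 * z t.2.1, ← Finset.sum_filter,
    Finset.filter_univ_mem]
  have ha : ({a, b, c} : Finset (Fin n)).erase a = {b, c} := by ext v; simp; grind
  have hb : ({a, b, c} : Finset (Fin n)).erase b = {a, c} := by ext v; simp; grind
  have hc : ({a, b, c} : Finset (Fin n)).erase c = {a, b} := by ext v; simp; grind
  rw [Finset.sum_insert (by simp [hab, hac]), Finset.sum_pair hbc, ha, hb, hc,
    Finset.prod_pair hbc, Finset.prod_pair hac, Finset.prod_pair hab]
  ring

/-- In a 3-graph the diagonal codegrees vanish. -/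
theorem codeg_self {n : ℕ} {E : Finset (Finset (Fin n))} (huniform : ∀ e ∈ E, e.card = 3)
    (u : Fin n) : codeg E u u = 0 := by
  rw [codeg, Finset.card_eq_zero, Finset.filter_eq_empty_iff]
  intro w _ hw
  have h3 := huniform _ hw
  have h2 : ({u, u, w} : Finset (Fin n)).card ≤ 2 := by
    rw [Finset.insert_eq_of_mem (Finset.mem_insert_self u _)]
    exact Finset.card_le_two
  omega

/-- For a sparse 3-graph on `N ≥ 2` vertices with maximum codegree at most 2 and a
probability vector `z`, the weighted link values `d_i(z) = Σ_{{j,k} : {i,j,k} ∈ Q} z_j z_k`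
satisfy `Σ_i d_i(z) ≤ ρ(z)·√(3N - 6)`, where `ρ(z) = Σ_i z_i²`. -/
theorem sum_links_le (n : ℕ) (hn : 2 ≤ n) (E : Finset (Finset (Fin n)))
    (huniform : ∀ e ∈ E, e.card = 3)
    (hsparse : Sparse E)
    (hcodeg : ∀ u v : Fin n, u ≠ v → codeg E u v ≤ 2)
    (z : Fin n → ℝ) (hz0 : ∀ i, 0 ≤ z i) (hz1 : ∑ i, z i = 1) :
    ∑ i, (∑ e ∈ E.filter (fun e => i ∈ e), ∏ j ∈ e.erase i, z j)
      ≤ (∑ i, z i ^ 2) * Real.sqrt (3 * (n : ℝ) - 6) := by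
  have hcard : (E.card : ℝ) ≤ n - 2 := by
    have h := hsparse Finset.univ (by simpa using hn)
    simp only [Finset.subset_univ, Finset.filter_true, Finset.card_univ, Fintype.card_fin] at h
    have h' : E.card + 2 ≤ n := by omega
    have : (E.card : ℝ) + 2 ≤ n := by exact_mod_cast h'
    linarith
  have hsq : ∑ p : Fin n × Fin n, (codeg E p.1 p.2 : ℝ) ^ 2 ≤ 12 * E.card := by
    have : 12 * (E.card : ℝ) = ∑ p : Fin n × Fin n, 2 * (codeg E p.1 p.2 : ℝ) := by
      rw [← Finset.mul_sum, sum_codeg huniform]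
      ring
    rw [this]
    refine Finset.sum_le_sum fun p _ => ?_
    have h2 : codeg E p.1 p.2 ≤ 2 := by
      rcases eq_or_ne p.1 p.2 with h | h
      · rw [h, codeg_self huniform]
        exact Nat.zero_le 2
      · exact hcodeg _ _ h
    have h2' : (codeg E p.1 p.2 : ℝ) ≤ 2 := by exact_mod_cast h2
    rw [sq]
    exact mul_le_mul_of_nonneg_right h2' (Nat.cast_nonneg _)
  have hrho : ∑ p : Fin n × Fin n, (z p.1 * z p.2) ^ 2 = (∑ i, z i ^ 2) ^ 2 := by
    simp_rw [Fintype.sum_prod_type, mul_pow, sq (∑ i, z i ^ 2), Finset.sum_mul_sum]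
  have hcs := Finset.sum_mul_sq_le_sq_mul_sq Finset.univ
    (fun p : Fin n × Fin n => (codeg E p.1 p.2 : ℝ)) (fun p => z p.1 * z p.2)
  rw [sum_codeg_mul_mul huniform z, hrho] at hcs
  have hn' : (0 : ℝ) ≤ 3 * n - 6 := by
    have : (2 : ℝ) ≤ n := by exact_mod_cast hn
    linarith
  refine le_of_sq_le_sq ?_ (by positivity)
  rw [mul_pow, Real.sq_sqrt hn']
  have := mul_le_mul_of_nonneg_right
    (hsq.trans (show 12 * (E.card : ℝ) ≤ 4 * (3 * n - 6) by linarith))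
    (sq_nonneg (∑ i, z i ^ 2))
  linarith
end

section
/- Let t ≥ 1 be an integer and let S be a 3-graph on t vertices. Then λ(cone(S)) ≥ (4/9)(1 − 1/t) + 16|S|/(9t³). In particular, if the number of edges of S is greater than t²/4, then λ(cone(S)) > 4/9. -/
theorem last_notMem_image_castSucc {n : ℕ} (e : Finset (Fin n)) :
    Fin.last n ∉ e.image Fin.castSucc := by
  simp [Fin.castSucc_ne_last]

theorem filter_last_mem_eq_image {n : ℕ} :
    (Finset.univ : Finset (Finset (Fin (n + 1)))).filter
      (fun e => e.card = 3 ∧ Fin.last n ∈ e) =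
    (Finset.powersetCard 2 (Finset.univ : Finset (Fin n))).image
      (fun p => insert (Fin.last n) (p.image Fin.castSucc)) := by
  ext e
  simp only [Finset.mem_filter, Finset.mem_univ, true_and, Finset.mem_image,
    Finset.mem_powersetCard, Finset.subset_univ]
  constructor
  · rintro ⟨hcard, hlast⟩
    have himage : (Finset.univ.filter fun i : Fin n => i.castSucc ∈ e).image Fin.castSucc
        = e.erase (Fin.last n) := by
      ext i
      cases i using Fin.lastCases <;> simp [Fin.castSucc_ne_last]
    refine ⟨Finset.univ.filter fun i : Fin n => i.castSucc ∈ e, ?_, ?_⟩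
    · rw [← Finset.card_image_of_injective _ (Fin.castSucc_injective n), himage,
        Finset.card_erase_of_mem hlast, hcard]
    · rw [himage, Finset.insert_erase hlast]
  · rintro ⟨p, hp, rfl⟩
    refine ⟨?_, Finset.mem_insert_self _ _⟩
    rw [Finset.card_insert_of_notMem (last_notMem_image_castSucc p),
      Finset.card_image_of_injective _ (Fin.castSucc_injective n), hp]

theorem sum_prod_coneEdges {n : ℕ} (E : Finset (Finset (Fin n))) (x : Fin (n + 1) → ℝ) :
    ∑ e ∈ coneEdges E, ∏ i ∈ e, x i =
      ∑ e ∈ E, ∏ i ∈ e, x i.castSucc +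
        x (Fin.last n) * ∑ p ∈ Finset.powersetCard 2 (Finset.univ : Finset (Fin n)),
          ∏ i ∈ p, x i.castSucc := by
  have hinj := Finset.image_injective (Fin.castSucc_injective n)
  have hdisj : Disjoint (E.image (Finset.image Fin.castSucc))
      ((Finset.univ : Finset (Finset (Fin (n + 1)))).filter
        (fun e => e.card = 3 ∧ Fin.last n ∈ e)) := by
    rw [Finset.disjoint_left]
    intro e he he'
    obtain ⟨f, -, rfl⟩ := Finset.mem_image.mp he
    exact last_notMem_image_castSucc f (Finset.mem_filter.mp he').2.2
  rw [coneEdges, Finset.sum_union hdisj, filter_last_mem_eq_image,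
    Finset.sum_image hinj.injOn, Finset.sum_image, Finset.mul_sum]
  · congr 1
    · exact Finset.sum_congr rfl fun e _ => Finset.prod_image (Fin.castSucc_injective n).injOn
    · refine Finset.sum_congr rfl fun p _ => ?_
      rw [Finset.prod_insert (last_notMem_image_castSucc p),
        Finset.prod_image (Fin.castSucc_injective n).injOn]
  · intro p _ q _ hpq
    apply hinj
    rw [← Finset.erase_insert (last_notMem_image_castSucc p),
      ← Finset.erase_insert (last_notMem_image_castSucc q)]
    exact congrArg (fun s => s.erase (Fin.last n)) hpq

theorem le_lagrangian {n : ℕ} (E : Finset (Finset (Fin n))) (x : Fin n → ℝ)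
    (hnonneg : ∀ i, 0 ≤ x i) (hsum : ∑ i, x i = 1) :
    6 * ∑ e ∈ E, ∏ i ∈ e, x i ≤ lagrangian E := by
  refine le_csSup ⟨6 * E.card, ?_⟩ ⟨x, hnonneg, hsum, rfl⟩
  rintro _ ⟨y, hy, hysum, rfl⟩
  have hle : ∀ i, y i ≤ 1 := fun i =>
    hysum ▸ Finset.single_le_sum (fun j _ => hy j) (Finset.mem_univ i)
  have hbound : ∑ e ∈ E, ∏ i ∈ e, y i ≤ ∑ _e ∈ E, (1 : ℝ) :=
    Finset.sum_le_sum fun e _ => Finset.prod_le_one (fun i _ => hy i) fun i _ => hle i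
  rw [Finset.sum_const, nsmul_eq_mul, mul_one] at hbound
  linarith


/-- For a 3-graph `S` on `t ≥ 1` vertices one has
`λ(cone(S)) ≥ (4/9)(1 - 1/t) + 16|S|/(9t³)`; in particular if `|S| > t²/4` then
`λ(cone(S)) > 4/9`. -/
theorem cone_lagrangian_lower_bound (t : ℕ) (ht : 1 ≤ t) (E : Finset (Finset (Fin t)))
    (huniform : ∀ e ∈ E, e.card = 3) :
    (4 / 9) * (1 - 1 / (t : ℝ)) + 16 * (E.card : ℝ) / (9 * (t : ℝ) ^ 3)
        ≤ lagrangian (coneEdges E) ∧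
    ((t : ℝ) ^ 2 / 4 < (E.card : ℝ) → 4 / 9 < lagrangian (coneEdges E)) := by
  have ht0 : (0 : ℝ) < t := by exact_mod_cast ht
  have hmain : (4 / 9) * (1 - 1 / (t : ℝ)) + 16 * (E.card : ℝ) / (9 * (t : ℝ) ^ 3)
      ≤ lagrangian (coneEdges E) := by
    let x : Fin (t + 1) → ℝ := Fin.snoc (fun _ : Fin t => 2 / (3 * (t : ℝ))) (1 / 3)
    have hcast : ∀ i : Fin t, x i.castSucc = 2 / (3 * (t : ℝ)) := fun i => by simp [x]
    have hlast : x (Fin.last t) = 1 / 3 := by simp [x]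
    have hnonneg : ∀ i, 0 ≤ x i := fun i => by
      cases i using Fin.lastCases with
      | last => rw [hlast]; norm_num
      | cast i => rw [hcast]; positivity
    have hsum : ∑ i, x i = 1 := by
      simp only [Fin.sum_univ_castSucc, hcast, hlast, Finset.sum_const, Finset.card_univ,
        Fintype.card_fin, nsmul_eq_mul]
      field_simp
      norm_num
    have hE : ∑ e ∈ E, ∏ i ∈ e, x i.castSucc = E.card * (2 / (3 * (t : ℝ))) ^ 3 := by
      rw [← nsmul_eq_mul, ← Finset.sum_const]
      refine Finset.sum_congr rfl fun e he => ?_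
      simp only [hcast, Finset.prod_const, huniform e he]
    have hpairs : ∑ p ∈ Finset.powersetCard 2 (Finset.univ : Finset (Fin t)),
        ∏ i ∈ p, x i.castSucc = (t * (t - 1) / 2) * (2 / (3 * (t : ℝ))) ^ 2 := by
      rw [← Nat.cast_choose_two, ← nsmul_eq_mul]
      conv_rhs => rw [← Fintype.card_fin t, ← Finset.card_univ, ← Finset.card_powersetCard]
      rw [← Finset.sum_const]
      refine Finset.sum_congr rfl fun p hp => ?_
      simp only [hcast, Finset.prod_const, (Finset.mem_powersetCard.mp hp).2, Fintype.card_fin,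
        Finset.card_univ]
    refine le_of_eq_of_le ?_ (le_lagrangian (coneEdges E) x hnonneg hsum)
    rw [sum_prod_coneEdges, hE, hpairs, hlast]
    field_simp
    ring
  refine ⟨hmain, fun hcard => lt_of_lt_of_le ?_ hmain⟩
  have hgain : (4 / 9) * (1 - 1 / (t : ℝ)) + 16 * (E.card : ℝ) / (9 * (t : ℝ) ^ 3) - 4 / 9
      = 16 / (9 * (t : ℝ) ^ 3) * (E.card - (t : ℝ) ^ 2 / 4) := by
    field_simp
    ring
  have hpos : 0 < 16 / (9 * (t : ℝ) ^ 3) * (E.card - (t : ℝ) ^ 2 / 4) :=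
    mul_pos (by positivity) (sub_pos.mpr hcard)
  linarith
end
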